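/- arXiv:2605.00995 — 2 statements merged into one kernel-verified Lean document; each statement's English description precedes it below -/
import Mathlib

section
/- There exists an absolute constant c > 0 such that the following holds. Let r ≥ 2 and n be integers with r ≤ √(log₂ log₂ n), let δ > 0, and let P₁,…,Pₙ : 𝔽₂^m → 𝔽₂ be functions each of degree at most 3 such that rank₂(P_i) ≤ r and |Pr_{X ~ Unif(𝔽₂^m)}[P_i(X) = 1] − 1/3| ≥ δ for all i ∈ [n]. Then ‖(P₁,…,Pₙ) − Ber(1/3)^⊗n‖_TV ≥ 1 − 2^{−(log₂ n)^{c/r²}}/δ². -/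
open Finset

/-- Distribution of `f(X)` on `β` for `X` uniform on the finite type `α`. -/
noncomputable def distOf {α β : Type*} [Fintype α] [DecidableEq β] (f : α → β) (y : β) : ℝ :=
  ((Finset.univ.filter fun x => f x = y).card : ℝ) / (Fintype.card α : ℝ)

/-- Output distribution on `𝔽₂ⁿ` of the tuple `(P₁(X),…,Pₙ(X))` for uniform `X ∈ 𝔽₂^m`. -/
noncomputable def outDist {m n : ℕ} (P : Fin n → (Fin m → ZMod 2) → ZMod 2) :
    (Fin n → ZMod 2) → ℝ :=
  distOf (fun x i => P i x)

/-- Total variation distance between two distributions on a finite type. -/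
noncomputable def tvDist {β : Type*} [Fintype β] (μ ν : β → ℝ) : ℝ :=
  (1 / 2) * ∑ y, |μ y - ν y|

/-- The distribution `Ber(1/3)^{⊗n}` on `𝔽₂ⁿ`. -/
noncomputable def ber13 {n : ℕ} (y : Fin n → ZMod 2) : ℝ :=
  (1 / 3 : ℝ) ^ (Finset.univ.filter fun i => y i = 1).card *
    (2 / 3 : ℝ) ^ (n - (Finset.univ.filter fun i => y i = 1).card)

/-- `P : 𝔽₂^m → 𝔽₂` has degree at most `d`. -/
def DegLE {m : ℕ} (d : ℕ) (P : (Fin m → ZMod 2) → ZMod 2) : Prop :=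
  ∃ p : MvPolynomial (Fin m) (ZMod 2), p.totalDegree ≤ d ∧ ∀ x, MvPolynomial.eval x p = P x

/-- `rank_{d'}(P) ≤ k`. -/
def RankLE {m : ℕ} (d' k : ℕ) (P : (Fin m → ZMod 2) → ZMod 2) : Prop :=
  ∃ (Q : Fin k → (Fin m → ZMod 2) → ZMod 2) (Γ : (Fin k → ZMod 2) → ZMod 2),
    (∀ j, DegLE d' (Q j)) ∧ ∀ x, P x = Γ (fun j => Q j x)

/-- `Pr_{X uniform}[P(X) = 1]`. -/
noncomputable def prOne {m : ℕ} (P : (Fin m → ZMod 2) → ZMod 2) : ℝ :=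
  distOf P 1

/-- sign character -/
noncomputable def sg (a : ZMod 2) : ℝ := if a = 0 then 1 else -1

lemma zmod2_cases (a : ZMod 2) : a = 0 ∨ a = 1 := by
  revert a; decide

lemma sg_add (a b : ZMod 2) : sg (a + b) = sg a * sg b := by
  have h : (1 + 1 : ZMod 2) = 0 := by decide
  rcases zmod2_cases a with rfl | rfl <;> rcases zmod2_cases b with rfl | rfl <;> simp [sg, h]

lemma sg_abs (a : ZMod 2) : |sg a| = 1 := by
  rcases zmod2_cases a with rfl | rfl <;> simp [sg]

lemma sg_sq (a : ZMod 2) : sg a * sg a = 1 := by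
  rcases zmod2_cases a with rfl | rfl <;> simp [sg]

lemma sg_zero : sg 0 = 1 := by simp [sg]

lemma sg_one : sg 1 = -1 := by simp [sg]

lemma sg_sum {κ : Type*} (s : Finset κ) (f : κ → ZMod 2) :
    sg (∑ i ∈ s, f i) = ∏ i ∈ s, sg (f i) := by
  classical
  induction s using Finset.induction_on with
  | empty => simp [sg]
  | insert a s ha ih => rw [sum_insert ha, prod_insert ha, sg_add, ih]

/-- character kernel -/
noncomputable def chi {κ : Type*} [Fintype κ] (a v : κ → ZMod 2) : ℝ := sg (∑ j, a j * v j)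

lemma chi_abs {κ : Type*} [Fintype κ] (a v : κ → ZMod 2) : |chi a v| = 1 := sg_abs _

lemma chi_orth {κ : Type*} [Fintype κ] [DecidableEq κ] (v v' : κ → ZMod 2) :
    ∑ a : κ → ZMod 2, chi a v * chi a v' = if v = v' then (2:ℝ) ^ Fintype.card κ else 0 := by
  have h1 : ∀ a : κ → ZMod 2, chi a v * chi a v' = ∏ j, sg (a j * (v j + v' j)) := by
    intro a
    rw [chi, chi, ← sg_add, ← sg_sum, ← sum_add_distrib]
    simp [mul_add]
  simp_rw [h1]
  rw [← Fintype.prod_sum (fun j (b : ZMod 2) => sg (b * (v j + v' j)))]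
  have h2 : ∀ c : ZMod 2, ∑ b : ZMod 2, sg (b * c) = if c = 0 then 2 else 0 := by
    intro c
    have : (Finset.univ : Finset (ZMod 2)) = {0, 1} := by decide
    rw [this, sum_pair (by decide)]
    rcases zmod2_cases c with rfl | rfl <;> norm_num [sg]
  simp_rw [h2]
  split_ifs with h
  · subst h
    have : ∀ j, v j + v j = 0 := fun j => CharTwo.add_self_eq_zero _
    simp [this]
  · obtain ⟨j, hj⟩ := Function.ne_iff.mp h
    apply prod_eq_zero (mem_univ j)
    rw [if_neg]
    intro h0
    exact hj (by rwa [CharTwo.add_eq_zero] at h0)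

/-- quadratic functions -/
def IsQuad {m : ℕ} (q : (Fin m → ZMod 2) → ZMod 2) : Prop :=
  ∀ x y z, q (x + y + z) + q (x + y) + q (y + z) + q (x + z) + q x + q y + q z + q 0 = 0

lemma isQuad_zero {m : ℕ} : IsQuad (0 : (Fin m → ZMod 2) → ZMod 2) := by
  intro x y z; simp

lemma IsQuad.add {m : ℕ} {p q : (Fin m → ZMod 2) → ZMod 2} (hp : IsQuad p) (hq : IsQuad q) :
    IsQuad (p + q) := by
  intro x y z
  have h1 := hp x y z
  have h2 := hq x y z
  simp only [Pi.add_apply]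
  linear_combination h1 + h2

lemma IsQuad.smul {m : ℕ} {q : (Fin m → ZMod 2) → ZMod 2} (c : ZMod 2) (hq : IsQuad q) :
    IsQuad (c • q) := by
  intro x y z
  have h2 := hq x y z
  simp only [Pi.smul_apply, smul_eq_mul]
  linear_combination c * h2

lemma IsQuad.sum {m : ℕ} {κ : Type*} (s : Finset κ) (f : κ → (Fin m → ZMod 2) → ZMod 2)
    (h : ∀ i ∈ s, IsQuad (f i)) : IsQuad (∑ i ∈ s, f i) := by
  classical
  induction s using Finset.induction_on with
  | empty => simpa using isQuad_zero
  | insert a s ha ih =>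
    rw [sum_insert ha]
    exact (h a (mem_insert_self _ _)).add (ih fun i hi => h i (mem_insert_of_mem hi))

lemma isQuad_multiset {m : ℕ} (M : Multiset (Fin m)) (hM : M.card ≤ 2) :
    IsQuad (fun x => (M.map x).prod) := by
  have h2 : (2 : ZMod 2) = 0 := by decide
  have : M.card = 0 ∨ M.card = 1 ∨ M.card = 2 := by omega
  rcases this with h | h | h
  · rw [Multiset.card_eq_zero] at h
    subst h
    intro x y z
    simp
    decide
  · obtain ⟨a, rfl⟩ := Multiset.card_eq_one.mp h
    intro x y z
    simp
    linear_combination (2 * x a + 2 * y a + 2 * z a) * h2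
  · obtain ⟨a, b, rfl⟩ := Multiset.card_eq_two.mp h
    intro x y z
    simp
    ring_nf
    simp [h2, show (4 : ZMod 2) = 0 by decide]

lemma DegLE.isQuad {m : ℕ} {P : (Fin m → ZMod 2) → ZMod 2} (h : DegLE 2 P) : IsQuad P := by
  obtain ⟨p, hp, hP⟩ := h
  have : P = ∑ d ∈ p.support, (p.coeff d) • (fun x => ((Finsupp.toMultiset d).map x).prod) := by
    funext x
    rw [← hP, MvPolynomial.eval_eq', Finset.sum_apply]
    refine sum_congr rfl fun d _ => ?_
    simp only [Pi.smul_apply, smul_eq_mul]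
    congr 1
    rw [Finsupp.toMultiset_map, Finsupp.prod_toMultiset, Finsupp.prod_mapDomain_index (by simp)
      (by intros; rw [pow_add]), Finsupp.prod_fintype _ _ (by simp)]
  rw [this]
  refine IsQuad.sum _ _ fun d hd => IsQuad.smul _ (isQuad_multiset _ ?_)
  rw [Finsupp.card_toMultiset]
  exact (MvPolynomial.le_totalDegree hd).trans hp
lemma sum_sg_linear {m : ℕ} (φ : Module.Dual (ZMod 2) (Fin m → ZMod 2)) (h : φ ≠ 0) :
    ∑ x, sg (φ x) = 0 := by
  obtain ⟨v, hv⟩ : ∃ v, φ v ≠ 0 := by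
    by_contra hc
    push Not at hc
    exact h (LinearMap.ext hc)
  have hv1 : φ v = 1 := (zmod2_cases _).resolve_left hv
  have : ∑ x, sg (φ x) = ∑ x, sg (φ (x + v)) :=
    (Fintype.sum_equiv (Equiv.addRight v) _ _ (fun x => rfl)).symm
  have h2 : ∑ x, sg (φ (x + v)) = - ∑ x, sg (φ x) := by
    rw [← sum_neg_distrib]
    refine sum_congr rfl fun x _ => ?_
    rw [map_add, sg_add, hv1, sg_one]; ring
  linarith

/-- additive map over F_2 as a dual element -/
def dualOfAdd {m : ℕ} (f : (Fin m → ZMod 2) → ZMod 2) (h : ∀ x y, f (x + y) = f x + f y) :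
    Module.Dual (ZMod 2) (Fin m → ZMod 2) :=
  (AddMonoidHom.mk' f h).toZModLinearMap 2

lemma exists_functionals {m b : ℕ} (K : Submodule (ZMod 2) (Fin m → ZMod 2))
    (h : 2 ^ m ≤ Nat.card K * 2 ^ b) :
    ∃ l : Fin b → Module.Dual (ZMod 2) (Fin m → ZMod 2), ∀ x, (∀ j, l j x = 0) → x ∈ K := by
  have hq := Submodule.finrank_quotient_add_finrank K
  have hK : Nat.card K = 2 ^ Module.finrank (ZMod 2) K := by
    rw [Module.natCard_eq_pow_finrank (K := ZMod 2) (V := K)]; simp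
  have hE : Module.finrank (ZMod 2) (Fin m → ZMod 2) = m := by simp
  rw [hK, ← pow_add, Nat.pow_le_pow_iff_right (by norm_num)] at h
  have hc : Module.finrank (ZMod 2) ((Fin m → ZMod 2) ⧸ K) ≤ b := by omega
  let B := Module.finBasis (ZMod 2) ((Fin m → ZMod 2) ⧸ K)
  refine ⟨fun j => if hj : j.1 < Module.finrank (ZMod 2) ((Fin m → ZMod 2) ⧸ K) then
    (B.coord ⟨j.1, hj⟩).comp K.mkQ else 0, fun x hx => ?_⟩
  rw [← Submodule.Quotient.mk_eq_zero]
  apply B.ext_elem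
  intro i
  have := hx ⟨i.1, lt_of_lt_of_le i.2 hc⟩
  simpa using this

/-- low rank at level T -/
def Low {m : ℕ} (T : ℕ) (q : (Fin m → ZMod 2) → ZMod 2) : Prop :=
  ∃ φ : Module.Dual (ZMod 2) (Fin m → ZMod 2), (2:ℝ) ^ m ≤ |∑ x, sg (q x + φ x)| * 2 ^ T

lemma low_zero {m : ℕ} (T : ℕ) : Low T (0 : (Fin m → ZMod 2) → ZMod 2) := by
  refine ⟨0, ?_⟩
  simp [sg_zero]
  exact one_le_pow₀ (by norm_num)

lemma quad_inverse {m T : ℕ} (q : (Fin m → ZMod 2) → ZMod 2) (hq : IsQuad q) (hL : Low T q) :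
    ∃ l : Fin (2 * T + 1) → Module.Dual (ZMod 2) (Fin m → ZMod 2),
      ∀ x y, (∀ j, l j x = l j y) → q x = q y := by
  classical
  obtain ⟨φ, hφ⟩ := hL
  have c2 : ∀ a : ZMod 2, a + a = 0 := fun a => CharTwo.add_self_eq_zero a
  have t2 : (2 : ZMod 2) = 0 := by decide
  -- bilinear form
  let B : (Fin m → ZMod 2) → (Fin m → ZMod 2) → ZMod 2 := fun h x => q (x + h) + q x + q h + q 0
  have hBadd : ∀ h x y, B h (x + y) = B h x + B h y := by
    intro h x y
    have := hq x y h
    simp only [B]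
    linear_combination this - (q x + q y + q h + q 0 + q (x + h) + q (y + h)) * t2
  have hBsymm : ∀ h x, B h x = B x h := by
    intro h x; simp only [B]; rw [add_comm x h]; ring
  let Bd : (Fin m → ZMod 2) → Module.Dual (ZMod 2) (Fin m → ZMod 2) := fun h =>
    dualOfAdd (B h) (hBadd h)
  have hBd : ∀ h x, Bd h x = B h x := fun h x => rfl
  have hBdadd : ∀ h k, Bd (h + k) = Bd h + Bd k := by
    intro h k
    apply LinearMap.ext
    intro x
    rw [LinearMap.add_apply, hBd, hBd, hBd, hBsymm, hBadd, hBsymm x h, hBsymm x k]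
  let Rad : Finset (Fin m → ZMod 2) := univ.filter fun h => Bd h = 0
  have hRad : ∀ h, h ∈ Rad ↔ Bd h = 0 := by intro h; simp [Rad]
  -- the square of the sum
  have hsq : (∑ x, sg (q x + φ x)) ^ 2 ≤ 2 ^ m * Rad.card := by
    have e1 : (∑ x, sg (q x + φ x)) ^ 2 =
        ∑ h, ∑ x, sg (q (x + h) + φ (x + h)) * sg (q x + φ x) := by
      rw [sq, sum_mul_sum, sum_comm]
      rw [sum_comm (s := univ) (t := univ) (f := fun h x => sg (q (x + h) + φ (x + h)) * sg (q x + φ x))]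
      refine sum_congr rfl fun x _ => ?_
      exact (Fintype.sum_equiv (Equiv.addLeft x) _ _ (fun h => by simp)).symm
    have e2 : ∀ h, ∑ x, sg (q (x + h) + φ (x + h)) * sg (q x + φ x) =
        sg (φ h + q h + q 0) * ∑ x, sg (Bd h x) := by
      intro h
      rw [mul_sum]
      refine sum_congr rfl fun x _ => ?_
      rw [← sg_add, ← sg_add, hBd, map_add]
      congr 1
      simp only [B]
      linear_combination (φ x - q h - q 0) * t2
    rw [e1]
    calc ∑ h, ∑ x, sg (q (x + h) + φ (x + h)) * sg (q x + φ x)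
        ≤ ∑ h, if Bd h = 0 then (2:ℝ) ^ m else 0 := by
          refine sum_le_sum fun h _ => ?_
          rw [e2]
          split_ifs with h0
          · rw [h0]
            simp only [LinearMap.zero_apply, sg_zero, sum_const, card_univ]
            have := le_abs_self (sg (φ h + q h + q 0))
            rw [sg_abs] at this
            simp
            exact this
          · rw [sum_sg_linear _ h0]; simp
      _ = 2 ^ m * Rad.card := by
          rw [← sum_filter, sum_const, nsmul_eq_mul, mul_comm]
  have hcard : 2 ^ m ≤ Rad.card * 2 ^ (2 * T) := by
    have h1 : ((2:ℝ) ^ m) ^ 2 ≤ (|∑ x, sg (q x + φ x)| * 2 ^ T) ^ 2 := by gcongr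
    rw [mul_pow, sq_abs] at h1
    have h2 : ((2:ℝ) ^ m) ^ 2 ≤ 2 ^ m * Rad.card * (2 ^ T) ^ 2 :=
      h1.trans (by gcongr)
    have h3 : (2:ℝ) ^ m * 2 ^ m ≤ 2 ^ m * (Rad.card * 2 ^ (2 * T)) := by
      calc (2:ℝ) ^ m * 2 ^ m = ((2:ℝ) ^ m) ^ 2 := by ring
        _ ≤ _ := h2
        _ = _ := by ring
    have h4 := le_of_mul_le_mul_left h3 (by positivity)
    exact_mod_cast h4
  have hqadd : ∀ h ∈ Rad, ∀ x, q (x + h) = q x + q h + q 0 := by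
    intro h hh x
    have : B h x = 0 := by rw [← hBd, (hRad h).1 hh]; rfl
    simp only [B] at this
    linear_combination this - (q x + q h + q 0) * t2
  let K : Submodule (ZMod 2) (Fin m → ZMod 2) :=
    { carrier := {h | h ∈ Rad ∧ q h = q 0}
      add_mem' := by
        rintro a b ⟨ha, ha'⟩ ⟨hb, hb'⟩
        refine ⟨?_, ?_⟩
        · rw [hRad] at *; rw [hBdadd, ha, hb, add_zero]
        · rw [hqadd b hb, ha', hb']; linear_combination q 0 * t2
      zero_mem' := by
        refine ⟨?_, rfl⟩
        rw [hRad]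
        apply LinearMap.ext
        intro x
        rw [hBd]; simp [B]; linear_combination (q x + q 0) * t2
      smul_mem' := by
        intro c x hx
        rcases zmod2_cases c with rfl | rfl
        · rw [zero_smul]
          refine ⟨?_, rfl⟩
          rw [hRad]
          apply LinearMap.ext
          intro x
          rw [hBd]; simp [B]; linear_combination (q x + q 0) * t2
        · rwa [one_smul] }
  have hKcard : Rad.card ≤ 2 * Nat.card K := by
    have hK1 : Nat.card K = (Rad.filter fun h => q h = q 0).card := by
      refine Nat.subtype_card _ (p := fun h => h ∈ K) ?_
      intro x
      rw [mem_filter]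
      rfl
    rw [hK1, ← card_filter_add_card_filter_not (s := Rad) (fun h => q h = q 0), two_mul]
    gcongr 1
    rcases (Rad.filter fun h => ¬ q h = q 0).eq_empty_or_nonempty with h0 | ⟨v, hv⟩
    · rw [h0]; simp
    · rw [mem_filter] at hv
      refine card_le_card_of_injOn (fun h => h + v) ?_ (fun a _ b _ hab => add_right_cancel hab)
      intro h hh
      have hh := mem_filter.1 hh
      refine mem_filter.2 ⟨?_, ?_⟩
      · have h1 := hh.1
        have h2 := hv.1
        rw [hRad] at h1 h2 ⊢
        rw [hBdadd, h1, h2, add_zero]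
      · have e1 : ∀ a b c : ZMod 2, ¬ a = c → ¬ b = c → a + b + c = c := by decide
        rw [hqadd v hv.1, e1 _ _ _ hh.2 hv.2]
  obtain ⟨l, hl⟩ := exists_functionals (b := 2 * T + 1) K (by
    calc 2 ^ m ≤ Rad.card * 2 ^ (2 * T) := hcard
      _ ≤ 2 * Nat.card K * 2 ^ (2 * T) := by gcongr
      _ = _ := by ring)
  refine ⟨l, fun x y hxy => ?_⟩
  have hm : x + y ∈ K := by
    apply hl
    intro j
    rw [map_add, hxy j]; exact c2 _
  obtain ⟨h1, h2⟩ := hm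
  have := hqadd _ h1 y
  rw [show y + (x + y) = x by rw [add_comm x y, ← add_assoc]; funext i; simp [c2]] at this
  rw [this, h2]; linear_combination q 0 * t2
lemma sunflower_step {G ι : Type*} [AddCommGroup G] [Module (ZMod 2) G] (Lw : G → Prop)
    (h0 : Lw 0) {s d k : ℕ} (W : Fin s → G) (R : ι → Fin d → G) (I : Finset ι) (hk : k ≤ I.card) :
    (∃ M ⊆ I, k ≤ M.card ∧ ∀ i ∈ M, ∀ j ∈ M, i ≠ j → ∀ (α : Fin s → ZMod 2)
      (c e : Fin d → ZMod 2), (c ≠ 0 ∨ e ≠ 0) →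
      ¬ Lw (∑ t, α t • W t + ∑ t, c t • R i t + ∑ t, e t • R j t)) ∨
    (∃ q : G, ∃ I' ⊆ I, I.card ≤ I'.card * (1 + k * 2 ^ d) ∧
      (q = 0 ∨ ∃ (j : ι) (e : Fin d → ZMod 2), j ∈ I ∧ q = ∑ t, e t • R j t) ∧
      ∀ i ∈ I', ∃ (α : Fin s → ZMod 2) (c : Fin d → ZMod 2), c ≠ 0 ∧
        Lw (∑ t, α t • W t + ∑ t, c t • R i t + q)) := by
  classical
  have neg2 : ∀ g : G, g + g = 0 := by
    intro g
    have : (2 : ZMod 2) • g = 0 := by rw [show (2 : ZMod 2) = 0 by decide, zero_smul]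
    rwa [two_smul] at this
  rcases Nat.eq_zero_or_pos d with hd | hd
  · subst hd
    left
    refine ⟨I, Subset.rfl, hk, fun i _ j _ _ α c e hce => ?_⟩
    rcases hce with h | h <;> exact absurd (Subsingleton.elim _ _) h
  let Good : Finset ι → Prop := fun M =>
    (∀ i ∈ M, ∀ (α : Fin s → ZMod 2) (c : Fin d → ZMod 2), c ≠ 0 →
      ¬ Lw (∑ t, α t • W t + ∑ t, c t • R i t)) ∧
    ∀ i ∈ M, ∀ j ∈ M, i ≠ j → ∀ (α : Fin s → ZMod 2)
      (c e : Fin d → ZMod 2), (c ≠ 0 ∨ e ≠ 0) →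
      ¬ Lw (∑ t, α t • W t + ∑ t, c t • R i t + ∑ t, e t • R j t)
  obtain ⟨M, hM, hmax⟩ := Finset.exists_max_image (I.powerset.filter Good) Finset.card
    ⟨∅, by simp [Good]⟩
  rw [mem_filter, mem_powerset] at hM
  obtain ⟨hMI, hMg⟩ := hM
  by_cases hkM : k ≤ M.card
  · exact Or.inl ⟨M, hMI, hkM, hMg.2⟩
  right
  push Not at hkM
  let Q : Finset G := insert 0 ((M ×ˢ (univ : Finset (Fin d → ZMod 2))).image
    fun p => ∑ t, p.2 t • R p.1 t)
  have hQ : Q.card ≤ 1 + k * 2 ^ d := by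
    calc Q.card ≤ _ + 1 := card_insert_le _ _
      _ ≤ (M ×ˢ (univ : Finset (Fin d → ZMod 2))).card + 1 := by gcongr; exact card_image_le
      _ = M.card * 2 ^ d + 1 := by rw [card_product]; simp [ZMod.card]
      _ ≤ k * 2 ^ d + 1 := by gcongr
      _ = _ := by ring
  have hQe : ∀ j ∈ M, ∀ e : Fin d → ZMod 2, ∑ t, e t • R j t ∈ Q := by
    intro j hj e
    refine mem_insert_of_mem (mem_image.2 ⟨(j, e), ?_, rfl⟩)
    simp [hj]
  have key : ∀ i ∈ I, ∃ q ∈ Q, ∃ (α : Fin s → ZMod 2) (c : Fin d → ZMod 2), c ≠ 0 ∧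
        Lw (∑ t, α t • W t + ∑ t, c t • R i t + q) := by
    intro i hi
    by_cases hiM : i ∈ M
    · refine ⟨_, hQe i hiM (fun _ => 1), 0, fun _ => 1, ?_, ?_⟩
      · intro h
        have := congrFun h ⟨0, hd⟩
        simp at this
      · rw [add_assoc, neg2]; simpa using h0
    · by_contra hcon
      push Not at hcon
      have hg : Good (insert i M) := by
        have hs : ∀ (α : Fin s → ZMod 2) (c : Fin d → ZMod 2), c ≠ 0 →
            ¬ Lw (∑ t, α t • W t + ∑ t, c t • R i t) := by
          intro α c hc
          have := hcon 0 (mem_insert_self _ _) α c hc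
          rwa [add_zero] at this
        have hp : ∀ j ∈ M, ∀ (α : Fin s → ZMod 2) (c e : Fin d → ZMod 2), (c ≠ 0 ∨ e ≠ 0) →
            ¬ Lw (∑ t, α t • W t + ∑ t, c t • R i t + ∑ t, e t • R j t) := by
          intro j hj α c e hce
          by_cases hc : c = 0
          · subst hc
            have he : e ≠ 0 := by tauto
            have := hMg.1 j hj α e he
            simpa using this
          · exact hcon _ (hQe j hj e) α c hc
        refine ⟨?_, ?_⟩
        · intro j hj
          rcases mem_insert.1 hj with rfl | hj
          · exact hs
          · exact hMg.1 j hj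
        · intro a ha b hb hab α c e hce
          rcases mem_insert.1 ha with ha' | ha' <;> rcases mem_insert.1 hb with hb' | hb'
          · exact absurd (ha'.trans hb'.symm) hab
          · rw [ha']; exact hp b hb' α c e hce
          · have := hp a ha' α e c hce.symm
            rw [hb']
            rwa [add_right_comm] at this
          · exact hMg.2 a ha' b hb' hab α c e hce
      have := hmax (insert i M) (by
        rw [mem_filter, mem_powerset]
        exact ⟨insert_subset hi hMI, hg⟩)
      rw [card_insert_of_notMem hiM] at this
      omega
  choose! f hfQ hf using key
  obtain ⟨q, hqQ, hqmax⟩ := Finset.exists_max_image Q (fun q => (I.filter fun i => f i = q).card)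
    ⟨0, mem_insert_self _ _⟩
  refine ⟨q, I.filter fun i => f i = q, filter_subset _ _, ?_, ?_, ?_⟩
  · calc I.card ≤ _ * Q.card := card_le_mul_card_image_of_maps_to hfQ _ hqmax
      _ ≤ _ := by gcongr
  · rcases mem_insert.1 hqQ with h | h
    · exact Or.inl h
    · obtain ⟨p, hp, hpe⟩ := mem_image.1 h
      rw [mem_product] at hp
      exact Or.inr ⟨p.1, p.2, hMI hp.1, hpe.symm⟩
  · intro i hi
    rw [mem_filter] at hi
    have := hf i hi.1
    rwa [hi.2] at this

lemma solve_coord {d : ℕ} (c v : Fin (d + 1) → ZMod 2) (j : Fin (d + 1)) (hj : c j ≠ 0) :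
    v j = ∑ t, c t * v t + ∑ t, c (j.succAbove t) * v (j.succAbove t) := by
  rw [Fin.sum_univ_succAbove _ j, (zmod2_cases (c j)).resolve_left hj, one_mul, add_assoc,
    CharTwo.add_self_eq_zero, add_zero]

lemma solve_all {d : ℕ} (c v v' : Fin (d + 1) → ZMod 2) (j : Fin (d + 1)) (hj : c j ≠ 0)
    (h1 : ∀ t, v (j.succAbove t) = v' (j.succAbove t)) (h2 : ∑ t, c t * v t = ∑ t, c t * v' t) :
    ∀ t, v t = v' t := by
  intro t
  rcases Fin.eq_self_or_eq_succAbove j t with rfl | ⟨u, rfl⟩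
  · rw [solve_coord c v t hj, solve_coord c v' t hj, h2]
    simp only [h1]
  · exact h1 u

lemma linStage {m : ℕ} {ι : Type*} (k D : ℕ) (hk : 1 ≤ k) : ∀ (d : ℕ), d ≤ D → ∀ (s : ℕ)
    (W : Fin s → Module.Dual (ZMod 2) (Fin m → ZMod 2))
    (l : ι → Fin d → Module.Dual (ZMod 2) (Fin m → ZMod 2)) (I : Finset ι),
    k * (1 + k * 2 ^ D) ^ d ≤ I.card →
    ∃ (s' d' : ℕ) (W' : Fin s' → Module.Dual (ZMod 2) (Fin m → ZMod 2))
      (l' : ι → Fin d' → Module.Dual (ZMod 2) (Fin m → ZMod 2)) (M : Finset ι),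
      s' ≤ s + d ∧ d' ≤ d ∧ M ⊆ I ∧ k ≤ M.card ∧
      (∀ i ∈ M, ∀ j ∈ M, i ≠ j → ∀ (α : Fin s' → ZMod 2) (c e : Fin d' → ZMod 2),
        (c ≠ 0 ∨ e ≠ 0) →
        (∑ t, α t • W' t + ∑ t, c t • l' i t + ∑ t, e t • l' j t) ≠ 0) ∧
      (∀ i ∈ M, ∀ x y, (∀ t, W' t x = W' t y) → (∀ t, l' i t x = l' i t y) →
        (∀ t, W t x = W t y) ∧ (∀ t, l i t x = l i t y)) := by
  intro d
  induction d with
  | zero =>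
    intro _ s W l I hI
    refine ⟨s, 0, W, l, I, le_rfl, le_rfl, Subset.rfl, by simpa using hI, ?_, ?_⟩
    · intro i _ j _ _ α c e hce
      rcases hce with h | h <;> exact absurd (Subsingleton.elim _ _) h
    · intro i _ x y h1 h2
      exact ⟨h1, h2⟩
  | succ d ih =>
    intro hd s W l I hI
    have hpos : 0 < (1 + k * 2 ^ D) := by positivity
    have hkI : k ≤ I.card := le_trans (Nat.le_mul_of_pos_right _ (by positivity)) hI
    rcases sunflower_step (fun g : Module.Dual (ZMod 2) (Fin m → ZMod 2) => g = 0) rfl W l I hkI with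
      ⟨M, hMI, hkM, hM⟩ | ⟨q, I', hI', hcard, -, hq⟩
    · exact ⟨s, d + 1, W, l, M, by omega, le_rfl, hMI, hkM, hM, fun i _ x y h1 h2 => ⟨h1, h2⟩⟩
    · choose! α c hc hlow using hq
      have : ∀ i, ∃ j, i ∈ I' → c i j ≠ 0 := by
        intro i
        by_cases hi : i ∈ I'
        · obtain ⟨j, hj⟩ := Function.ne_iff.1 (hc i hi)
          exact ⟨j, fun _ => hj⟩
        · exact ⟨0, fun h => absurd h hi⟩
      choose J hJ using this
      have hc' : I.card ≤ I'.card * (1 + k * 2 ^ D) := by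
        refine hcard.trans ?_
        gcongr
        norm_num
      obtain ⟨s', d', W', l', M, h1, h2, h3, h4, h5, h6⟩ := ih (by omega) (s + 1)
        (Fin.cons q W) (fun i t => l i ((J i).succAbove t)) I' (by
          rw [pow_succ, ← mul_assoc] at hI
          exact Nat.le_of_mul_le_mul_right (hI.trans hc') hpos)
      refine ⟨s', d', W', l', M, by omega, by omega, h3.trans hI', h4, h5, ?_⟩
      intro i hi x y hx hy
      obtain ⟨g1, g2⟩ := h6 i hi x y hx hy
      have gq : q x = q y := by simpa using g1 0
      have gW : ∀ t, W t x = W t y := fun t => by simpa using g1 t.succ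
      refine ⟨gW, ?_⟩
      refine solve_all (c i) (fun t => l i t x) (fun t => l i t y) (J i) (hJ i (h3 hi)) g2 ?_
      have hl := hlow i (h3 hi)
      have ex : ∀ z, ∑ t, c i t * l i t z = ∑ t, α i t * W t z + q z := by
        intro z
        have := congrArg (fun f : Module.Dual (ZMod 2) (Fin m → ZMod 2) => f z) hl
        simp only [LinearMap.add_apply, LinearMap.sum_apply, LinearMap.smul_apply, smul_eq_mul,
          LinearMap.zero_apply] at this
        have t2 : (2 : ZMod 2) = 0 := by decide
        linear_combination this - (∑ t, α i t * W t z + q z) * t2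
      rw [ex, ex, gq]
      simp only [gW]

lemma quadStage {m : ℕ} {ι : Type*} (P : ι → (Fin m → ZMod 2) → ZMod 2) (r k A : ℕ) (hk : 1 ≤ k)
    (hA : 1 ≤ A) : ∀ (v u s d D : ℕ)
    (W : Fin s → (Fin m → ZMod 2) → ZMod 2)
    (R : ι → Fin d → (Fin m → ZMod 2) → ZMod 2)
    (l : ι → Fin D → Module.Dual (ZMod 2) (Fin m → ZMod 2)) (I : Finset ι),
    2 * d + s ≤ v → v + u ≤ 2 * r → D + A ≤ 16 ^ u * A →
    (∀ t, IsQuad (W t)) → (∀ i ∈ I, ∀ t, IsQuad (R i t)) →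
    (∀ i ∈ I, ∀ x y, (∀ t, W t x = W t y) → (∀ t, R i t x = R i t y) →
      (∀ t, l i t x = l i t y) → P i x = P i y) →
    k * (1 + k * 2 ^ r) ^ v ≤ I.card →
    ∃ (T s d D : ℕ) (W : Fin s → (Fin m → ZMod 2) → ZMod 2)
      (R : ι → Fin d → (Fin m → ZMod 2) → ZMod 2)
      (l : ι → Fin D → Module.Dual (ZMod 2) (Fin m → ZMod 2)) (M : Finset ι),
      2 * d + s ≤ 2 * r ∧ D + A ≤ 16 ^ (2 * r) * A ∧ 7 * (D + A) ≤ T ∧ k ≤ M.card ∧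
      (∀ i ∈ M, ∀ x y, (∀ t, W t x = W t y) → (∀ t, R i t x = R i t y) →
        (∀ t, l i t x = l i t y) → P i x = P i y) ∧
      (∀ i ∈ M, ∀ j ∈ M, i ≠ j → ∀ (α : Fin s → ZMod 2) (c e : Fin d → ZMod 2),
        (α ≠ 0 ∨ c ≠ 0 ∨ e ≠ 0) →
        ¬ Low T (∑ t, α t • W t + ∑ t, c t • R i t + ∑ t, e t • R j t)) := by
  classical
  have t2 : (2 : ZMod 2) = 0 := by decide
  intro v
  induction v with
  | zero =>
    intro u s d D W R l I hv huv hD hWq hRq hdet hI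
    obtain rfl : d = 0 := by omega
    obtain rfl : s = 0 := by omega
    refine ⟨7 * (D + A), 0, 0, D, W, R, l, I, by omega, hD.trans ?_, le_rfl, by simpa using hI, hdet, ?_⟩
    · gcongr
      · norm_num
      · omega
    · intro i _ j _ _ α c e h
      rcases h with h | h | h <;> exact absurd (Subsingleton.elim _ _) h
  | succ v ih =>
    intro u s d D W R l I hv huv hD hWq hRq hdet hI
    have hpos : 0 < (1 + k * 2 ^ r) := by positivity
    have hkI : k ≤ I.card := le_trans (Nat.le_mul_of_pos_right _ (by positivity)) hI
    let T := 7 * (16 ^ u * A)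
    have hDu : D + A ≤ 16 ^ (2 * r) * A := by
      refine hD.trans ?_
      gcongr
      · norm_num
      · omega
    have hD' : D + (2 * T + 1) + A ≤ 16 ^ (u + 1) * A := by
      have : 1 ≤ 16 ^ u * A := Nat.mul_pos (by positivity) hA
      rw [pow_succ, mul_right_comm]
      simp only [T]
      omega
    by_cases hW : ∃ α : Fin s → ZMod 2, α ≠ 0 ∧ Low T (∑ t, α t • W t)
    · obtain ⟨α, hα, hlow⟩ := hW
      cases s with
      | zero => exact absurd (Subsingleton.elim _ _) hα
      | succ s =>
        obtain ⟨J, hJ⟩ := Function.ne_iff.1 hα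
        obtain ⟨κ, hκ⟩ := quad_inverse _ (IsQuad.sum _ _ fun t _ => (hWq t).smul (α t)) hlow
        refine ih (u + 1) s d (D + (2 * T + 1)) (fun t => W (J.succAbove t)) R
          (fun i => Fin.append (l i) κ) I (by omega) (by omega) hD' (fun t => hWq _) hRq ?_ ?_
        · intro i hi x y h1 h2 h3
          have h3l : ∀ t, l i t x = l i t y := fun t => by
            simpa using h3 (Fin.castAdd _ t)
          have h3k : ∀ t, κ t x = κ t y := fun t => by
            simpa using h3 (Fin.natAdd _ t)
          refine hdet i hi x y ?_ h2 h3l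
          refine solve_all α (fun t => W t x) (fun t => W t y) J hJ h1 ?_
          have := hκ x y h3k
          simpa [Finset.sum_apply] using this
        · refine le_trans ?_ hI
          gcongr
          · omega
    push Not at hW
    rcases sunflower_step (Low T) (low_zero T) W R I hkI with
      ⟨M, hMI, hkM, hM⟩ | ⟨q, I', hI', hcard, hqf, hq⟩
    · refine ⟨T, s, d, D, W, R, l, M, by omega, hDu, by simp only [T]; omega, hkM,
        fun i hi => hdet i (hMI hi), ?_⟩
      intro i hi j hj hij α c e h
      by_cases hce : c ≠ 0 ∨ e ≠ 0
      · exact hM i hi j hj hij α c e hce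
      · push Not at hce
        obtain ⟨rfl, rfl⟩ := hce
        have := hW α (by tauto)
        simpa using this
    · have hI'0 : I'.Nonempty := by
        rw [← card_pos]
        by_contra h0
        have : I'.card = 0 := by omega
        rw [this] at hcard
        omega
      cases d with
      | zero =>
        obtain ⟨i, hi⟩ := hI'0
        obtain ⟨α, c, hc, -⟩ := hq i hi
        exact absurd (Subsingleton.elim _ _) hc
      | succ d =>
        have hqq : IsQuad q := by
          rcases hqf with rfl | ⟨j, e, hj, rfl⟩
          · exact isQuad_zero
          · exact IsQuad.sum _ _ fun t _ => (hRq j hj t).smul _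
        choose! α c hc hlow using hq
        have : ∀ i, ∃ j, i ∈ I' → c i j ≠ 0 := by
          intro i
          by_cases hi : i ∈ I'
          · obtain ⟨j, hj⟩ := Function.ne_iff.1 (hc i hi)
            exact ⟨j, fun _ => hj⟩
          · exact ⟨0, fun h => absurd h hi⟩
        choose J hJ using this
        have : ∀ i, ∃ κ : Fin (2 * T + 1) → Module.Dual (ZMod 2) (Fin m → ZMod 2), i ∈ I' →
            ∀ x y, (∀ j, κ j x = κ j y) → (∑ t, α i t • W t + ∑ t, c i t • R i t + q) x =
              (∑ t, α i t • W t + ∑ t, c i t • R i t + q) y := by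
          intro i
          by_cases hi : i ∈ I'
          · obtain ⟨κ, hκ⟩ := quad_inverse _ (((IsQuad.sum _ _ fun t _ => (hWq t).smul (α i t)).add
              (IsQuad.sum _ _ fun t _ => (hRq i (hI' hi) t).smul (c i t))).add hqq) (hlow i hi)
            exact ⟨κ, fun _ => hκ⟩
          · exact ⟨fun _ => 0, fun h => absurd h hi⟩
        choose κ hκ using this
        have hc' : I.card ≤ I'.card * (1 + k * 2 ^ r) := by
          refine hcard.trans ?_
          gcongr
          · norm_num
          · omega
        refine ih (u + 1) (s + 1) d (D + (2 * T + 1)) (Fin.cons q W)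
          (fun i t => R i ((J i).succAbove t))
          (fun i => Fin.append (l i) (κ i)) I' (by omega) (by omega) hD' ?_
          (fun i hi t => hRq i (hI' hi) _) ?_ ?_
        · intro t
          refine Fin.cases ?_ (fun t => ?_) t
          · simpa using hqq
          · simpa using hWq t
        · intro i hi x y h1 h2 h3
          have h3l : ∀ t, l i t x = l i t y := fun t => by
            simpa using h3 (Fin.castAdd _ t)
          have h3k : ∀ t, κ i t x = κ i t y := fun t => by
            simpa using h3 (Fin.natAdd _ t)
          have gq : q x = q y := by simpa using h1 0
          have gW : ∀ t, W t x = W t y := fun t => by simpa using h1 t.succ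
          refine hdet i (hI' hi) x y gW ?_ h3l
          refine solve_all (c i) (fun t => R i t x) (fun t => R i t y) (J i) (hJ i hi) h2 ?_
          have := hκ i hi x y h3k
          simp only [Pi.add_apply, Finset.sum_apply, Pi.smul_apply, smul_eq_mul, gW, gq] at this
          exact add_left_cancel (add_right_cancel this)
        · rw [pow_succ, ← mul_assoc] at hI
          exact Nat.le_of_mul_le_mul_right (hI.trans hc') hpos
lemma fourier_bound {X Ω Ω' : Type*} [Fintype X] [Fintype Ω] [Fintype Ω'] [DecidableEq Ω]
    (e : Ω' → Ω → ℝ) (N B : ℝ) (hN : 0 < N) (hB : 0 ≤ B)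
    (horth : ∀ z z', ∑ a, e a z * e a z' = if z = z' then N else 0)
    (he : ∀ a z, |e a z| ≤ 1) (F : Ω → ℝ) (hF : ∀ z, |F z| ≤ 1) (Z : X → Ω)
    (h : ∀ a, (∑ z, F z * e a z = 0) ∨ |∑ x, e a (Z x)| ≤ B) :
    N * |∑ x, F (Z x)| ≤ Fintype.card Ω' * (Fintype.card Ω * B) := by
  have e1 : N * ∑ x, F (Z x) = ∑ a, (∑ z, F z * e a z) * ∑ x, e a (Z x) := by
    calc N * ∑ x, F (Z x) = ∑ x, ∑ z, F z * (if z = Z x then N else 0) := by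
          rw [mul_sum]
          refine sum_congr rfl fun x _ => ?_
          simp [mul_comm]
      _ = ∑ x, ∑ z, ∑ a, F z * e a z * e a (Z x) := by
          refine sum_congr rfl fun x _ => sum_congr rfl fun z _ => ?_
          rw [← horth, mul_sum]
          simp only [mul_assoc]
      _ = ∑ a, ∑ x, ∑ z, F z * e a z * e a (Z x) := by
          rw [sum_comm]
          conv_lhs => enter [2, z]; rw [sum_comm]
          rw [sum_comm]
          refine sum_congr rfl fun a _ => ?_
          rw [sum_comm]
      _ = _ := by
          refine sum_congr rfl fun a _ => ?_
          rw [sum_mul_sum, sum_comm]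
  rw [← abs_of_pos hN, ← abs_mul, e1]
  refine (abs_sum_le_sum_abs _ _).trans ?_
  have : ∀ a ∈ (univ : Finset Ω'), |(∑ z, F z * e a z) * ∑ x, e a (Z x)| ≤ Fintype.card Ω * B := by
    intro a _
    rw [abs_mul]
    rcases h a with h0 | h0
    · rw [h0]; simp; positivity
    · have : |∑ z, F z * e a z| ≤ Fintype.card Ω := by
        refine (abs_sum_le_sum_abs _ _).trans ?_
        calc ∑ z, |F z * e a z| ≤ ∑ z : Ω, (1:ℝ) := by
              refine sum_le_sum fun z _ => ?_
              rw [abs_mul]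
              exact mul_le_one₀ (hF z) (abs_nonneg _) (he a z)
          _ = _ := by simp
      gcongr
  refine (sum_le_sum this).trans ?_
  simp

lemma pair_bound {X κ μ : Type*} [Fintype X] [Fintype κ] [Fintype μ] [DecidableEq κ]
    [DecidableEq μ] (W : X → κ → ZMod 2) (Y Y' : X → μ → ZMod 2) (B : ℝ) (hB : 0 ≤ B)
    (h : ∀ (α : κ → ZMod 2) (a b : μ → ZMod 2), (a ≠ 0 ∨ b ≠ 0) →
      |∑ x, sg (∑ t, α t * W x t + ∑ t, a t * Y x t + ∑ t, b t * Y' x t)| ≤ B)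
    (f g : (κ → ZMod 2) → (μ → ZMod 2) → ℝ) (hf : ∀ w y, |f w y| ≤ 1) (hg : ∀ w y, |g w y| ≤ 1)
    (hf0 : ∀ w, ∑ y, f w y = 0) (hg0 : ∀ w, ∑ y, g w y = 0) :
    |∑ x, f (W x) (Y x) * g (W x) (Y' x)| ≤
      2 ^ (Fintype.card κ + 2 * Fintype.card μ) * B := by
  let Ω := (κ → ZMod 2) × (μ → ZMod 2) × (μ → ZMod 2)
  let e : Ω → Ω → ℝ := fun a z => chi a.1 z.1 * (chi a.2.1 z.2.1 * chi a.2.2 z.2.2)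
  have hcard : (Fintype.card Ω : ℝ) = 2 ^ (Fintype.card κ + 2 * Fintype.card μ) := by
    simp [Ω, ZMod.card]
    ring
  have key := fourier_bound (X := X) e ((2:ℝ) ^ (Fintype.card κ + 2 * Fintype.card μ)) B
    (by positivity) hB ?_ ?_ (fun z => f z.1 z.2.1 * g z.1 z.2.2) ?_
    (fun x => (W x, Y x, Y' x)) ?_
  · rw [hcard] at key
    exact le_of_mul_le_mul_left key (by positivity)
  · rintro ⟨w, y, y'⟩ ⟨w1, y1, y1'⟩
    have : ∀ a : Ω, e a (w, y, y') * e a (w1, y1, y1') = (chi a.1 w * chi a.1 w1) *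
      ((chi a.2.1 y * chi a.2.1 y1) * (chi a.2.2 y' * chi a.2.2 y1')) := by
      intro a; simp only [e]; ring
    rw [sum_congr rfl fun a _ => this a]
    simp only [Ω, Fintype.sum_prod_type, ← mul_sum, ← sum_mul, chi_orth]
    simp only [Prod.mk.injEq]
    by_cases h1 : w = w1 <;> by_cases h2 : y = y1 <;> by_cases h3 : y' = y1' <;> simp [h1, h2, h3]
    ring
  · intro a z
    simp only [e, abs_mul, chi_abs]; norm_num
  · intro z
    rw [abs_mul]
    exact mul_le_one₀ (hf _ _) (abs_nonneg _) (hg _ _)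
  · rintro ⟨α, a, b⟩
    by_cases hab : a ≠ 0 ∨ b ≠ 0
    · right
      have := h α a b hab
      simp only [sg_add, mul_assoc] at this
      exact this
    · left
      push Not at hab
      obtain ⟨rfl, rfl⟩ := hab
      have c0 : ∀ y : μ → ZMod 2, chi 0 y = 1 := by intro y; simp [chi, sg_zero]
      simp only [e, c0, mul_one]
      rw [Fintype.sum_prod_type]
      refine sum_eq_zero fun w _ => ?_
      rw [Fintype.sum_prod_type]
      simp only [← sum_mul, ← mul_sum, hg0]
      simp

lemma distOf_sum {α β : Type*} [Fintype α] [Fintype β] [DecidableEq β] (f : α → β) (φ : β → ℝ) :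
    ∑ y, φ y * distOf f y = (∑ x, φ (f x)) / Fintype.card α := by
  simp only [distOf, ← mul_div_assoc]
  rw [← sum_div]
  congr 1
  have : ∀ y, φ y * ((univ.filter fun x => f x = y).card : ℝ) =
      ∑ x, if f x = y then φ y else 0 := by
    intro y
    rw [← sum_filter, sum_const, nsmul_eq_mul, mul_comm]
  simp_rw [this]
  rw [sum_comm]
  simp

lemma tv_ge {β : Type*} [Fintype β] (μ ν : β → ℝ) (T : Finset β) [DecidableEq β]
    (hμ1 : ∑ y, μ y = 1) (hν1 : ∑ y, ν y = 1) :
    1 - (∑ y, (if y ∈ T then 0 else 1) * μ y) - (∑ y, (if y ∈ T then 1 else 0) * ν y)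
      ≤ tvDist μ ν := by
  have : ∀ y, μ y + ν y - 2 * ((if y ∈ T then 0 else 1) * μ y)
      - 2 * ((if y ∈ T then 1 else 0) * ν y) ≤ |μ y - ν y| := by
    intro y
    split_ifs
    · have := le_abs_self (μ y - ν y); linarith
    · have := neg_abs_le (μ y - ν y); linarith
  have h := sum_le_sum fun y (_ : y ∈ univ) => this y
  rw [sum_sub_distrib, sum_sub_distrib, sum_add_distrib, hμ1, hν1, ← mul_sum, ← mul_sum] at h
  rw [tvDist]
  linarith

/-- Bernoulli weight -/
noncomputable def bw (b : ZMod 2) : ℝ := if b = 1 then 1 / 3 else 2 / 3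

/-- real value of a bit -/
noncomputable def rv (b : ZMod 2) : ℝ := if b = 1 then 1 else 0

lemma ber13_eq {n : ℕ} (y : Fin n → ZMod 2) : ber13 y = ∏ i, bw (y i) := by
  unfold ber13 bw
  rw [prod_ite, prod_const, prod_const]
  congr 2
  have := card_filter_add_card_filter_not (s := (univ : Finset (Fin n))) (fun i => y i = 1)
  simp at this
  omega

lemma sum_zmod2 (f : ZMod 2 → ℝ) : ∑ b, f b = f 0 + f 1 := by
  have : (Finset.univ : Finset (ZMod 2)) = {0, 1} := by decide
  rw [this, sum_pair (by decide)]

lemma ber13_sum {n : ℕ} : ∑ y : Fin n → ZMod 2, ber13 y = 1 := by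
  simp_rw [ber13_eq]
  rw [← Fintype.prod_sum (fun (_ : Fin n) (b : ZMod 2) => bw b)]
  simp only [sum_zmod2, bw]
  norm_num

lemma ber13_nonneg {n : ℕ} (y : Fin n → ZMod 2) : 0 ≤ ber13 y := by
  unfold ber13; positivity

lemma ber13_cross {n : ℕ} (i j : Fin n) (hij : i ≠ j) :
    ∑ y : Fin n → ZMod 2, (rv (y i) - 1 / 3) * (rv (y j) - 1 / 3) * ber13 y = 0 := by
  have : ∀ y : Fin n → ZMod 2, (rv (y i) - 1 / 3) * (rv (y j) - 1 / 3) * ber13 y =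
      ∏ t, ((if t = i then rv (y t) - 1 / 3 else 1) * (if t = j then rv (y t) - 1 / 3 else 1)
        * bw (y t)) := by
    intro y
    rw [prod_mul_distrib, prod_mul_distrib, ber13_eq]
    simp
  simp_rw [this]
  rw [← Fintype.prod_sum (fun (t : Fin n) (b : ZMod 2) =>
    ((if t = i then rv b - 1 / 3 else 1) * (if t = j then rv b - 1 / 3 else 1) * bw b))]
  apply prod_eq_zero (mem_univ i)
  simp only [sum_zmod2, if_true, if_neg hij]
  have h01 : (0 : ZMod 2) ≠ 1 := by decide
  norm_num [rv, bw, h01]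
lemma second_moment {X ι : Type*} [Fintype X] [DecidableEq ι] (w : X → ℝ) (F : ι → X → ℝ)
    (S : Finset ι) (C1 C2 : ℝ) (h2 : 0 ≤ C2)
    (hd : ∀ i ∈ S, ∑ x, F i x * F i x * w x ≤ C1)
    (ho : ∀ i ∈ S, ∀ j ∈ S, i ≠ j → ∑ x, F i x * F j x * w x ≤ C2) :
    ∑ x, (∑ i ∈ S, F i x) ^ 2 * w x ≤ S.card * C1 + (S.card : ℝ) ^ 2 * C2 := by
  have e : ∑ x, (∑ i ∈ S, F i x) ^ 2 * w x = ∑ i ∈ S, ∑ j ∈ S, ∑ x, F i x * F j x * w x := by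
    have : ∀ x, (∑ i ∈ S, F i x) ^ 2 * w x = ∑ i ∈ S, ∑ j ∈ S, F i x * F j x * w x := by
      intro x
      rw [sq, sum_mul_sum, sum_mul]
      refine sum_congr rfl fun i _ => ?_
      rw [sum_mul]
    simp_rw [this]
    rw [sum_comm]
    refine sum_congr rfl fun i _ => ?_
    rw [sum_comm]
  rw [e]
  calc ∑ i ∈ S, ∑ j ∈ S, ∑ x, F i x * F j x * w x
      ≤ ∑ i ∈ S, ∑ j ∈ S, ((if i = j then C1 else 0) + C2) := by
        refine sum_le_sum fun i hi => sum_le_sum fun j hj => ?_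
        split_ifs with hij
        · subst hij; linarith [hd i hi]
        · linarith [ho i hi j hj hij]
    _ = _ := by
        simp only [sum_add_distrib, sum_const, nsmul_eq_mul, sum_ite_eq]
        rw [← sum_filter]
        simp
        ring

lemma cheb {X : Type*} [Fintype X] (w A : X → ℝ) (hw : ∀ x, 0 ≤ w x) (Q : X → Prop)
    [DecidablePred Q] (τ : ℝ) (hτ : 0 < τ) (hQ : ∀ x, Q x → τ ≤ |A x|) :
    ∑ x, (if Q x then 1 else 0) * w x ≤ (∑ x, (A x) ^ 2 * w x) / τ ^ 2 := by
  rw [sum_div]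
  refine sum_le_sum fun x _ => ?_
  split_ifs with h
  · rw [le_div_iff₀ (by positivity), one_mul, mul_comm]
    have := hQ x h
    rw [← sq_abs (A x)]
    have := hw x
    gcongr
  · have := hw x
    rw [zero_mul]; positivity

lemma rv_abs (b : ZMod 2) (p : ℝ) (h0 : 0 ≤ p) (h1 : p ≤ 1) : |rv b - p| ≤ 1 := by
  rw [abs_le]
  unfold rv
  split_ifs <;> constructor <;> linarith

lemma dyadic_far (d c : ℕ) : 1 / (3 * (2:ℝ) ^ d) ≤ |1 / 3 - (c:ℝ) / 2 ^ d| := by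
  have h1 : ((2:ℤ) ^ d - 3 * c) ≠ 0 := by
    intro h
    have h3 : (3:ℤ) ∣ 2 ^ d := ⟨c, by linarith⟩
    have := Int.prime_three.dvd_of_dvd_pow h3
    norm_num at this
  have h2 : (1:ℝ) ≤ |(2:ℝ) ^ d - 3 * c| := by
    have := Int.one_le_abs h1
    exact_mod_cast this
  have : (1 / 3 - (c:ℝ) / 2 ^ d) = ((2:ℝ) ^ d - 3 * c) / (3 * 2 ^ d) := by
    field_simp
  rw [this, abs_div, abs_of_pos (show (0:ℝ) < 3 * 2 ^ d by positivity)]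
  gcongr

lemma tv_lower {m n : ℕ} (P : Fin n → (Fin m → ZMod 2) → ZMod 2) {κ μ : Type*} [Fintype κ]
    [Fintype μ] [DecidableEq κ] [DecidableEq μ] (W : (Fin m → ZMod 2) → κ → ZMod 2)
    (Y : Fin n → (Fin m → ZMod 2) → μ → ZMod 2) (S : Finset (Fin n)) (hS : S.Nonempty)
    (g : Fin n → (κ → ZMod 2) → (μ → ZMod 2) → ZMod 2)
    (hP : ∀ i ∈ S, ∀ x, P i x = g i (W x) (Y i x)) (η : ℝ) (hη : 0 ≤ η)
    (h : ∀ i ∈ S, ∀ j ∈ S, i ≠ j → ∀ (α : κ → ZMod 2) (a b : μ → ZMod 2), (a ≠ 0 ∨ b ≠ 0) →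
      |∑ x, sg (∑ t, α t * W x t + ∑ t, a t * Y i x t + ∑ t, b t * Y j x t)| ≤ η * 2 ^ m) :
    1 - (72 * 2 ^ (Fintype.card κ + 2 * Fintype.card μ) / S.card +
      36 * 2 ^ (Fintype.card κ + 4 * Fintype.card μ) * η) ≤ tvDist (outDist P) ber13 := by
  classical
  set p := Fintype.card κ with hp
  set d := Fintype.card μ with hd
  set k : ℝ := (S.card : ℝ) with hk
  have hkpos : 0 < k := by rw [hk]; exact_mod_cast hS.card_pos
  let pr : Fin n → (κ → ZMod 2) → ℝ := fun i w => (∑ y, rv (g i w y)) / 2 ^ d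
  have hcμ : (Fintype.card (μ → ZMod 2) : ℝ) = 2 ^ d := by simp [ZMod.card, hd]
  have hcκ : (Fintype.card (κ → ZMod 2) : ℝ) = 2 ^ p := by simp [ZMod.card, hp]
  have hprc : ∀ i w, ∃ c : ℕ, pr i w = (c : ℝ) / 2 ^ d ∧ (c : ℝ) ≤ 2 ^ d := by
    intro i w
    refine ⟨(univ.filter fun y => g i w y = 1).card, ?_, ?_⟩
    · simp only [pr, rv]; rw [← sum_filter]; simp
    · rw [← hcμ]; exact_mod_cast card_le_univ _
  have hpr0 : ∀ i w, 0 ≤ pr i w := by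
    intro i w; obtain ⟨c, hc, -⟩ := hprc i w; rw [hc]; positivity
  have hpr1 : ∀ i w, pr i w ≤ 1 := by
    intro i w; obtain ⟨c, hc, hc'⟩ := hprc i w; rw [hc]; exact div_le_one_of_le₀ hc' (by positivity)
  set ε : ℝ := 1 / (3 * (2:ℝ) ^ d) with hε
  have hεpos : 0 < ε := by rw [hε]; positivity
  have hfar : ∀ i w, ε ≤ |1 / 3 - pr i w| := by
    intro i w; obtain ⟨c, hc, -⟩ := hprc i w; rw [hc]; exact dyadic_far d c
  let σ : Fin n → (κ → ZMod 2) → ℝ := fun i w => if 0 ≤ 1 / 3 - pr i w then 1 else -1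
  have hσabs : ∀ i w, |σ i w| = 1 := by intro i w; simp only [σ]; split_ifs <;> simp
  have hσ : ∀ i w, σ i w * (1 / 3 - pr i w) = |1 / 3 - pr i w| := by
    intro i w; simp only [σ]; split_ifs with h0
    · rw [abs_of_nonneg h0]; ring
    · rw [abs_of_neg (not_le.1 h0)]; ring
  let f : Fin n → (κ → ZMod 2) → (μ → ZMod 2) → ℝ := fun i w y => σ i w * (rv (g i w y) - pr i w)
  have hf1 : ∀ i w y, |f i w y| ≤ 1 := by
    intro i w y
    simp only [f]
    rw [abs_mul, hσabs, one_mul]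
    exact rv_abs _ _ (hpr0 _ _) (hpr1 _ _)
  have hf0 : ∀ i w, ∑ y, f i w y = 0 := by
    intro i w
    simp only [f]
    rw [← mul_sum, sum_sub_distrib, sum_const, card_univ, nsmul_eq_mul, hcμ]
    simp only [pr]
    field_simp
    ring
  let A : (κ → ZMod 2) → (Fin n → ZMod 2) → ℝ := fun w z => ∑ i ∈ S, σ i w * (rv (z i) - pr i w)
  let C : (κ → ZMod 2) → (Fin n → ZMod 2) → ℝ := fun w z => ∑ i ∈ S, σ i w * (rv (z i) - 1 / 3)
  set τ : ℝ := ε * k / 2 with hτ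
  have hτpos : 0 < τ := by positivity
  let T : Finset (Fin n → ZMod 2) := univ.filter fun z => ∃ w, |A w z| ≤ τ
  have hAC : ∀ w z, |A w z| ≤ τ → τ ≤ |C w z| := by
    intro w z hA
    have e : A w z = C w z + ∑ i ∈ S, |1 / 3 - pr i w| := by
      simp only [A, C]
      rw [← sum_add_distrib]
      refine sum_congr rfl fun i _ => ?_
      rw [← hσ]; ring
    have h1 : k * ε ≤ ∑ i ∈ S, |1 / 3 - pr i w| := by
      have := card_nsmul_le_sum S (fun i => |1 / 3 - pr i w|) ε (fun i _ => hfar i w)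
      rwa [nsmul_eq_mul] at this
    have h2 := (abs_le.1 hA).2
    have h3 := neg_abs_le (C w z)
    rw [e] at h2
    rw [hτ] at h2 ⊢
    linarith
  have hout1 : ∑ y, outDist P y = 1 := by
    have := distOf_sum (fun x i => P i x) (fun _ => 1)
    simp only [one_mul] at this
    unfold outDist
    rw [this]
    simp
  have htv := tv_ge (outDist P) ber13 T hout1 ber13_sum
  -- Bernoulli side
  have hν : ∑ y, (if y ∈ T then 1 else 0) * ber13 y ≤ 2 ^ p * (k / τ ^ 2) := by
    have hw : ∀ w, ∑ y, (if |A w y| ≤ τ then 1 else 0) * ber13 y ≤ k / τ ^ 2 := by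
      intro w
      refine (cheb ber13 (C w) ber13_nonneg (fun y => |A w y| ≤ τ) τ hτpos (fun y => hAC w y)).trans ?_
      gcongr
      have := second_moment (fun y : Fin n → ZMod 2 => ber13 y)
        (fun i y => σ i w * (rv (y i) - 1 / 3)) S 1 0 le_rfl ?_ ?_
      · rw [mul_one, mul_zero, add_zero] at this; exact this
      · intro i hi
        refine le_trans ?_ (ber13_sum (n := n)).le
        refine sum_le_sum fun y _ => ?_
        have h1 : |σ i w * (rv (y i) - 1 / 3)| ≤ 1 := by
          rw [abs_mul, hσabs, one_mul]
          exact rv_abs _ _ (by norm_num) (by norm_num)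
        have h2 : σ i w * (rv (y i) - 1 / 3) * (σ i w * (rv (y i) - 1 / 3)) ≤ 1 := by
          rw [← sq, sq_le_one_iff_abs_le_one]; exact h1
        have := ber13_nonneg y
        nlinarith
      · intro i hi j hj hij
        apply le_of_eq
        have := ber13_cross i j hij
        calc _ = ∑ y : Fin n → ZMod 2, σ i w * σ j w *
              ((rv (y i) - 1 / 3) * (rv (y j) - 1 / 3) * ber13 y) := by
              refine sum_congr rfl fun y _ => ?_
              ring
          _ = 0 := by rw [← mul_sum, this, mul_zero]
    calc ∑ y, (if y ∈ T then 1 else 0) * ber13 y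
        ≤ ∑ y, ∑ w, (if |A w y| ≤ τ then 1 else 0) * ber13 y := by
          refine sum_le_sum fun y _ => ?_
          have hn : ∀ w ∈ (univ : Finset (κ → ZMod 2)),
              0 ≤ (if |A w y| ≤ τ then (1:ℝ) else 0) * ber13 y := by
            intro w _
            have := ber13_nonneg y
            split_ifs <;> simp [this]
          split_ifs with hy
          · obtain ⟨w, hw⟩ := (mem_filter.1 hy).2
            have := single_le_sum hn (mem_univ w)
            rwa [if_pos hw] at this
          · rw [zero_mul]; exact sum_nonneg hn
      _ = ∑ w, ∑ y, (if |A w y| ≤ τ then 1 else 0) * ber13 y := sum_comm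
      _ ≤ ∑ w : κ → ZMod 2, k / τ ^ 2 := sum_le_sum fun w _ => hw w
      _ = _ := by rw [sum_const, card_univ, nsmul_eq_mul, hcκ]
  -- polynomial side
  have hμ : ∑ y, (if y ∈ T then 0 else 1) * outDist P y ≤
      (k + k ^ 2 * (2 ^ (p + 2 * d) * η)) / τ ^ 2 := by
    have e := distOf_sum (fun x i => P i x) (fun y => if y ∈ T then 0 else 1)
    unfold outDist
    rw [e]
    have hcm : (Fintype.card (Fin m → ZMod 2) : ℝ) = 2 ^ m := by simp [ZMod.card]
    rw [hcm, div_le_iff₀ (by positivity)]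
    have hAx : ∀ x, A (W x) (fun i => P i x) = ∑ i ∈ S, f i (W x) (Y i x) := by
      intro x
      simp only [A, f]
      refine sum_congr rfl fun i hi => ?_
      rw [hP i hi]
    have h1 := cheb (fun _ => (1:ℝ)) (fun x => A (W x) (fun i => P i x)) (fun _ => zero_le_one)
      (fun x => (fun i => P i x) ∉ T) τ hτpos (by
        intro x hx
        by_contra hc
        exact hx (mem_filter.2 ⟨mem_univ _, W x, (not_le.1 hc).le⟩))
    have h2 := second_moment (fun _ : Fin m → ZMod 2 => (1:ℝ)) (fun i x => f i (W x) (Y i x)) S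
      (2 ^ m) (2 ^ (p + 2 * d) * (η * 2 ^ m)) (by positivity) (by
        intro i _
        calc ∑ x, f i (W x) (Y i x) * f i (W x) (Y i x) * 1 ≤ ∑ x : Fin m → ZMod 2, (1:ℝ) := by
              refine sum_le_sum fun x _ => ?_
              rw [mul_one, ← sq, sq_le_one_iff_abs_le_one]
              exact hf1 _ _ _
          _ = 2 ^ m := by rw [sum_const, card_univ, nsmul_eq_mul, hcm, mul_one]) (by
        intro i hi j hj hij
        have := pair_bound W (Y i) (Y j) (η * 2 ^ m) (by positivity) (h i hi j hj hij)
          (f i) (f j) (hf1 i) (hf1 j) (hf0 i) (hf0 j)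
        simp only [mul_one]
        exact (le_abs_self _).trans this)
    simp only [mul_one, hAx] at h1 h2
    calc ∑ x, (if (fun i => P i x) ∈ T then (0:ℝ) else 1)
        = ∑ x, (if (fun i => P i x) ∉ T then (1:ℝ) else 0) := by
          refine sum_congr rfl fun x _ => ?_
          by_cases hx : (fun i => P i x) ∈ T <;> simp [hx]
      _ ≤ _ := h1
      _ ≤ (k * 2 ^ m + k ^ 2 * (2 ^ (p + 2 * d) * (η * 2 ^ m))) / τ ^ 2 := by gcongr
      _ = _ := by ring
  have hτ2 : τ ^ 2 = k ^ 2 / (36 * 2 ^ (2 * d)) := by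
    rw [hτ, hε]
    field_simp
    ring
  have e1 : 2 ^ p * (k / τ ^ 2) = 36 * 2 ^ (p + 2 * d) / k := by
    rw [hτ2]; field_simp; ring
  have e2 : (k + k ^ 2 * (2 ^ (p + 2 * d) * η)) / τ ^ 2 =
      36 * 2 ^ (2 * d) / k + 36 * 2 ^ (p + 4 * d) * η := by
    rw [hτ2]; field_simp; ring
  rw [e1] at hν
  rw [e2] at hμ
  have e3 : 36 * (2:ℝ) ^ (2 * d) / k ≤ 36 * 2 ^ (p + 2 * d) / k := by
    gcongr
    · norm_num
    · omega
  have e4 : 72 * (2:ℝ) ^ (p + 2 * d) / k = 36 * 2 ^ (p + 2 * d) / k + 36 * 2 ^ (p + 2 * d) / k := by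
    ring
  rw [e4]
  linarith
lemma core_bound (r n m K A F : ℕ) (hA : A = r + K + 2) (hF : F = 16 ^ (2 * r) * A)
    (hn : 2 ^ (34 * F ^ 3) ≤ n) (P : Fin n → (Fin m → ZMod 2) → ZMod 2)
    (hP : ∀ i, RankLE 2 r (P i)) :
    1 - 1 / (2:ℝ) ^ K ≤ tvDist (outDist P) ber13 := by
  classical
  choose Q Γ hQ hΓ using hP
  have hAF : A ≤ F := by
    rw [hF]; exact Nat.le_mul_of_pos_left _ (by positivity)
  have hF1 : 1 ≤ F := by omega
  have hF2 : F ≤ F ^ 2 := by nlinarith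
  have hF3 : F ^ 2 ≤ F ^ 3 := by
    rw [pow_succ F 2]; exact Nat.le_mul_of_pos_right _ hF1
  have two_add : ∀ a b : ℕ, a + 1 ≤ b → 1 + 2 ^ a ≤ 2 ^ b := by
    intro a b hab
    have h1 : 2 ^ (a + 1) ≤ 2 ^ b := Nat.pow_le_pow_right (by norm_num) hab
    have h2 : 1 ≤ 2 ^ a := Nat.one_le_two_pow
    rw [pow_succ] at h1
    omega
  obtain ⟨T, s, d, D, W, R, l, M, hsd, hDF, hT, hkM, hdet, hhigh⟩ :=
    quadStage P r (2 ^ (10 * F ^ 2)) A Nat.one_le_two_pow (by omega) (2 * r) 0 0 r 0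
      Fin.elim0 Q (fun _ => Fin.elim0) univ (by omega) (by omega) (by simp)
      (fun t => t.elim0) (fun i _ t => (hQ i t).isQuad) (by
        intro i _ x y _ h2 _
        rw [hΓ, hΓ]
        congr 1
        funext t
        exact h2 t) (by
        rw [card_univ, Fintype.card_fin, ← pow_add]
        refine le_trans ?_ hn
        have h1 : 1 + 2 ^ (10 * F ^ 2 + r) ≤ 2 ^ (12 * F ^ 2) := two_add _ _ (by omega)
        calc 2 ^ (10 * F ^ 2) * (1 + 2 ^ (10 * F ^ 2 + r)) ^ (2 * r)
            ≤ 2 ^ (10 * F ^ 2) * (2 ^ (12 * F ^ 2)) ^ (2 * r) := by gcongr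
          _ = 2 ^ (10 * F ^ 2 + 12 * F ^ 2 * (2 * r)) := by rw [← pow_mul, ← pow_add]
          _ ≤ 2 ^ (34 * F ^ 3) := by
            refine Nat.pow_le_pow_right (by norm_num) ?_
            have : F ^ 2 * r ≤ F ^ 3 := by
              rw [pow_succ F 2]; exact Nat.mul_le_mul_left _ (by omega)
            nlinarith)
  rw [← hF] at hDF
  obtain ⟨s', d', W', l', M', hs', hd', hM'M, hkM', hind, hdet'⟩ :=
    linStage (2 ^ (4 * F)) D Nat.one_le_two_pow D le_rfl 0 Fin.elim0 l M (by
      refine le_trans ?_ hkM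
      rw [← pow_add]
      have h1 : 1 + 2 ^ (4 * F + D) ≤ 2 ^ (6 * F) := two_add _ _ (by omega)
      calc 2 ^ (4 * F) * (1 + 2 ^ (4 * F + D)) ^ D
          ≤ 2 ^ (4 * F) * (2 ^ (6 * F)) ^ D := by gcongr
        _ = 2 ^ (4 * F + 6 * F * D) := by rw [← pow_mul, ← pow_add]
        _ ≤ 2 ^ (10 * F ^ 2) := by
          refine Nat.pow_le_pow_right (by norm_num) ?_
          have : F * D ≤ F ^ 2 := by
            rw [sq]; exact Nat.mul_le_mul_left _ (by omega)
          nlinarith)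
  let Wx : (Fin m → ZMod 2) → (Fin s ⊕ Fin s') → ZMod 2 := fun x =>
    Sum.elim (fun t => W t x) (fun t => W' t x)
  let Yx : Fin n → (Fin m → ZMod 2) → (Fin d ⊕ Fin d') → ZMod 2 := fun i x =>
    Sum.elim (fun t => R i t x) (fun t => l' i t x)
  have hfac : ∀ i ∈ M', ∀ x y, Wx x = Wx y → Yx i x = Yx i y → P i x = P i y := by
    intro i hi x y h1 h2
    have hl := (hdet' i hi x y (fun t => congrFun h1 (Sum.inr t))
      (fun t => congrFun h2 (Sum.inr t))).2
    exact hdet i (hM'M hi) x y (fun t => congrFun h1 (Sum.inl t))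
      (fun t => congrFun h2 (Sum.inl t)) hl
  let g : Fin n → ((Fin s ⊕ Fin s') → ZMod 2) → ((Fin d ⊕ Fin d') → ZMod 2) → ZMod 2 :=
    fun i w y => if h : ∃ x, Wx x = w ∧ Yx i x = y then P i h.choose else 0
  have hg : ∀ i ∈ M', ∀ x, P i x = g i (Wx x) (Yx i x) := by
    intro i hi x
    have hex : ∃ z, Wx z = Wx x ∧ Yx i z = Yx i x := ⟨x, rfl, rfl⟩
    simp only [g]
    rw [dif_pos hex]
    exact (hfac i hi _ _ hex.choose_spec.1 hex.choose_spec.2).symm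
  have hM'0 : M'.Nonempty := by
    rw [← card_pos]
    exact lt_of_lt_of_le (by positivity) hkM'
  have htv := tv_lower P Wx Yx M' hM'0 g hg (1 / 2 ^ T) (by positivity) (by
    intro i hi j hj hij α a b hab
    let φ : Module.Dual (ZMod 2) (Fin m → ZMod 2) := ∑ t, α (Sum.inr t) • W' t +
      ∑ t, a (Sum.inr t) • l' i t + ∑ t, b (Sum.inr t) • l' j t
    let q : (Fin m → ZMod 2) → ZMod 2 := ∑ t, α (Sum.inl t) • W t +
      ∑ t, a (Sum.inl t) • R i t + ∑ t, b (Sum.inl t) • R j t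
    have e : ∀ x, ∑ t, α t * Wx x t + ∑ t, a t * Yx i x t + ∑ t, b t * Yx j x t = q x + φ x := by
      intro x
      simp only [Fintype.sum_sum_type, Wx, Yx, Sum.elim_inl, Sum.elim_inr, q, φ, Pi.add_apply,
        Finset.sum_apply, Pi.smul_apply, smul_eq_mul, LinearMap.add_apply, LinearMap.sum_apply,
        LinearMap.smul_apply]
      ring
    simp_rw [e]
    by_cases hz : (fun t => α (Sum.inl t)) ≠ 0 ∨ (fun t => a (Sum.inl t)) ≠ 0 ∨
        (fun t => b (Sum.inl t)) ≠ 0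
    · have := hhigh i (hM'M hi) j (hM'M hj) hij _ _ _ hz
      unfold Low at this
      push Not at this
      have := this φ
      rw [one_div, inv_mul_eq_div, le_div_iff₀ (by positivity)]
      exact this.le
    · push Not at hz
      obtain ⟨h1, h2, h3⟩ := hz
      have hq0 : ∀ x, q x = 0 := by
        intro x
        have h1' := fun t => congrFun h1 t
        have h2' := fun t => congrFun h2 t
        have h3' := fun t => congrFun h3 t
        simp only [Pi.zero_apply] at h1' h2' h3'
        simp [q, h1', h2', h3']
      have hφ : φ ≠ 0 := by
        refine hind i hi j hj hij _ _ _ ?_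
        by_contra hc
        push Not at hc
        obtain ⟨c1, c2⟩ := hc
        rcases hab with hab | hab
        · apply hab
          funext t
          rcases t with t | t
          · exact congrFun h2 t
          · exact congrFun c1 t
        · apply hab
          funext t
          rcases t with t | t
          · exact congrFun h3 t
          · exact congrFun c2 t
      simp only [hq0, zero_add]
      rw [sum_sg_linear φ hφ, abs_zero]
      positivity)
  refine le_trans ?_ htv
  simp only [Fintype.card_sum, Fintype.card_fin]
  have b1 : 72 * (2:ℝ) ^ (s + s' + 2 * (d + d')) / M'.card ≤ 1 / 2 ^ (K + 1) := by
    have hc : (2:ℝ) ^ (4 * F) ≤ M'.card := by exact_mod_cast hkM'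
    rw [div_le_div_iff₀ (by exact_mod_cast hM'0.card_pos) (by positivity)]
    calc 72 * (2:ℝ) ^ (s + s' + 2 * (d + d')) * 2 ^ (K + 1)
        ≤ 2 ^ 7 * (2:ℝ) ^ (s + s' + 2 * (d + d')) * 2 ^ (K + 1) := by gcongr; norm_num
      _ = 2 ^ (7 + (s + s' + 2 * (d + d')) + (K + 1)) := by rw [← pow_add, ← pow_add]
      _ ≤ 2 ^ (4 * F) := pow_le_pow_right₀ (by norm_num) (by omega)
      _ ≤ _ := by rw [one_mul]; exact hc
  have b2 : 36 * (2:ℝ) ^ (s + s' + 4 * (d + d')) * (1 / 2 ^ T) ≤ 1 / 2 ^ (K + 1) := by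
    rw [mul_one_div, div_le_div_iff₀ (by positivity) (by positivity)]
    calc 36 * (2:ℝ) ^ (s + s' + 4 * (d + d')) * 2 ^ (K + 1)
        ≤ 2 ^ 6 * (2:ℝ) ^ (s + s' + 4 * (d + d')) * 2 ^ (K + 1) := by gcongr; norm_num
      _ = 2 ^ (6 + (s + s' + 4 * (d + d')) + (K + 1)) := by rw [← pow_add, ← pow_add]
      _ ≤ 2 ^ T := pow_le_pow_right₀ (by norm_num) (by omega)
      _ = _ := by rw [one_mul]
  have b3 : 1 / (2:ℝ) ^ K = 1 / 2 ^ (K + 1) + 1 / 2 ^ (K + 1) := by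
    rw [pow_succ]; field_simp; norm_num
  rw [b3]
  linarith

/-- lower bound for cubic polynomials of bounded quadratic rank. -/
theorem bounded_quadratic_rank_lower_bound :
    ∃ c > (0:ℝ), ∀ r n m : ℕ, 2 ≤ r →
      (r:ℝ) ≤ Real.sqrt (Real.logb 2 (Real.logb 2 (n:ℝ))) →
      ∀ δ : ℝ, 0 < δ →
      ∀ P : Fin n → (Fin m → ZMod 2) → ZMod 2,
        (∀ i, DegLE 3 (P i)) → (∀ i, RankLE 2 r (P i)) →
        (∀ i, |prOne (P i) - 1/3| ≥ δ) →
        tvDist (outDist P) ber13 ≥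
          1 - (2:ℝ) ^ (-(Real.logb 2 (n:ℝ)) ^ (c / (r:ℝ)^2)) / δ^2 := by
  refine ⟨1 / 1000, by norm_num, ?_⟩
  intro r n m hr hrn δ hδ P _ hP hbias
  set L := Real.logb 2 (n:ℝ) with hL
  set l := Real.logb 2 L with hl
  have hr2 : (2:ℝ) ≤ r := by exact_mod_cast hr
  have hlr : (r:ℝ) ^ 2 ≤ l := by
    have h := Real.le_sqrt' (by linarith : (0:ℝ) < r) |>.1 hrn
    exact h
  have hl4 : (4:ℝ) ≤ l := by nlinarith
  have hn0 : n ≠ 0 := by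
    rintro rfl
    simp [hL, hl] at hl4
    linarith
  have hL0 : 0 ≤ L := by
    rw [hL]
    apply Real.logb_nonneg (by norm_num)
    exact_mod_cast Nat.one_le_iff_ne_zero.2 hn0
  have hLpos : 0 < L := by
    rcases hL0.lt_or_eq with h | h
    · exact h
    · rw [hl, ← h] at hl4
      simp at hl4
      linarith
  have hLl : (2:ℝ) ^ l = L := Real.rpow_logb (by norm_num) (by norm_num) hLpos
  have hnL : (2:ℝ) ^ L = n := Real.rpow_logb (by norm_num) (by norm_num)
    (by exact_mod_cast Nat.pos_of_ne_zero hn0)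
  set e : ℝ := 1 / 1000 / (r:ℝ) ^ 2 with he
  have hr2pos : (0:ℝ) < (r:ℝ) ^ 2 := by positivity
  set Kr := L ^ e with hKr
  have hKl : Kr = (2:ℝ) ^ (l * e) := by
    rw [hKr, ← hLl, ← Real.rpow_mul (by norm_num)]
  have hle0 : 0 ≤ l * e := by positivity
  have hK1 : 1 ≤ Kr := by
    rw [hKl]; exact Real.one_le_rpow (by norm_num) hle0
  have hδ1 : δ ≤ 2 / 3 := by
    have h := hbias ⟨0, Nat.pos_of_ne_zero hn0⟩
    refine le_trans h ?_
    unfold prOne distOf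
    have h1 : (0:ℝ) ≤ ((univ.filter fun x => P ⟨0, Nat.pos_of_ne_zero hn0⟩ x = 1).card : ℝ) /
      (Fintype.card (Fin m → ZMod 2) : ℝ) := by positivity
    have h2 : ((univ.filter fun x => P ⟨0, Nat.pos_of_ne_zero hn0⟩ x = 1).card : ℝ) /
      (Fintype.card (Fin m → ZMod 2) : ℝ) ≤ 1 := by
      apply div_le_one_of_le₀ _ (by positivity)
      exact_mod_cast card_le_univ _
    rw [abs_le]
    constructor <;> linarith
  have hδ2 : δ ^ 2 ≤ 4 / 9 := by nlinarith
  have hδp : 0 < δ ^ 2 := by positivity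
  show 1 - (2:ℝ) ^ (-Kr) / δ ^ 2 ≤ tvDist (outDist P) ber13
  have hpos : (0:ℝ) < (2:ℝ) ^ (-Kr) := by positivity
  by_cases hc : l ≤ 100 * (r:ℝ) ^ 2
  · have htv : 0 ≤ tvDist (outDist P) ber13 := by unfold tvDist; positivity
    have h1 : l * e ≤ 1 / 10 := by
      rw [he, ← mul_div_assoc, div_le_iff₀ hr2pos]; linarith
    have h10 : ∀ x : ℝ, x = (2:ℝ) ^ (1 / 10 : ℝ) → x ≤ 11 / 10 := by
      intro x hx
      have hx10 : x ^ 10 = 2 := by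
        rw [hx, ← Real.rpow_natCast, ← Real.rpow_mul (by norm_num)]; norm_num
      by_contra hcon
      push Not at hcon
      have := pow_lt_pow_left₀ hcon (by norm_num) (n := 10) (by norm_num)
      rw [hx10] at this
      norm_num at this
    have h10' := h10 _ rfl
    have hK : Kr ≤ 11 / 10 := by
      rw [hKl]
      exact (Real.rpow_le_rpow_of_exponent_le (by norm_num) h1).trans h10'
    have h2 : (2:ℝ) ^ Kr ≤ 22 / 10 := by
      calc (2:ℝ) ^ Kr ≤ (2:ℝ) ^ (1 + 1 / 10 : ℝ) :=
            Real.rpow_le_rpow_of_exponent_le (by norm_num) (by linarith)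
        _ = 2 * (2:ℝ) ^ (1 / 10 : ℝ) := by rw [Real.rpow_add (by norm_num), Real.rpow_one]
        _ ≤ _ := by linarith
    have h3 : 4 / 9 ≤ (2:ℝ) ^ (-Kr) := by
      rw [Real.rpow_neg (by norm_num), le_inv_comm₀ (by norm_num) (by positivity)]
      linarith
    have h4 : 1 ≤ (2:ℝ) ^ (-Kr) / δ ^ 2 := by
      rw [one_le_div hδp]; linarith
    linarith
  · push Not at hc
    set K := ⌈Kr⌉₊ with hKdef
    have hKle : Kr ≤ K := Nat.le_ceil _
    have hKlt : (K:ℝ) ≤ Kr + 1 := (Nat.ceil_lt_add_one (by linarith)).le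
    have hmain := core_bound r n m K (r + K + 2) (16 ^ (2 * r) * (r + K + 2)) rfl rfl ?_ P hP
    · refine le_trans ?_ hmain
      have h1 : 1 / (2:ℝ) ^ K ≤ (2:ℝ) ^ (-Kr) := by
        rw [Real.rpow_neg (by norm_num), one_div, ← Real.rpow_natCast]
        apply inv_anti₀ (by positivity)
        exact Real.rpow_le_rpow_of_exponent_le (by norm_num) hKle
      have h2 : (2:ℝ) ^ (-Kr) ≤ (2:ℝ) ^ (-Kr) / δ ^ 2 := by
        rw [le_div_iff₀ hδp]
        nlinarith
      linarith
    · have hA : ((r + K + 2 : ℕ) : ℝ) ≤ (2:ℝ) ^ (2 * r) * Kr := by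
        push_cast
        have h1 : (r:ℝ) + 4 ≤ (2:ℝ) ^ (2 * r) := by
          have h : r + 4 ≤ 2 ^ (2 * r) := by
            clear * - hr
            induction r, hr using Nat.le_induction with
            | base => norm_num
            | succ k hk ih =>
              rw [show 2 * (k + 1) = 2 * k + 2 by ring, pow_add]
              omega
          exact_mod_cast h
        nlinarith
      have hF : ((16 ^ (2 * r) * (r + K + 2) : ℕ) : ℝ) ≤ (2:ℝ) ^ (10 * r) * Kr := by
        rw [Nat.cast_mul]
        calc ((16 ^ (2 * r) : ℕ) : ℝ) * ((r + K + 2 : ℕ) : ℝ)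
            ≤ ((16 ^ (2 * r) : ℕ) : ℝ) * ((2:ℝ) ^ (2 * r) * Kr) := by gcongr
          _ = _ := by
            push_cast
            rw [show (16:ℝ) = 2 ^ 4 by norm_num, ← pow_mul, ← mul_assoc, ← pow_add]
            congr 2; ring
      have hKr3 : Kr ^ 3 = (2:ℝ) ^ (3 * (l * e)) := by
        rw [hKl, ← Real.rpow_natCast, ← Real.rpow_mul (by norm_num)]
        congr 1; push_cast; ring
      have hel : l * e ≤ l / 1000 := by
        rw [he, ← mul_div_assoc, div_le_iff₀ hr2pos]
        have h1r : (1:ℝ) ≤ (r:ℝ) ^ 2 := by nlinarith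
        have := mul_le_mul_of_nonneg_left h1r (by linarith : (0:ℝ) ≤ l / 1000)
        linarith
      have hfin : ((34 * (16 ^ (2 * r) * (r + K + 2)) ^ 3 : ℕ) : ℝ) ≤ L := by
        rw [Nat.cast_mul, Nat.cast_pow]
        calc ((34 : ℕ) : ℝ) * ((16 ^ (2 * r) * (r + K + 2) : ℕ) : ℝ) ^ 3
            ≤ 64 * ((2:ℝ) ^ (10 * r) * Kr) ^ 3 := by
              gcongr; norm_num
          _ = (2:ℝ) ^ ((6:ℝ) + 30 * r + 3 * (l * e)) := by
              rw [mul_pow, hKr3, Real.rpow_add (by norm_num), Real.rpow_add (by norm_num),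
                ← pow_mul, ← Real.rpow_natCast, mul_assoc ((2:ℝ) ^ (6:ℝ))]
              congr 1
              · norm_num
              · congr 2; push_cast; ring
          _ ≤ (2:ℝ) ^ l := by
              apply Real.rpow_le_rpow_of_exponent_le (by norm_num)
              nlinarith
          _ = L := hLl
      have : ((2:ℝ) ^ (34 * (16 ^ (2 * r) * (r + K + 2)) ^ 3 : ℕ)) ≤ n := by
        rw [← hnL, ← Real.rpow_natCast]
        exact Real.rpow_le_rpow_of_exponent_le (by norm_num) hfin
      exact_mod_cast this
end

section
/- There exist an absolute constant c > 0 and a threshold n₀ such that the following holds. For all n ≥ n₀, all m, and all functions P₁,…,Pₙ : 𝔽₂^m → 𝔽₂ each of degree at most 3, ‖(P₁,…,Pₙ) − Ber(1/3)^⊗n‖_TV ≥ 1 − 2^{−c·√(log₂ log₂ n)}. -/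
open Finset

namespace CL

/-! basic -/

noncomputable def chi (a : ZMod 2) : ℝ := if a = 0 then 1 else -1

lemma chi_zero : chi 0 = 1 := by simp [chi]
lemma chi_one : chi 1 = -1 := by simp [chi]
lemma zmod2_cases (a : ZMod 2) : a = 0 ∨ a = 1 := by revert a; decide
lemma zmod2_add_self (a : ZMod 2) : a + a = 0 := by revert a; decide
lemma zmod2_eq_of_add {a b : ZMod 2} (h : a + b = 0) : a = b := by revert a b; decide

lemma chi_add (a b : ZMod 2) : chi (a + b) = chi a * chi b := by
  rcases zmod2_cases a with rfl | rfl <;> rcases zmod2_cases b with rfl | rfl <;>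
    simp [chi, zmod2_add_self]

lemma chi_sq (a : ZMod 2) : chi a * chi a = 1 := by
  rw [← chi_add, zmod2_add_self, chi_zero]

lemma chi_abs (a : ZMod 2) : |chi a| = 1 := by
  unfold chi; split_ifs <;> simp

lemma chi_int (a : ZMod 2) : ∃ z : ℤ, chi a = z := by
  unfold chi; split_ifs
  · exact ⟨1, by simp⟩
  · exact ⟨-1, by simp⟩

/-- expectation -/
noncomputable def Ex {α : Type*} [Fintype α] (f : α → ℝ) : ℝ := (∑ x, f x) / (Fintype.card α : ℝ)

section
variable {α : Type*} [Fintype α]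

lemma Ex_add (f g : α → ℝ) : Ex (fun x => f x + g x) = Ex f + Ex g := by
  simp [Ex, Finset.sum_add_distrib, add_div]

lemma Ex_sub (f g : α → ℝ) : Ex (fun x => f x - g x) = Ex f - Ex g := by
  simp [Ex, Finset.sum_sub_distrib, sub_div]

lemma Ex_mul_left (c : ℝ) (f : α → ℝ) : Ex (fun x => c * f x) = c * Ex f := by
  simp [Ex, ← Finset.mul_sum, mul_div_assoc]

lemma Ex_mul_right (c : ℝ) (f : α → ℝ) : Ex (fun x => f x * c) = Ex f * c := by
  simp [Ex, ← Finset.sum_mul]; ring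

lemma Ex_const [Nonempty α] (c : ℝ) : Ex (fun _ : α => c) = c := by
  simp [Ex]

lemma Ex_mono {f g : α → ℝ} (h : ∀ x, f x ≤ g x) : Ex f ≤ Ex g := by
  unfold Ex; gcongr with x; exact h x

lemma Ex_nonneg {f : α → ℝ} (h : ∀ x, 0 ≤ f x) : 0 ≤ Ex f := by
  unfold Ex; exact div_nonneg (Finset.sum_nonneg fun x _ => h x) (by positivity)

lemma Ex_abs_le [Nonempty α] {f : α → ℝ} {c : ℝ} (h : ∀ x, |f x| ≤ c) : |Ex f| ≤ c := by
  rw [abs_le]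
  constructor
  · rw [← Ex_const (α := α) (-c)]; exact Ex_mono fun x => (abs_le.1 (h x)).1
  · rw [← Ex_const (α := α) c]; exact Ex_mono fun x => (abs_le.1 (h x)).2

lemma Ex_comm {β : Type*} [Fintype β] (f : α → β → ℝ) :
    Ex (fun x => Ex (fun y => f x y)) = Ex (fun y => Ex (fun x => f x y)) := by
  simp only [Ex, ← Finset.sum_div]
  rw [Finset.sum_comm]
  rw [div_div, div_div, mul_comm]

lemma Ex_sum {ι : Type*} (s : Finset ι) (f : ι → α → ℝ) :
    Ex (fun x => ∑ i ∈ s, f i x) = ∑ i ∈ s, Ex (f i) := by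
  simp only [Ex]
  rw [Finset.sum_comm, Finset.sum_div]

lemma Ex_sq_le [Nonempty α] (f : α → ℝ) : (Ex f) ^ 2 ≤ Ex (fun x => f x ^ 2) := by
  have h : 0 ≤ Ex (fun x => (f x - Ex f) ^ 2) := Ex_nonneg fun x => sq_nonneg _
  have : (fun x => (f x - Ex f) ^ 2) = fun x => (f x ^ 2 - (2 * Ex f) * f x) + (Ex f) ^ 2 := by
    funext x; ring
  rw [this, Ex_add, Ex_sub, Ex_mul_left, Ex_const] at h
  nlinarith
end

section
variable {V : Type} [AddCommGroup V] [Module (ZMod 2) V]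

lemma vself (x : V) : x + x = 0 := ZModModule.add_self x

lemma vcancel (x y : V) : x + y + y = x := by rw [add_assoc, vself, add_zero]

lemma Ex_shift [Fintype V] (f : V → ℝ) (v : V) : Ex (fun x => f (x + v)) = Ex f := by
  unfold Ex; congr 1
  exact Fintype.sum_equiv (Equiv.addRight v) _ _ (fun x => rfl)

lemma Ex_avg [Fintype V] (U : Submodule (ZMod 2) V) [Fintype U] (f : V → ℝ) :
    Ex f = Ex (fun x => Ex (fun u : U => f (x + u))) := by
  rw [Ex_comm]
  have : (fun y : U => Ex fun x => f (x + (y : V))) = fun _ => Ex f := by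
    funext y; exact Ex_shift f y
  rw [this, Ex_const]

def mkSub (S : Set V) (h0 : (0 : V) ∈ S) (hadd : ∀ x y, x ∈ S → y ∈ S → x + y ∈ S) :
    Submodule (ZMod 2) V where
  carrier := S
  zero_mem' := h0
  add_mem' := fun {a b} ha hb => hadd a b ha hb
  smul_mem' := by
    intro c x hx
    rcases zmod2_cases c with rfl | rfl
    · simpa using h0
    · simpa using hx

lemma mem_mkSub {S : Set V} {h0 : (0 : V) ∈ S} {hadd : ∀ x y, x ∈ S → y ∈ S → x + y ∈ S} {x : V} :
    x ∈ mkSub S h0 hadd ↔ x ∈ S := Iff.rfl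

def mkLin {M : Type*} [AddCommGroup M] [Module (ZMod 2) M] (f : V → M)
    (hadd : ∀ x y, f (x + y) = f x + f y) : V →ₗ[ZMod 2] M :=
  AddMonoidHom.toZModLinearMap 2 (AddMonoidHom.mk' f hadd)

lemma mkLin_apply {M : Type*} [AddCommGroup M] [Module (ZMod 2) M] (f : V → M)
    (hadd : ∀ x y, f (x + y) = f x + f y) (x : V) : mkLin f hadd x = f x := rfl

lemma card_eq [Fintype V] : (Fintype.card V : ℝ) = 2 ^ Module.finrank (ZMod 2) V := by
  have := Module.card_eq_pow_finrank (K := ZMod 2) (V := V)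
  rw [ZMod.card] at this
  exact_mod_cast this

lemma card_eq_nat [Fintype V] : Fintype.card V = 2 ^ Module.finrank (ZMod 2) V := by
  have := Module.card_eq_pow_finrank (K := ZMod 2) (V := V)
  rwa [ZMod.card] at this

/-- derivative -/
def dd (h : V) (f : V → ZMod 2) : V → ZMod 2 := fun x => f (x + h) + f x

def Quad (g : V → ZMod 2) : Prop := ∀ a b c x, dd a (dd b (dd c g)) x = 0

def Rad (g : V → ZMod 2) : Submodule (ZMod 2) V :=
  mkSub {y | ∀ z x, dd z (dd y g) x = 0} (by
    intro z x; simp [dd, zmod2_add_self]) (by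
    intro a b ha hb z x
    have h1 := ha z (x + b)
    have h2 := hb z x
    simp only [dd] at *
    have e1 : x + z + (a + b) = x + b + z + a := by abel
    have e2 : x + (a + b) = x + b + a := by abel
    have e3 : x + b + z = x + z + b := by abel
    rw [e1, e2]
    rw [e3] at h1 ⊢
    linear_combination h1 + h2 - zmod2_add_self (g (x + z + b)) - zmod2_add_self (g (x+b)))

lemma mem_Rad {g : V → ZMod 2} {y : V} : y ∈ Rad g ↔ ∀ z x, dd z (dd y g) x = 0 := Iff.rfl

def Inv (g : V → ZMod 2) : Submodule (ZMod 2) V :=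
  mkSub {y | ∀ x, g (x + y) = g x} (by intro x; simp) (by
    intro a b ha hb x
    rw [← add_assoc, hb, ha])

lemma mem_Inv {g : V → ZMod 2} {y : V} : y ∈ Inv g ↔ ∀ x, g (x + y) = g x := Iff.rfl

lemma Rad_const {g : V → ZMod 2} {y : V} (hy : y ∈ Rad g) (x : V) :
    g (x + y) + g x = g y + g 0 := by
  have := hy x 0
  simp only [dd, zero_add] at this
  exact zmod2_eq_of_add this

lemma Rad_add {g : V → ZMod 2} {y z : V} (hy : y ∈ Rad g) :
    g (y + z) + g 0 = (g y + g 0) + (g z + g 0) := by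
  have := Rad_const hy z
  rw [add_comm y z]
  linear_combination this - zmod2_add_self (g z) 

lemma quad_sum_shift [Fintype V] {g : V → ZMod 2} (hg : Quad g) (y : V) [Decidable (y ∈ Rad g)] :
    Ex (fun x => chi (g (x + y) + g x)) = if y ∈ Rad g then chi (g y + g 0) else 0 := by
  split_ifs with hy
  · simp_rw [Rad_const hy]
    exact Ex_const _
  · rw [mem_Rad] at hy
    push Not at hy
    obtain ⟨z, x0, hz⟩ := hy
    have hz1 : ∀ x, dd z (dd y g) x = 1 := by
      intro x
      have := hg (x + x0) z y x0
      have e : x0 + (x + x0) = x := by rw [add_comm x, ← add_assoc, vself, zero_add]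
      rw [dd, e] at this
      rw [zmod2_eq_of_add this]
      exact (zmod2_cases _).resolve_left hz
    have h1 := Ex_shift (fun x => chi (g (x + y) + g x)) z
    have h2 : (fun x => chi (g (x + z + y) + g (x + z))) = fun x => (-1) * chi (g (x + y) + g x) := by
      funext x
      have := hz1 x
      simp only [dd] at this
      have e : g (x + z + y) + g (x + z) = 1 + (g (x + y) + g x) := by
        linear_combination this - zmod2_add_self (g (x+y)+ g x)
      rw [e, chi_add, chi_one]
    rw [h2, Ex_mul_left] at h1
    linarith

lemma quad_sq [Fintype V] {g : V → ZMod 2} (hg : Quad g) [DecidablePred (· ∈ Rad g)] :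
    (Ex (fun x => chi (g x))) ^ 2 = Ex (fun y => if y ∈ Rad g then chi (g y + g 0) else 0) := by
  have : ∀ y, Ex (fun x => chi (g (x + y) + g x)) = if y ∈ Rad g then chi (g y + g 0) else 0 :=
    fun y => quad_sum_shift hg y
  simp_rw [← this]
  rw [Ex_comm]
  rw [sq, ← Ex_mul_left]
  congr 1; funext x
  simp_rw [chi_add]
  rw [Ex_mul_right, ]
  congr 1
  rw [← Ex_shift _ x]
  congr 1; funext y; rw [add_comm]

end
end CL

namespace CL
section
variable {V : Type} [AddCommGroup V] [Module (ZMod 2) V] [Fintype V]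

open Module

lemma sum_ind_le (S U : Submodule (ZMod 2) V) [Fintype U] [DecidablePred (· ∈ S)] :
    (∑ y : U, if (y : V) ∈ S then (1:ℝ) else 0) ≤ 2 ^ finrank (ZMod 2) S := by
  classical
  rw [← card_eq (V := S), Finset.sum_boole]
  norm_cast
  rw [← Finset.card_univ (α := S)]
  exact Finset.card_le_card_of_injOn (fun y : U => if h : (y : V) ∈ S then (⟨y, h⟩ : S) else 0)
    (by intro y _; simp) (by
      intro a ha b hb hab
      simp only [coe_filter, mem_univ, true_and, Set.mem_ofPred_eq] at ha hb
      simp only [ha, hb, dif_pos, Subtype.mk.injEq] at hab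
      exact Subtype.ext hab)

lemma coset_bias {g : V → ZMod 2} (hg : Quad g) (U : Submodule (ZMod 2) V) [Fintype U] {D : ℕ}
    (hU : finrank (ZMod 2) V ≤ D + finrank (ZMod 2) U) (x : V) :
    (Ex (fun u : U => chi (g (x + u)))) ^ 2 ≤
      2 ^ (2 * D) * 2 ^ finrank (ZMod 2) (Rad g) / 2 ^ finrank (ZMod 2) V := by
  classical
  set β : V → ℝ := fun x => Ex (fun u : U => chi (g (x + u))) with hβ
  have hinv : ∀ x, ∀ u : U, β (x + u) = β x := by
    intro x u
    simp only [hβ]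
    rw [← Ex_shift (fun v : U => chi (g (x + v))) u]
    congr 1; funext v
    congr 2
    push_cast
    abel
  have h1 : Ex (fun x => β x ^ 2) = Ex (fun v : U => Ex (fun x => chi (g (x + v) + g x))) := by
    rw [← Ex_comm]
    have : (fun x => Ex (fun v : U => chi (g (x + v) + g x))) = fun x => chi (g x) * β x := by
      funext x
      simp_rw [chi_add]
      rw [Ex_mul_right, mul_comm]
    rw [this, Ex_avg U (fun x => chi (g x) * β x)]
    congr 1; funext x
    simp_rw [hinv]
    rw [Ex_mul_right, sq]
  have h2 : Ex (fun x => β x ^ 2) ≤ 2 ^ finrank (ZMod 2) (Rad g) / 2 ^ finrank (ZMod 2) U := by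
    rw [h1]
    have : Ex (fun v : U => Ex (fun x => chi (g (x + v) + g x))) ≤
        Ex (fun v : U => if (v : V) ∈ Rad g then (1:ℝ) else 0) := by
      apply Ex_mono
      intro v
      rw [quad_sum_shift hg]
      split_ifs
      · have := chi_abs (g v + g 0)
        exact (le_abs_self _).trans this.le
      · exact le_rfl
    refine this.trans ?_
    unfold Ex
    rw [card_eq (V := U)]
    gcongr
    exact sum_ind_le _ _
  have h3 : (2:ℝ) ^ finrank (ZMod 2) U * β x ^ 2 ≤ ∑ y, β y ^ 2 := by
    have e1 : ∑ u : U, β (x + u) ^ 2 = (2:ℝ) ^ finrank (ZMod 2) U * β x ^ 2 := by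
      simp_rw [hinv]
      rw [Finset.sum_const, nsmul_eq_mul, Finset.card_univ, card_eq (V := U)]
    rw [← e1]
    have e2 : ∑ u : U, β (x + u) ^ 2 = ∑ y ∈ Finset.univ.map ⟨fun u : U => x + u, by
        intro a b h; simpa using h⟩, β y ^ 2 := by
      rw [Finset.sum_map]; rfl
    rw [e2]
    exact Finset.sum_le_univ_sum_of_nonneg (fun y => sq_nonneg _)
  unfold Ex at h2
  rw [card_eq] at h2
  rw [div_le_div_iff₀ (by positivity) (by positivity)] at h2
  rw [le_div_iff₀ (by positivity)]
  set v := finrank (ZMod 2) V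
  set u := finrank (ZMod 2) U
  set R := (2:ℝ) ^ finrank (ZMod 2) (Rad g)
  have hvu : (2:ℝ) ^ v ≤ 2 ^ D * 2 ^ u := by
    rw [← pow_add]; exact pow_le_pow_right₀ (by norm_num) hU
  have hp : (0:ℝ) < 2 ^ u := by positivity
  have h4 : (2:ℝ) ^ u * β x ^ 2 * 2 ^ u ≤ R * 2 ^ v := le_trans (by gcongr) h2
  have h5 : β x ^ 2 * (2 ^ u * 2 ^ u) * 2 ^ v ≤ R * (2^D * 2^u) * (2 ^ D * 2 ^ u) := by
    calc β x ^ 2 * (2 ^ u * 2 ^ u) * 2 ^ v = (2 ^ u * β x ^ 2 * 2 ^ u) * 2 ^ v := by ring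
      _ ≤ (R * 2 ^ v) * 2 ^ v := by gcongr
      _ ≤ R * (2^D * 2^u) * (2 ^ D * 2 ^ u) := by gcongr
  have h6 : (β x ^ 2 * 2 ^ v) * (2 ^ u * 2 ^ u) ≤ (2 ^ (2*D) * R) * (2 ^ u * 2 ^ u) := by
    have : (2:ℝ) ^ (2*D) = 2^D * 2^D := by rw [← pow_add]; congr 1; ring
    rw [this]; linarith
  exact le_of_mul_le_mul_right h6 (by positivity)

lemma bias_le {g : V → ZMod 2} (hg : Quad g) :
    (Ex (fun x => chi (g x))) ^ 2 ≤ 2 ^ finrank (ZMod 2) (Rad g) / 2 ^ finrank (ZMod 2) V := by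
  classical
  rw [quad_sq hg]
  unfold Ex
  rw [card_eq]
  gcongr
  rw [← card_eq (V := Rad g)]
  calc (∑ x, if x ∈ Rad g then chi (g x + g 0) else 0) ≤ ∑ x, if x ∈ Rad g then (1:ℝ) else 0 := by
        apply Finset.sum_le_sum
        intro x _
        split_ifs
        · have := chi_abs (g x + g 0)
          exact (le_abs_self _).trans this.le
        · exact le_rfl
    _ ≤ _ := by
        rw [Finset.sum_boole, Fintype.card_subtype]

lemma finrank_ker_add {M N : Type*} [AddCommGroup M] [Module (ZMod 2) M] [AddCommGroup N] [Module (ZMod 2) N]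
    [Finite M] [Finite N] (f : M →ₗ[ZMod 2] N) :
    finrank (ZMod 2) M ≤ finrank (ZMod 2) N + finrank (ZMod 2) (LinearMap.ker f) := by
  have := LinearMap.finrank_range_add_finrank_ker f
  have h2 := Submodule.finrank_le (LinearMap.range f)
  omega

lemma Rad_le_Inv (g : V → ZMod 2) : finrank (ZMod 2) (Rad g) ≤ 1 + finrank (ZMod 2) (Inv g) := by
  let f : Rad g →ₗ[ZMod 2] ZMod 2 := mkLin (fun y => g y + g 0) (fun x y => Rad_add x.2)
  have h := finrank_ker_add f
  rw [finrank_self] at h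
  have h2 : finrank (ZMod 2) (LinearMap.ker f) ≤ finrank (ZMod 2) (Inv g) := by
    rw [← Submodule.finrank_map_subtype_eq]
    apply Submodule.finrank_mono
    rintro _ ⟨y, hy, rfl⟩
    intro x
    have h3 : g y + g 0 = 0 := hy
    have := Rad_const y.2 x
    rw [h3] at this
    exact zmod2_eq_of_add this
  omega

lemma quad_exact {g : V → ZMod 2} (hg : Quad g) :
    Ex (fun x => chi (g x)) = 0 ∨ ∃ h : ℕ, |Ex (fun x => chi (g x))| = (1/2:ℝ) ^ h := by
  classical
  -- sum over Rad
  have hsq := quad_sq hg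
  have hR : (∑ y, if y ∈ Rad g then chi (g y + g 0) else 0) = ∑ y : Rad g, chi (g y + g 0) := by
    rw [← Finset.sum_filter]
    rw [Finset.sum_subtype (p := fun y => y ∈ Rad g)]
    simp
  by_cases hc : ∀ y : Rad g, g y + g 0 = 0
  · right
    have h1 : (∑ y : Rad g, chi (g y + g 0)) = 2 ^ finrank (ZMod 2) (Rad g) := by
      simp_rw [hc, chi_zero]
      rw [← card_eq (V := Rad g)]; simp
    obtain ⟨z, hz⟩ : ∃ z : ℤ, ∑ x, chi (g x) = z := by
      choose f hf using fun a => chi_int a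
      exact ⟨∑ x, f (g x), by push_cast; exact Finset.sum_congr rfl fun x _ => hf _⟩
    have hE : Ex (fun x => chi (g x)) = z / 2 ^ finrank (ZMod 2) V := by
      unfold Ex; rw [hz, card_eq]
    have hsq2 : ((z:ℝ) / 2 ^ finrank (ZMod 2) V) ^ 2 = 2 ^ finrank (ZMod 2) (Rad g) / 2 ^ finrank (ZMod 2) V := by
      rw [← hE, hsq, Ex, hR, h1, card_eq]
    have hz2 : (z:ℝ) ^ 2 = 2 ^ (finrank (ZMod 2) (Rad g) + finrank (ZMod 2) V) := by
      field_simp at hsq2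
      rw [hsq2, pow_add, mul_comm]
    have hz3 : z.natAbs ^ 2 = 2 ^ (finrank (ZMod 2) (Rad g) + finrank (ZMod 2) V) := by
      have : (z:ℤ) ^ 2 = 2 ^ (finrank (ZMod 2) (Rad g) + finrank (ZMod 2) V) := by exact_mod_cast hz2
      zify
      rw [sq_abs]; exact this
    have hd : z.natAbs ∣ 2 ^ (finrank (ZMod 2) (Rad g) + finrank (ZMod 2) V) := by
      rw [← hz3]; exact dvd_pow_self _ (by norm_num)
    obtain ⟨a, -, ha⟩ := (Nat.dvd_prime_pow Nat.prime_two).1 hd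
    have habs : |(z:ℝ)| = 2 ^ a := by
      rw [← Int.cast_abs, Int.abs_eq_natAbs, ha]; push_cast; rfl
    have hle : a ≤ finrank (ZMod 2) V := by
      have h3 : |Ex (fun x => chi (g x))| ≤ 1 := Ex_abs_le fun x => (chi_abs _).le
      rw [hE, abs_div, habs, abs_of_pos (by positivity : (0:ℝ) < 2 ^ finrank (ZMod 2) V),
        div_le_one (by positivity)] at h3
      exact (pow_le_pow_iff_right₀ (by norm_num)).1 h3
    refine ⟨finrank (ZMod 2) V - a, ?_⟩
    rw [hE, abs_div, habs, abs_of_pos (by positivity : (0:ℝ) < 2 ^ finrank (ZMod 2) V)]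
    rw [div_pow, one_pow, div_eq_div_iff (by positivity) (by positivity), one_mul, ← pow_add]
    congr 1; omega
  · left
    push Not at hc
    obtain ⟨y0, hy0⟩ := hc
    have hy1 := (zmod2_cases _).resolve_left hy0
    have h1 : (∑ y : Rad g, chi (g y + g 0)) = 0 := by
      have h2 := Ex_shift (V := Rad g) (fun y => chi (g y + g 0)) y0
      have h3 : (fun y : Rad g => chi (g ((y + y0 : Rad g) : V) + g 0)) = fun y : Rad g => (-1) * chi (g y + g 0) := by
        funext y
        push_cast
        rw [Rad_add y.2, hy1, chi_add, chi_one]; ring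
      rw [h3, Ex_mul_left] at h2
      have h4 : Ex (fun y : Rad g => chi (g y + g 0)) = 0 := by linarith
      unfold Ex at h4
      rcases div_eq_zero_iff.1 h4 with h | h
      · exact h
      · rw [card_eq] at h
        exact absurd h (by positivity)
    have h5 : Ex (fun y => if y ∈ Rad g then chi (g y + g 0) else 0) = 0 := by
      rw [Ex, hR, h1, zero_div]
    rw [h5] at hsq
    exact pow_eq_zero_iff (by norm_num) |>.1 hsq
end
end CL

namespace CL
section
open Module

lemma gap_sum {ι : Type*} (B : ℕ) (hB : 3 ≤ B) : ∀ (N : ℕ) (s : Finset ι) (a : ι → ℝ), s.card = N →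
    8 * N ≤ 2 ^ B → (∀ i ∈ s, a i = 0 ∨ ∃ h : ℕ, |a i| = (1/2:ℝ) ^ h) → ∀ m : ℤ, ¬ (3:ℤ) ∣ m →
    (1/2:ℝ) ^ (B * (N + 1)) ≤ |∑ i ∈ s, a i - m / 3| := by
  classical
  intro N
  induction N with
  | zero =>
    intro s a hs _ _ m hm
    rw [Finset.card_eq_zero] at hs
    subst hs
    have h1 : (1:ℝ) ≤ |(m:ℝ)| := by
      have : m ≠ 0 := by rintro rfl; simp at hm
      exact_mod_cast Int.one_le_abs this
    have h2 : (1/2:ℝ) ^ (B * (0 + 1)) ≤ (1/2:ℝ)^3 :=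
      pow_le_pow_of_le_one (by norm_num) (by norm_num) (by omega)
    simp only [Finset.sum_empty, zero_sub, abs_neg, abs_div]
    norm_num at h2 ⊢
    linarith
  | succ N ih =>
    intro s a hs hN ha m hm
    by_cases hc : ∃ h : ℕ, ∃ i ∈ s, |a i| = (1/2:ℝ) ^ h ∧ h < B
    · have hmin := Nat.find_spec hc
      have hmin' := fun {k} => Nat.find_min hc (m := k)
      set h := Nat.find hc with hh
      obtain ⟨i, his, hai, hhB⟩ := hmin
      obtain ⟨σ, hσ, hσ2⟩ : ∃ σ : ℤ, a i = σ * (1/2:ℝ)^h ∧ (σ = 1 ∨ σ = -1) := by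
        rcases abs_choice (a i) with h1 | h1
        · exact ⟨1, by rw [← hai, h1]; simp, Or.inl rfl⟩
        · exact ⟨-1, by rw [← hai, h1]; simp, Or.inr rfl⟩
      have h12 : (2:ℝ) ^ h * (1/2) ^ h = 1 := by rw [← mul_pow]; norm_num
      have key := ih (s.erase i) (fun j => 2 ^ h * a j) (by rw [Finset.card_erase_of_mem his, hs]; rfl)
        (by omega) (by
          intro j hj
          have hjs := Finset.mem_of_mem_erase hj
          rcases ha j hjs with h0 | ⟨k, hk⟩
          · left; simp [h0]
          · right
            have hkh : h ≤ k := by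
              by_contra hlt
              push Not at hlt
              exact hmin' hlt ⟨j, hjs, hk, by omega⟩
            refine ⟨k - h, ?_⟩
            rw [abs_mul, hk, abs_of_pos (by positivity)]
            obtain ⟨d, rfl⟩ := Nat.exists_eq_add_of_le hkh
            rw [Nat.add_sub_cancel_left, pow_add, ← mul_assoc, h12, one_mul])
        (2 ^ h * m - 3 * σ) (by
          intro hd
          have h3 : (3:ℤ) ∣ 2 ^ h * m := by
            have := dvd_add hd (dvd_mul_right 3 σ)
            simpa using this
          have h4 : IsCoprime (3:ℤ) (2 ^ h) := IsCoprime.pow_right (by norm_num)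
          exact hm (h4.dvd_of_dvd_mul_left h3))
      have e : ∑ j ∈ s.erase i, 2 ^ h * a j - ((2 ^ h * m - 3 * σ : ℤ) : ℝ) / 3 =
          2 ^ h * (∑ j ∈ s, a j - m / 3) := by
        rw [← Finset.add_sum_erase s a his, hσ, ← Finset.mul_sum]
        push_cast
        linear_combination -(σ:ℝ) * h12
      rw [e, abs_mul, abs_of_pos (by positivity : (0:ℝ) < 2 ^ h)] at key
      have h5 : (1/2:ℝ) ^ (B * (N + 1 + 1)) ≤ (1/2) ^ h * (1/2) ^ (B * (N + 1)) := by
        rw [← pow_add]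
        apply pow_le_pow_of_le_one (by norm_num) (by norm_num)
        nlinarith
      calc _ ≤ _ := h5
        _ ≤ (1/2) ^ h * (2 ^ h * |∑ i ∈ s, a i - m / 3|) := by gcongr
        _ = _ := by rw [← mul_assoc, mul_comm ((1/2:ℝ)^h), h12, one_mul]
    · push Not at hc
      have h1 : |∑ i ∈ s, a i| ≤ 1 / 8 := by
        calc |∑ i ∈ s, a i| ≤ ∑ i ∈ s, |a i| := Finset.abs_sum_le_sum_abs _ _
          _ ≤ ∑ i ∈ s, (1/2:ℝ) ^ B := by
              apply Finset.sum_le_sum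
              intro i hi
              rcases ha i hi with h0 | ⟨k, hk⟩
              · rw [h0, abs_zero]; positivity
              · rw [hk]
                exact pow_le_pow_of_le_one (by norm_num) (by norm_num) (hc k i hi hk)
          _ = (N + 1 : ℕ) * (1/2:ℝ) ^ B := by rw [Finset.sum_const, hs, nsmul_eq_mul]
          _ ≤ _ := by
              have : (8 * (N + 1 : ℕ) : ℝ) ≤ 2 ^ B := by exact_mod_cast hN
              have h2 : (2:ℝ) ^ B * (1/2) ^ B = 1 := by rw [← mul_pow]; norm_num
              have h3 : (0:ℝ) < (1/2) ^ B := by positivity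
              nlinarith
      have h2 : (1:ℝ) ≤ |(m:ℝ)| := by
        have : m ≠ 0 := by rintro rfl; simp at hm
        exact_mod_cast Int.one_le_abs this
      have h3 : (1/2:ℝ) ^ (B * (N + 1 + 1)) ≤ (1/2:ℝ)^3 :=
        pow_le_pow_of_le_one (by norm_num) (by norm_num) (by nlinarith)
      have h4 := abs_sub_abs_le_abs_sub ((m:ℝ)/3) (∑ i ∈ s, a i)
      rw [abs_sub_comm, abs_div] at h4
      norm_num at h3 h4 ⊢
      linarith

variable {V : Type} [AddCommGroup V] [Module (ZMod 2) V] [Fintype V]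

lemma Ex_compl (C W : Submodule (ZMod 2) V) [Fintype C] [Fintype W] (h : IsCompl C W) (f : V → ℝ) :
    Ex f = Ex (fun c : C => Ex (fun w : W => f (c + w))) := by
  have e := Submodule.prodEquivOfIsCompl C W h
  have hcard : (Fintype.card V : ℝ) = Fintype.card C * Fintype.card W := by
    rw [← Nat.cast_mul, ← Fintype.card_prod]
    congr 1
    exact (Fintype.card_congr e.toEquiv).symm
  unfold Ex
  rw [← Finset.sum_div, hcard, div_div, mul_comm (Fintype.card C : ℝ)]
  congr 1
  rw [← Fintype.sum_prod_type' (f := fun (c : C) (w : W) => f (c + w))]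
  exact (Fintype.sum_equiv (Submodule.prodEquivOfIsCompl C W h).toEquiv _ _ (fun x => by simp)).symm

def QuadOn (W : Submodule (ZMod 2) V) (Q : V → ZMod 2) : Prop :=
  ∀ a ∈ W, ∀ b ∈ W, ∀ c ∈ W, ∀ x, dd a (dd b (dd c Q)) x = 0

lemma QuadOn.restrict {W : Submodule (ZMod 2) V} {Q : V → ZMod 2} (h : QuadOn W Q) (x : V) :
    Quad (fun w : W => Q (x + w)) := by
  intro a b c y
  have := h a a.2 b b.2 c c.2 (x + y)
  simp only [dd] at this ⊢
  push_cast
  simp only [add_assoc] at this ⊢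
  exact this

def gapE (r : ℕ) : ℕ := (r + 3) * (2 ^ r + 1)

lemma mean_gap {W : Submodule (ZMod 2) V} {Q : V → ZMod 2} (h : QuadOn W Q) {r : ℕ}
    (hW : finrank (ZMod 2) V ≤ r + finrank (ZMod 2) W) :
    (1/2:ℝ) ^ gapE r ≤ |Ex (fun x => chi (Q x)) - 1/3| := by
  classical
  obtain ⟨C, hC⟩ := Submodule.exists_isCompl W
  have hdim := Submodule.finrank_add_eq_of_isCompl hC
  have hCr : finrank (ZMod 2) C ≤ r := by omega
  rw [Ex_compl C W hC.symm]
  set d := finrank (ZMod 2) C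
  have h2 : Ex (fun c : C => Ex (fun w : W => chi (Q (c + w)))) =
      ∑ c : C, (1/2:ℝ)^d * Ex (fun w : W => chi (Q (c + w))) := by
    rw [← Finset.mul_sum]
    unfold Ex
    rw [card_eq (V := C)]
    rw [div_eq_mul_inv, mul_comm, one_div, inv_pow]
  rw [h2]
  have hcard : (Finset.univ : Finset C).card = 2 ^ d := by
    rw [Finset.card_univ, card_eq_nat]
  have h2r : 2 ^ d ≤ 2 ^ r := Nat.pow_le_pow_right (by norm_num) hCr
  have := gap_sum (r + 3) (by omega) (2 ^ d) (Finset.univ : Finset C)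
    (fun c => (1/2:ℝ)^d * Ex (fun w : W => chi (Q (c + w)))) hcard (by
      rw [pow_add]; omega) (by
      intro c _
      rcases quad_exact (h.restrict (c : V)) with h0 | ⟨k, hk⟩
      · left; simp only [h0, mul_zero]
      · right
        refine ⟨d + k, ?_⟩
        rw [abs_mul, hk, pow_add, abs_of_pos (by positivity)]) 1 (by norm_num)
  refine le_trans ?_ (le_trans this (by norm_num))
  apply pow_le_pow_of_le_one (by norm_num) (by norm_num)
  unfold gapE
  gcongr
end
end CL

namespace CL
section
open Module

noncomputable def pb (b : ZMod 2) : ℝ := if b = 1 then 1/3 else 2/3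

lemma ber_prod {n : ℕ} (y : Fin n → ZMod 2) : ber13 y = ∏ i, pb (y i) := by
  unfold ber13 pb
  rw [Finset.prod_ite, Finset.prod_const, Finset.prod_const]
  congr 2
  have := Finset.card_filter_add_card_filter_not (s := (Finset.univ : Finset (Fin n))) (fun i => y i = 1)
  rw [Finset.card_univ, Fintype.card_fin] at this
  omega

lemma sum_zmod2 (f : ZMod 2 → ℝ) : ∑ b, f b = f 0 + f 1 := Fin.sum_univ_two f

lemma pb_sum : ∑ b, pb b = 1 := by
  rw [sum_zmod2]; simp [pb]; norm_num

lemma pb_mean : ∑ b, pb b * (chi b - 1/3) = 0 := by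
  rw [sum_zmod2]; simp [pb, chi]; norm_num

lemma pb_nonneg (b : ZMod 2) : 0 ≤ pb b := by unfold pb; split_ifs <;> norm_num

lemma ber_nonneg {n : ℕ} (y : Fin n → ZMod 2) : 0 ≤ ber13 y := by
  rw [ber_prod]; exact Finset.prod_nonneg fun i _ => pb_nonneg _

lemma ber_sum {n : ℕ} : ∑ y : Fin n → ZMod 2, ber13 y = 1 := by
  simp_rw [ber_prod]
  have := Finset.prod_univ_sum (fun _ : Fin n => (Finset.univ : Finset (ZMod 2))) (fun _ b => pb b)
  rw [Fintype.piFinset_univ] at this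
  rw [← this]; simp [pb_sum]

lemma ber_cov {n : ℕ} {i j : Fin n} (hij : i ≠ j) :
    ∑ y : Fin n → ZMod 2, ber13 y * ((chi (y i) - 1/3) * (chi (y j) - 1/3)) = 0 := by
  have h : ∀ y : Fin n → ZMod 2, ber13 y * ((chi (y i) - 1/3) * (chi (y j) - 1/3)) =
      ∏ l, (pb (y l) * ((if l = i then (chi (y l) - 1/3) else 1) *
        (if l = j then (chi (y l) - 1/3) else 1))) := by
    intro y
    rw [Finset.prod_mul_distrib, Finset.prod_mul_distrib, ber_prod]
    simp
  simp_rw [h]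
  have := Finset.prod_univ_sum (fun _ : Fin n => (Finset.univ : Finset (ZMod 2)))
    (fun l b => pb b * ((if l = i then (chi b - 1/3) else 1) * (if l = j then (chi b - 1/3) else 1)))
  rw [Fintype.piFinset_univ] at this
  rw [← this]
  apply Finset.prod_eq_zero (Finset.mem_univ i)
  simp [hij]
  simpa using pb_mean

lemma dist_nonneg' {α β : Type*} [Fintype α] [DecidableEq β] (f : α → β) (y : β) : 0 ≤ distOf f y := by
  unfold distOf; positivity

lemma dist_sum {α β : Type*} [Fintype α] [Fintype β] [DecidableEq β] (f : α → β) (F : β → ℝ) :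
    ∑ y, distOf f y * F y = Ex (fun x => F (f x)) := by
  unfold distOf Ex
  simp_rw [div_mul_eq_mul_div]
  rw [← Finset.sum_div]
  congr 1
  rw [← Finset.sum_fiberwise (s := Finset.univ) (g := f)]
  apply Finset.sum_congr rfl
  intro y _
  rw [← nsmul_eq_mul, ← Finset.sum_const]
  apply Finset.sum_congr rfl
  intro x hx
  rw [(Finset.mem_filter.1 hx).2]

noncomputable def ov {n : ℕ} {α : Type*} [Fintype α] (Q : Fin n → α → ZMod 2) : ℝ :=
  ∑ y, min (distOf (fun x i => Q i x) y) (ber13 y)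

lemma tv_eq {m n : ℕ} (P : Fin n → (Fin m → ZMod 2) → ZMod 2) :
    tvDist (outDist P) ber13 = 1 - ov P := by
  have h1 : ∑ y, outDist P y = 1 := by
    have := dist_sum (fun (x : Fin m → ZMod 2) i => P i x) (fun _ => (1:ℝ))
    rw [Ex_const] at this
    simpa [outDist] using this
  unfold tvDist ov
  have h2 : ∀ y, |outDist P y - ber13 y| = outDist P y + ber13 y -
      2 * min (distOf (fun x i => P i x) y) (ber13 y) := by
    intro y
    change |outDist P y - ber13 y| = outDist P y + ber13 y - 2 * min (outDist P y) (ber13 y)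
    rcases le_total (outDist P y) (ber13 y) with h | h
    · rw [min_eq_left h, abs_of_nonpos (by linarith)]; ring
    · rw [min_eq_right h, abs_of_nonneg (by linarith)]; ring
  simp_rw [h2]
  rw [Finset.sum_sub_distrib, Finset.sum_add_distrib, h1, ber_sum, ← Finset.mul_sum]
  ring

lemma ov_cover {n : ℕ} {α β : Type*} [Fintype α] [Fintype β] (Q : Fin n → α → ZMod 2)
    (Q' : ZMod 2 → Fin n → β → ZMod 2)
    (h : ∀ y, distOf (fun x i => Q i x) y ≤ ∑ a, distOf (fun x i => Q' a i x) y) (ε : ℝ)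
    (hε : ∀ a, ov (Q' a) ≤ ε) : ov Q ≤ 2 * ε := by
  have h1 : ov Q ≤ ov (Q' 0) + ov (Q' 1) := by
    unfold ov
    rw [← Finset.sum_add_distrib]
    apply Finset.sum_le_sum
    intro y _
    have h2 := h y
    rw [sum_zmod2] at h2
    have hb := ber_nonneg y
    have a0 := dist_nonneg' (fun x i => Q' 0 i x) y
    have a1 := dist_nonneg' (fun x i => Q' 1 i x) y
    rcases le_total (distOf (fun x i => Q' 0 i x) y) (ber13 y) with k0 | k0
    · rcases le_total (distOf (fun x i => Q' 1 i x) y) (ber13 y) with k1 | k1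
      · rw [min_eq_left k0, min_eq_left k1]
        exact (min_le_left _ _).trans h2
      · rw [min_eq_right k1, min_eq_left k0]
        exact (min_le_right _ _).trans (by linarith)
    · rw [min_eq_right k0]
      refine (min_le_right _ _).trans ?_
      have : 0 ≤ min (distOf (fun x i => Q' 1 i x) y) (ber13 y) := le_min a1 hb
      linarith
  linarith [hε 0, hε 1]

lemma ov_cond {n : ℕ} {α : Type*} [Fintype α] (Q : Fin n → α → ZMod 2)
    (Q' : ZMod 2 → Fin n → α → ZMod 2) (g : α → ZMod 2) (hg : ∀ i x, Q' (g x) i x = Q i x) (ε : ℝ)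
    (hε : ∀ a, ov (Q' a) ≤ ε) : ov Q ≤ 2 * ε := by
  classical
  apply ov_cover Q Q' _ ε hε
  intro y
  unfold distOf
  rw [← Finset.sum_div]
  gcongr
  norm_cast
  calc _ ≤ (Finset.univ.biUnion fun a => Finset.univ.filter fun x => (fun i => Q' a i x) = y).card := by
        apply Finset.card_le_card
        intro x hx
        simp only [mem_filter, mem_univ, true_and, mem_biUnion] at hx ⊢
        refine ⟨g x, ?_⟩
        rw [← hx]; funext i; exact hg i x
    _ ≤ _ := Finset.card_biUnion_le

lemma ov_lin {n : ℕ} {V : Type} [AddCommGroup V] [Module (ZMod 2) V] [Fintype V]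
    (Q : Fin n → V → ZMod 2) (φ : V →ₗ[ZMod 2] ZMod 2) [Fintype (LinearMap.ker φ)]
    (v : V) (hv : φ v = 1) (ε : ℝ)
    (hε : ∀ a : ZMod 2, ov (fun i (x : LinearMap.ker φ) => Q i (x + a • v)) ≤ ε) : ov Q ≤ 2 * ε := by
  classical
  apply ov_cover Q (fun (a : ZMod 2) i (x : LinearMap.ker φ) => Q i (x + a • v)) _ ε hε
  intro y
  unfold distOf
  rw [← Finset.sum_div]
  have hc : (Fintype.card (LinearMap.ker φ) : ℝ) ≤ Fintype.card V := by
    exact_mod_cast Fintype.card_subtype_le _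
  have hpos : (0:ℝ) < Fintype.card (LinearMap.ker φ) := by
    exact_mod_cast Fintype.card_pos
  refine div_le_div₀ (by positivity) ?_ hpos hc
  norm_cast
  have key : (Finset.univ.filter fun x : V => (fun i => Q i x) = y) ⊆ Finset.univ.biUnion fun a : ZMod 2 =>
        Finset.image (fun x : LinearMap.ker φ => (x : V) + a • v)
        (Finset.univ.filter fun x : LinearMap.ker φ => (fun i => Q i ((x : V) + a • v)) = y) := by
    intro x hx
    simp only [mem_filter, mem_univ, true_and, mem_biUnion, mem_image] at hx ⊢
    refine ⟨φ x, ⟨x + φ x • v, by simp [LinearMap.mem_ker, hv, zmod2_add_self]⟩, ?_, ?_⟩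
    · rw [← hx]; funext i
      simp [vcancel]
    · simp [vcancel]
  exact (Finset.card_le_card key).trans (Finset.card_biUnion_le.trans
    (Finset.sum_le_sum fun a _ => Finset.card_image_le))

lemma sq_sum_bound {ι : Type*} (J : Finset ι) (c : ι → ι → ℝ) (A B : ℝ)
    (hd : ∀ i ∈ J, c i i ≤ A) (ho : ∀ i ∈ J, ∀ j ∈ J, i ≠ j → c i j ≤ B) (hB : 0 ≤ B) :
    ∑ i ∈ J, ∑ j ∈ J, c i j ≤ J.card * A + J.card ^ 2 * B := by
  classical
  calc ∑ i ∈ J, ∑ j ∈ J, c i j ≤ ∑ i ∈ J, ∑ j ∈ J, ((if i = j then A else 0) + B) := by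
        apply Finset.sum_le_sum; intro i hi
        apply Finset.sum_le_sum; intro j hj
        split_ifs with h
        · subst h; linarith [hd i hi]
        · linarith [ho i hi j hj h]
    _ = _ := by
        simp [Finset.sum_add_distrib]
        ring

lemma success {n : ℕ} {α : Type*} [Fintype α] [Nonempty α] (Q : Fin n → α → ZMod 2)
    (J : Finset (Fin n)) (hJ : J.Nonempty) (μ : Fin n → ℝ) (γ δ : ℝ) (hγ : 0 < γ) (hδ : 0 ≤ δ)
    (hμ : ∀ i ∈ J, |μ i| ≤ 1) (hgap : ∀ i ∈ J, γ ≤ |μ i - 1/3|)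
    (hcov : ∀ i ∈ J, ∀ j ∈ J, i ≠ j →
      |Ex (fun x => (chi (Q i x) - μ i) * (chi (Q j x) - μ j))| ≤ δ) :
    ov Q ≤ 2 * (6 / (J.card : ℝ) + δ) / γ ^ 2 := by
  classical
  obtain ⟨σ, hσ1, hσ2⟩ : ∃ σ : Fin n → ℝ, (∀ i, |σ i| = 1) ∧ ∀ i, σ i * (μ i - 1/3) = |μ i - 1/3| := by
    refine ⟨fun i => if 0 ≤ μ i - 1/3 then 1 else -1, fun i => by dsimp only; split_ifs <;> simp, fun i => ?_⟩
    dsimp only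
    split_ifs with h
    · rw [abs_of_nonneg h, one_mul]
    · rw [abs_of_neg (not_le.1 h)]; ring
  have hσσ : ∀ i j, |σ i * σ j| = 1 := fun i j => by rw [abs_mul, hσ1, hσ1, one_mul]
  set t : ℝ := (J.card : ℝ) with ht
  have htpos : 0 < t := by
    rw [ht]; exact_mod_cast Finset.card_pos.2 hJ
  set m : ℝ := ∑ i ∈ J, |μ i - 1/3| with hm
  have hmt : γ * t ≤ m := by
    rw [hm, ht, mul_comm, ← nsmul_eq_mul, ← Finset.sum_const]
    exact Finset.sum_le_sum hgap
  set S : (Fin n → ZMod 2) → ℝ := fun y => ∑ i ∈ J, σ i * (chi (y i) - 1/3) with hS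
  have hber : ∑ y, ber13 y * S y ^ 2 ≤ t * 2 := by
    have e : ∑ y, ber13 y * S y ^ 2 = ∑ i ∈ J, ∑ j ∈ J, ∑ y : Fin n → ZMod 2,
        (σ i * σ j) * (ber13 y * ((chi (y i) - 1/3) * (chi (y j) - 1/3))) := by
      have : ∀ y, ber13 y * S y ^ 2 = ∑ i ∈ J, ∑ j ∈ J,
          (σ i * σ j) * (ber13 y * ((chi (y i) - 1/3) * (chi (y j) - 1/3))) := by
        intro y
        rw [hS, sq, Finset.sum_mul_sum, Finset.mul_sum]
        apply Finset.sum_congr rfl; intro i _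
        rw [Finset.mul_sum]
        apply Finset.sum_congr rfl; intro j _
        ring
      simp_rw [this]
      rw [Finset.sum_comm]
      apply Finset.sum_congr rfl; intro i _
      rw [Finset.sum_comm]
    rw [e]
    have := sq_sum_bound J (fun i j => ∑ y : Fin n → ZMod 2,
        (σ i * σ j) * (ber13 y * ((chi (y i) - 1/3) * (chi (y j) - 1/3)))) 2 0 (by
          intro i _
          calc ∑ y : Fin n → ZMod 2,
            (σ i * σ i) * (ber13 y * ((chi (y i) - 1/3) * (chi (y i) - 1/3))) ≤
              ∑ y : Fin n → ZMod 2, ber13 y * 2 := by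
                apply Finset.sum_le_sum
                intro y _
                have h1 : σ i * σ i = 1 := by
                  have := hσ1 i
                  rw [← abs_mul_abs_self, this, one_mul]
                rw [h1, one_mul]
                apply mul_le_mul_of_nonneg_left _ (ber_nonneg y)
                unfold chi; split_ifs <;> norm_num
            _ = 2 := by rw [← Finset.sum_mul, ber_sum, one_mul]) (by
          intro i _ j _ hij
          rw [← Finset.mul_sum, ber_cov hij, mul_zero]) le_rfl
    linarith
  have hQ : Ex (fun x => (S (fun i => Q i x) - m) ^ 2) ≤ t * 4 + t ^ 2 * δ := by
    have e : (fun x => (S (fun i => Q i x) - m) ^ 2) = fun x => ∑ i ∈ J, ∑ j ∈ J,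
        (σ i * σ j) * ((chi (Q i x) - μ i) * (chi (Q j x) - μ j)) := by
      funext x
      have : S (fun i => Q i x) - m = ∑ i ∈ J, σ i * (chi (Q i x) - μ i) := by
        rw [hS, hm]
        simp_rw [← hσ2]
        rw [← Finset.sum_sub_distrib]
        apply Finset.sum_congr rfl; intro i _; ring
      rw [this, sq, Finset.sum_mul_sum]
      apply Finset.sum_congr rfl; intro i _
      apply Finset.sum_congr rfl; intro j _
      ring
    rw [e, Ex_sum]
    simp_rw [Ex_sum, Ex_mul_left]
    have hb : ∀ i ∈ J, ∀ j ∈ J, ∀ c : ℝ, |Ex (fun x => (chi (Q i x) - μ i) * (chi (Q j x) - μ j))| ≤ c →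
        σ i * σ j * Ex (fun x => (chi (Q i x) - μ i) * (chi (Q j x) - μ j)) ≤ c := by
      intro i _ j _ c hc
      refine (le_abs_self _).trans ?_
      rw [abs_mul, hσσ, one_mul]; exact hc
    apply sq_sum_bound J _ 4 δ _ _ hδ
    · intro i hi
      apply hb i hi i hi
      apply Ex_abs_le
      intro x
      have h1 := chi_abs (Q i x)
      have h2 := hμ i hi
      rw [abs_mul]
      have h3 := abs_sub (chi (Q i x)) (μ i)
      have h4 := abs_nonneg (chi (Q i x) - μ i)
      nlinarith
    · intro i hi j hj hij
      exact hb i hi j hj _ (hcov i hi j hj hij)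
  have hmain : ov Q * (m ^ 2 / 2) ≤ t * 6 + t ^ 2 * δ := by
    calc ov Q * (m ^ 2 / 2) ≤ ∑ y, (distOf (fun x i => Q i x) y * (S y - m) ^ 2 + ber13 y * S y ^ 2) := by
          unfold ov
          rw [Finset.sum_mul]
          apply Finset.sum_le_sum
          intro y _
          have h1 := min_le_left (distOf (fun x i => Q i x) y) (ber13 y)
          have h2 := min_le_right (distOf (fun x i => Q i x) y) (ber13 y)
          have h0 : 0 ≤ min (distOf (fun x i => Q i x) y) (ber13 y) :=
            le_min (dist_nonneg' _ _) (ber_nonneg y)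
          have h3 : m ^ 2 / 2 ≤ (S y - m) ^ 2 + S y ^ 2 := by nlinarith [sq_nonneg (2 * S y - m)]
          calc _ ≤ min (distOf (fun x i => Q i x) y) (ber13 y) * ((S y - m) ^ 2 + S y ^ 2) := by gcongr
            _ = min (distOf (fun x i => Q i x) y) (ber13 y) * (S y - m) ^ 2 +
              min (distOf (fun x i => Q i x) y) (ber13 y) * S y ^ 2 := by ring
            _ ≤ _ := by gcongr
      _ = Ex (fun x => (S (fun i => Q i x) - m) ^ 2) + ∑ y, ber13 y * S y ^ 2 := by
          rw [Finset.sum_add_distrib, dist_sum (fun x i => Q i x) (fun y => (S y - m) ^ 2)]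
      _ ≤ _ := by linarith
  have hov : 0 ≤ ov Q := Finset.sum_nonneg fun y _ => le_min (dist_nonneg' _ _) (ber_nonneg y)
  have h1 : ov Q * ((γ * t) ^ 2 / 2) ≤ t * 6 + t ^ 2 * δ := le_trans (by gcongr) hmain
  rw [le_div_iff₀ (by positivity)]
  have h2 : ov Q * γ ^ 2 * t ^ 2 ≤ (2 * (6 / t + δ)) * t ^ 2 := by
    have : (2 * (6 / t + δ)) * t ^ 2 = 2 * (t * 6 + t ^ 2 * δ) := by field_simp
    rw [this]; nlinarith
  exact le_of_mul_le_mul_right h2 (by positivity)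
end
end CL

namespace CL
section
variable {V : Type} [AddCommGroup V] [Module (ZMod 2) V] [Fintype V]
open Module

/-- typical structured cubic -/
structure TD (r k D : ℕ) (Q : V → ZMod 2) where
  W : Submodule (ZMod 2) V
  U : Submodule (ZMod 2) V
  G : Submodule (ZMod 2) (V → ZMod 2)
  rho : V → (V → ZMod 2)
  hUW : U ≤ W
  hW : finrank (ZMod 2) V ≤ r + finrank (ZMod 2) W
  hU : finrank (ZMod 2) V ≤ D + finrank (ZMod 2) U
  hG : finrank (ZMod 2) G ≤ k
  hGq : ∀ g ∈ G, Quad g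
  hrho : ∀ x, rho x ∈ G
  hrhoW : ∀ x, ∀ w ∈ W, rho (x + w) = rho x
  hQU : ∀ x, ∀ w ∈ U, Q (x + w) + rho x (x + w) = Q x + rho x x
  hQuad : QuadOn W Q

def Low (K : ℕ) (g : V → ZMod 2) : Prop := finrank (ZMod 2) V ≤ K + finrank (ZMod 2) (Rad g)

def Piece (U : Submodule (ZMod 2) V) (K : ℕ) (Φ : V → ℝ) : Prop :=
  ∀ x, (∀ u ∈ U, Φ (x + u) = 0) ∨ ∃ (g : V → ZMod 2) (c : ℝ), Quad g ∧ ¬ Low K g ∧ |c| ≤ 1 ∧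
    ∀ u ∈ U, Φ (x + u) = c * chi (g (x + u))

lemma piece_bound {U : Submodule (ZMod 2) V} {K D q : ℕ} {Φ : V → ℝ} (h : Piece U K Φ)
    (hU : finrank (ZMod 2) V ≤ D + finrank (ZMod 2) U) (hK : 2 * D + 2 * q ≤ K) :
    |Ex Φ| ≤ (1/2:ℝ) ^ q := by
  classical
  rw [Ex_avg U Φ]
  apply Ex_abs_le
  intro x
  rcases h x with h0 | ⟨g, c, hg, hl, hc, hu⟩
  · have : (fun u : U => Φ (x + u)) = fun _ => 0 := by funext u; exact h0 u u.2
    rw [this, Ex_const, abs_zero]; positivity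
  · have : (fun u : U => Φ (x + u)) = fun u : U => c * chi (g (x + u)) := by funext u; exact hu u u.2
    rw [this, Ex_mul_left, abs_mul]
    have h1 := coset_bias hg U hU x
    have h2 : (2:ℝ) ^ (2 * D) * 2 ^ finrank (ZMod 2) (Rad g) / 2 ^ finrank (ZMod 2) V ≤ ((1/2:ℝ) ^ q) ^ 2 := by
      rw [div_le_iff₀ (by positivity), ← pow_mul, one_div, inv_pow, ← div_eq_inv_mul, le_div_iff₀ (by positivity),
        ← pow_add, ← pow_add]
      apply pow_le_pow_right₀ (by norm_num)
      unfold Low at hl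
      omega
    have h3 : |Ex (fun u : U => chi (g (x + u)))| ≤ (1/2:ℝ) ^ q := by
      apply abs_le_of_sq_le_sq _ (by positivity)
      exact h1.trans h2
    calc |c| * |Ex (fun u : U => chi (g (x + u)))| ≤ 1 * (1/2:ℝ) ^ q :=
          mul_le_mul hc h3 (abs_nonneg _) (by norm_num)
      _ = _ := one_mul _

namespace TD
variable {r k D : ℕ} {Q Q' : V → ZMod 2}

open Classical in
noncomputable def A (T : TD r k D Q) (x : V) : ℝ := if T.rho x = 0 then chi (Q x) else 0
noncomputable def B (T : TD r k D Q) (x : V) : ℝ := chi (Q x) - T.A x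
noncomputable def al (T : TD r k D Q) : ℝ := Ex T.A

lemma rhoU (T : TD r k D Q) (x : V) {u : V} (hu : u ∈ T.U) : T.rho (x + u) = T.rho x :=
  T.hrhoW x u (T.hUW hu)

lemma A_inv (T : TD r k D Q) (x : V) {u : V} (hu : u ∈ T.U) : T.A (x + u) = T.A x := by
  unfold A
  rw [T.rhoU x hu]
  split_ifs with h
  · have := T.hQU x u hu
    rw [h] at this
    simp only [Pi.zero_apply, add_zero] at this
    rw [this]
  · rfl

lemma A_abs (T : TD r k D Q) (x : V) : |T.A x| ≤ 1 := by
  unfold A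
  split_ifs
  · exact (chi_abs _).le
  · simp

lemma al_abs (T : TD r k D Q) : |T.al| ≤ 1 := Ex_abs_le T.A_abs

lemma B_piece (T : TD r k D Q) (x : V) : (∀ u ∈ T.U, T.B (x + u) = 0) ∨
    (T.rho x ≠ 0 ∧ ∃ c : ℝ, |c| ≤ 1 ∧ ∀ u ∈ T.U, T.B (x + u) = c * chi (T.rho x (x + u))) := by
  by_cases h : T.rho x = 0
  · left
    intro u hu
    simp [B, A, T.rhoU x hu, h]
  · right
    refine ⟨h, chi (Q x + T.rho x x), (chi_abs _).le, fun u hu => ?_⟩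
    simp only [B, A, T.rhoU x hu, h, if_false, sub_zero]
    rw [← T.hQU x u hu, chi_add, mul_assoc, chi_sq, mul_one]

def Good (T : TD r k D Q) (K : ℕ) : Prop := ∀ g ∈ T.G, g ≠ 0 → ¬ Low K g

def Unrel (T : TD r k D Q) (T' : TD r k D Q') (K : ℕ) : Prop :=
  T.U ⊔ T'.U = ⊤ ∧ ∀ g ∈ T.G, g ≠ 0 → ∀ g' ∈ T'.G, g' ≠ 0 → ¬ Low K (g + g')

lemma B_bound (T : TD r k D Q) {K q : ℕ} (hg : T.Good K) (hK : 2 * D + 2 * q ≤ K) : |Ex T.B| ≤ (1/2:ℝ) ^ q := by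
  refine piece_bound (U := T.U) (K := K) (D := D) (fun x => ?_) T.hU hK
  rcases T.B_piece x with h | ⟨h0, c, hc, h⟩
  · exact Or.inl h
  · exact Or.inr ⟨T.rho x, c, T.hGq _ (T.hrho x), hg _ (T.hrho x) h0, hc, h⟩

lemma finrank_inf (U U' : Submodule (ZMod 2) V) {D D' : ℕ} (h : finrank (ZMod 2) V ≤ D + finrank (ZMod 2) U)
    (h' : finrank (ZMod 2) V ≤ D' + finrank (ZMod 2) U') :
    finrank (ZMod 2) V ≤ (D + D') + finrank (ZMod 2) (U ⊓ U' : Submodule (ZMod 2) V) := by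
  have h1 := Submodule.finrank_sup_add_finrank_inf_eq U U'
  have h2 := Submodule.finrank_le (U ⊔ U')
  omega

lemma AB_bound (T : TD r k D Q) (T' : TD r k D Q') {K q : ℕ} (hg : T'.Good K)
    (hK : 4 * D + 2 * q ≤ K) : |Ex (fun x => T.A x * T'.B x)| ≤ (1/2:ℝ) ^ q := by
  refine piece_bound (U := T.U ⊓ T'.U) (K := K) (D := D + D) (fun x => ?_) (finrank_inf _ _ T.hU T'.hU) (by omega)
  rcases T'.B_piece x with h | ⟨h0, c, hc, h⟩
  · left; intro u hu; rw [h u hu.2, mul_zero]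
  · right
    refine ⟨T'.rho x, T.A x * c, T'.hGq _ (T'.hrho x), hg _ (T'.hrho x) h0, ?_, fun u hu => ?_⟩
    · rw [abs_mul]; exact mul_le_one₀ (T.A_abs x) (abs_nonneg _) hc
    · rw [h u hu.2, T.A_inv x hu.1]; ring

lemma quad_add {g g' : V → ZMod 2} (h : Quad g) (h' : Quad g') : Quad (g + g') := by
  intro a b c x
  have h1 := h a b c x
  have h2 := h' a b c x
  simp only [dd, Pi.add_apply] at h1 h2 ⊢
  linear_combination h1 + h2

lemma BB_bound (T : TD r k D Q) (T' : TD r k D Q') {K q : ℕ} (hu : T.Unrel T' K)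
    (hK : 4 * D + 2 * q ≤ K) : |Ex (fun x => T.B x * T'.B x)| ≤ (1/2:ℝ) ^ q := by
  refine piece_bound (U := T.U ⊓ T'.U) (K := K) (D := D + D) (fun x => ?_) (finrank_inf _ _ T.hU T'.hU) (by omega)
  rcases T.B_piece x with h | ⟨h0, c, hc, h⟩
  · left; intro u hu; rw [h u hu.1, zero_mul]
  rcases T'.B_piece x with h' | ⟨h0', c', hc', h'⟩
  · left; intro u hu; rw [h' u hu.2, mul_zero]
  · right
    refine ⟨T.rho x + T'.rho x, c * c', quad_add (T.hGq _ (T.hrho x)) (T'.hGq _ (T'.hrho x)),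
      hu.2 _ (T.hrho x) h0 _ (T'.hrho x) h0', ?_, fun u hu => ?_⟩
    · rw [abs_mul]; exact mul_le_one₀ hc (abs_nonneg _) hc'
    · rw [h u hu.1, h' u hu.2, Pi.add_apply, chi_add]; ring

lemma AA (T : TD r k D Q) (T' : TD r k D Q') (h : T.U ⊔ T'.U = ⊤) :
    Ex (fun x => T.A x * T'.A x) = T.al * T'.al := by
  classical
  set a : V → ℝ := fun x => Ex (fun u : T'.U => T.A (x + u)) with ha
  have hconst : ∀ x, a x = a 0 := by
    intro x
    have hx : x ∈ T.U ⊔ T'.U := by rw [h]; trivial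
    obtain ⟨u, hu, v, hv, rfl⟩ := Submodule.mem_sup.1 hx
    have e1 : a (u + v) = Ex (fun w : T'.U => T.A (w + ⟨v, hv⟩ : T'.U)) := by
      simp only [ha]
      congr 1; funext w
      rw [← T.A_inv ((w + ⟨v, hv⟩ : T'.U) : V) hu]
      congr 1
      push_cast
      abel
    rw [e1]
    have := Ex_shift (fun w : T'.U => T.A w) ⟨v, hv⟩
    rw [this]
    simp [ha]
  have h0 : a 0 = T.al := by
    have : T.al = Ex a := Ex_avg T'.U T.A
    rw [this, show a = fun _ => a 0 from funext hconst, Ex_const]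
  rw [Ex_avg T'.U]
  have : (fun x => Ex fun u : T'.U => T.A (x + u) * T'.A (x + u)) = fun x => T.al * T'.A x := by
    funext x
    have e : (fun u : T'.U => T.A (x + u) * T'.A (x + u)) = fun u : T'.U => T.A (x + u) * T'.A x := by
      funext u; rw [T'.A_inv x u.2]
    rw [e, Ex_mul_right, ← h0, ← hconst x]
  rw [this, Ex_mul_left]; rfl

lemma cov_bound (T : TD r k D Q) (T' : TD r k D Q') {K q : ℕ} (hg : T.Good K) (hg' : T'.Good K)
    (hu : T.Unrel T' K) (hK : 4 * D + 2 * q ≤ K) :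
    |Ex (fun x => (chi (Q x) - T.al) * (chi (Q' x) - T'.al))| ≤ 5 * (1/2:ℝ) ^ q := by
  have e : (fun x => (chi (Q x) - T.al) * (chi (Q' x) - T'.al)) = fun x =>
      (T.A x * T'.A x + T.A x * T'.B x + T'.A x * T.B x + T.B x * T'.B x + T.al * T'.al)
      - (T.al * T'.A x + T'.al * T.A x + T.al * T'.B x + T'.al * T.B x) := by
    funext x
    simp only [B]; ring
  rw [e, Ex_sub]
  simp only [Ex_add, Ex_mul_left, Ex_const]
  rw [AA T T' hu.1]
  have h1 := AB_bound T T' hg' hK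
  have h2 := AB_bound T' T hg hK
  have h3 := BB_bound T T' hu hK
  have h4 := T.B_bound hg (q := q) (by omega)
  have h5 := T'.B_bound hg' (q := q) (by omega)
  have h6 : |T.al * Ex T'.B| ≤ (1/2:ℝ) ^ q := by
    rw [abs_mul]
    calc _ ≤ 1 * (1/2:ℝ) ^ q := mul_le_mul T.al_abs h5 (abs_nonneg _) (by norm_num)
      _ = _ := one_mul _
  have h7 : |T'.al * Ex T.B| ≤ (1/2:ℝ) ^ q := by
    rw [abs_mul]
    calc _ ≤ 1 * (1/2:ℝ) ^ q := mul_le_mul T'.al_abs h4 (abs_nonneg _) (by norm_num)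
      _ = _ := one_mul _
  change |T.al * T'.al + _ + _ + _ + _ - (T.al * T'.al + T'.al * T.al + T.al * Ex T'.B + T'.al * Ex T.B)| ≤ _
  rw [abs_le] at *
  constructor <;> nlinarith

lemma al_gap (T : TD r k D Q) {K q : ℕ} (hg : T.Good K) (hK : 2 * D + 2 * q ≤ K) :
    (1/2:ℝ) ^ gapE r - (1/2:ℝ) ^ q ≤ |T.al - 1/3| := by
  have h1 := mean_gap T.hQuad T.hW
  have h2 := T.B_bound hg hK
  have h3 : Ex (fun x => chi (Q x)) = T.al + Ex T.B := by
    unfold al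
    rw [← Ex_add]
    congr 1; funext x; simp [B]
  rw [h3] at h1
  have : |T.al + Ex T.B - 1/3| ≤ |T.al - 1/3| + |Ex T.B| := by
    rw [show T.al + Ex T.B - 1/3 = (T.al - 1/3) + Ex T.B by ring]
    exact abs_add_le _ _
  linarith

end TD
end

lemma greedy {ι : Type*} [DecidableEq ι] (R : ι → ι → Prop) (hs : ∀ i j, R i j → R j i) (N : ℕ) (hN : 1 ≤ N) :
    ∀ (t : ℕ) (I : Finset ι), t * N ≤ I.card →
    (∃ J ⊆ I, J.card = t ∧ ∀ i ∈ J, ∀ j ∈ J, i ≠ j → ¬ R i j) ∨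
    (∃ i ∈ I, ∃ J ⊆ I, N ≤ J.card ∧ ∀ j ∈ J, R i j) := by
  classical
  intro t
  induction t with
  | zero => intro I _; left; exact ⟨∅, by simp, rfl, by simp⟩
  | succ t ih =>
    intro I hI
    by_cases hbig : ∃ i ∈ I, ∃ J ⊆ I, N ≤ J.card ∧ ∀ j ∈ J, R i j
    · exact Or.inr hbig
    have hpos : 0 < I.card := by
      have : 1 ≤ (t + 1) * N := by nlinarith
      omega
    obtain ⟨i, hi⟩ := Finset.card_pos.1 hpos
    have hlt : (I.filter (fun j => R i j)).card < N := by
      by_contra hc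
      exact hbig ⟨i, hi, I.filter (fun j => R i j), Finset.filter_subset _ _, not_lt.1 hc,
        fun j hj => (Finset.mem_filter.1 hj).2⟩
    set I' := (I.filter (fun j => ¬ R i j)).erase i with hI'
    have hsum := Finset.card_filter_add_card_filter_not (s := I) (fun j => R i j)
    have herase : (I.filter (fun j => ¬ R i j)).card - 1 ≤ I'.card := Finset.pred_card_le_card_erase
    have hI'c : t * N ≤ I'.card := by
      have : (t + 1) * N = t * N + N := by ring
      omega
    have hsub : I' ⊆ I := (Finset.erase_subset _ _).trans (Finset.filter_subset _ _)
    rcases ih I' hI'c with ⟨J, hJ, hJc, hJR⟩ | ⟨i', hi', J, hJ, h⟩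
    · left
      have hiJ : i ∉ J := fun h => by simpa [hI'] using hJ h
      refine ⟨insert i J, ?_, ?_, ?_⟩
      · intro x hx
        rcases Finset.mem_insert.1 hx with rfl | hx
        · exact hi
        · exact hsub (hJ hx)
      · rw [Finset.card_insert_of_notMem hiJ, hJc]
      · have hn : ∀ j ∈ J, ¬ R i j := fun j hj => by
          have := hJ hj
          simp only [hI', mem_erase, mem_filter] at this
          exact this.2.2
        intro a ha b hb hab
        rcases Finset.mem_insert.1 ha with rfl | ha2
        · rcases Finset.mem_insert.1 hb with rfl | hb2
          · exact absurd rfl hab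
          · exact hn b hb2
        · rcases Finset.mem_insert.1 hb with rfl | hb2
          · exact fun h => hn a ha2 (hs _ _ h)
          · exact hJR a ha2 b hb2 hab
    · exact absurd ⟨i', hsub hi', J, hJ.trans hsub, h⟩ hbig
end CL

namespace CL
section
variable {V : Type} [AddCommGroup V] [Module (ZMod 2) V] [Fintype V]
open Module

lemma TD.lin {r k D : ℕ} {Q : V → ZMod 2} (T : TD r k (D + 1) Q) (φ : V →ₗ[ZMod 2] ZMod 2) (v : V)
    (hv : φ v = 1) (hφ : ∀ u ∈ T.U, φ u = 0) [Fintype (LinearMap.ker φ)] (a : ZMod 2) :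
    Nonempty (TD r k D (fun x : LinearMap.ker φ => Q (x + a • v))) := by
  classical
  set w0 : V := a • v with hw0
  have hk : finrank (ZMod 2) V = 1 + finrank (ZMod 2) (LinearMap.ker φ) := by
    have h1 := LinearMap.finrank_range_add_finrank_ker φ
    have h2 : LinearMap.range φ = ⊤ := by
      rw [LinearMap.range_eq_top]
      intro y
      exact ⟨y • v, by simp [hv]⟩
    rw [h2, finrank_top, finrank_self] at h1
    omega
  have hc : ∀ S : Submodule (ZMod 2) V, finrank (ZMod 2) (S.comap (LinearMap.ker φ).subtype) =
      finrank (ZMod 2) (LinearMap.ker φ ⊓ S : Submodule (ZMod 2) V) := by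
    intro S
    rw [← Submodule.map_comap_subtype, Submodule.finrank_map_subtype_eq]
  refine ⟨{
    W := T.W.comap (LinearMap.ker φ).subtype
    U := T.U.comap (LinearMap.ker φ).subtype
    G := T.G.map (LinearMap.funLeft (ZMod 2) (ZMod 2) (fun x : LinearMap.ker φ => (x : V) + w0))
    rho := fun x => LinearMap.funLeft (ZMod 2) (ZMod 2) (fun x : LinearMap.ker φ => (x : V) + w0) (T.rho (x + w0))
    hUW := Submodule.comap_mono T.hUW
    hW := ?_
    hU := ?_
    hG := (Submodule.finrank_map_le _ _).trans T.hG
    hGq := ?_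
    hrho := fun x => Submodule.mem_map_of_mem (T.hrho _)
    hrhoW := ?_
    hQU := ?_
    hQuad := ?_ }⟩
  · rw [hc]
    have h1 := Submodule.finrank_sup_add_finrank_inf_eq (LinearMap.ker φ) T.W
    have h2 := Submodule.finrank_le (LinearMap.ker φ ⊔ T.W)
    have := T.hW
    omega
  · rw [hc, inf_eq_right.2 (fun u hu => hφ u hu)]
    have := T.hU
    omega
  · rintro _ ⟨g, hg, rfl⟩ a b c x
    have := T.hGq g hg a b c (x + w0)
    simp only [dd, LinearMap.funLeft_apply] at this ⊢
    push_cast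
    simp only [add_right_comm _ w0] at this
    exact this
  · intro x w hw
    have := T.hrhoW (x + w0) w hw
    congr 1
    rw [← this]
    congr 1
    push_cast
    abel
  · intro x w hw
    have := T.hQU (x + w0) w hw
    simp only [LinearMap.funLeft_apply]
    push_cast
    simp only [add_right_comm _ w0] at this
    exact this
  · intro a ha b hb c hc x
    have := T.hQuad a ha b hb c hc (x + w0)
    simp only [dd] at this ⊢
    push_cast
    simp only [add_right_comm _ w0] at this
    exact this

lemma TD.quad {r k D K : ℕ} {Q : V → ZMod 2} (T : TD r (k + 1) D Q) (g1 : V → ZMod 2) (hg1 : g1 ∈ T.G)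
    (h0 : g1 ≠ 0) (g' : V → ZMod 2) (hq : Quad g') (hl : Low K (g1 + g')) :
    ∃ l : V → ZMod 2, ∀ a : ZMod 2, Nonempty (TD r k (D + (K + 1)) (fun x => Q x + l x * (g' x + a))) := by
  classical
  obtain ⟨x0, hx0⟩ := Function.ne_iff.1 h0
  have hx1 : g1 x0 = 1 := (zmod2_cases _).resolve_left hx0
  refine ⟨fun x => T.rho x x0, fun a => ?_⟩
  have hU' := TD.finrank_inf T.U (Inv (g1 + g')) T.hU (D' := K + 1) (by
    have := Rad_le_Inv (g1 + g')
    unfold Low at hl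
    omega)
  refine ⟨{
    W := T.W
    U := T.U ⊓ Inv (g1 + g')
    G := T.G ⊓ LinearMap.ker (LinearMap.proj (R := ZMod 2) (φ := fun _ : V => ZMod 2) x0)
    rho := fun x => T.rho x + T.rho x x0 • g1
    hUW := inf_le_left.trans T.hUW
    hW := T.hW
    hU := hU'
    hG := ?_
    hGq := fun g hg => T.hGq g hg.1
    hrho := ?_
    hrhoW := ?_
    hQU := ?_
    hQuad := ?_ }⟩
  · have hlt : T.G ⊓ LinearMap.ker (LinearMap.proj (R := ZMod 2) (φ := fun _ : V => ZMod 2) x0) < T.G := by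
      refine lt_of_le_of_ne inf_le_left fun h => ?_
      rw [← h] at hg1
      exact hx0 hg1.2
    have := Submodule.finrank_lt_finrank_of_lt hlt
    have := T.hG
    omega
  · intro x
    refine ⟨T.G.add_mem (T.hrho x) (T.G.smul_mem _ hg1), ?_⟩
    simp [hx1, zmod2_add_self]
  · intro x w hw
    simp only [T.hrhoW x w hw]
  · intro x w hw
    have h1 := T.hQU x w hw.1
    have h2 : (g1 + g') (x + w) = (g1 + g') x := hw.2 x
    simp only [Pi.add_apply, Pi.smul_apply, smul_eq_mul, T.rhoU x hw.1] at h2 ⊢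
    linear_combination h1 + T.rho x x0 * h2
  · intro b hb c hc d hd x
    have h1 := T.hQuad b hb c hc d hd x
    have h2 := hq b c d x
    simp only [dd, T.hrhoW _ _ hb, T.hrhoW _ _ hc, T.hrhoW _ _ hd] at h1 h2 ⊢
    linear_combination h1 + T.rho x x0 * h2 + zmod2_add_self (4 * T.rho x x0 * a)

lemma pigeon {M ι : Type} [AddCommGroup M] [Module (ZMod 2) M] [Finite M] (S : Submodule (ZMod 2) M) (c N : ℕ)
    (hS : finrank (ZMod 2) S ≤ c) (J : Finset ι) (P : ι → M → Prop) (hP : ∀ j ∈ J, ∃ s ∈ S, P j s)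
    (hJ : 2 ^ c * N ≤ J.card) : ∃ s ∈ S, ∃ J' ⊆ J, N ≤ J'.card ∧ ∀ j ∈ J', P j s := by
  classical
  have := Fintype.ofFinite M
  choose! f hf hf2 using hP
  have hcard : (Finset.univ.filter (fun s => s ∈ S)).card ≤ 2 ^ c := by
    rw [← Fintype.card_subtype]
    have := card_eq_nat (V := S)
    calc _ = 2 ^ finrank (ZMod 2) S := by
          rw [← this]
      _ ≤ _ := Nat.pow_le_pow_right (by norm_num) hS
  obtain ⟨s, hs, h⟩ := Finset.exists_le_card_fiber_of_mul_le_card_of_maps_to (s := J)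
    (t := Finset.univ.filter (fun s => s ∈ S)) (f := f) (n := N)
    (fun j hj => by simpa using hf j hj) ⟨0, by simp⟩ ((Nat.mul_le_mul_right N hcard).trans hJ)
  refine ⟨s, by simpa using hs, J.filter (fun j => f j = s), Finset.filter_subset _ _, h, fun j hj => ?_⟩
  obtain ⟨h1, rfl⟩ := Finset.mem_filter.1 hj
  exact hf2 j h1

lemma ov_quad_step {n r k D K e : ℕ} (Q : Fin n → V → ZMod 2) (I : Finset (Fin n))
    (g' : V → ZMod 2) (hq : Quad g')
    (h : ∀ i ∈ I, ∃ T : TD r (k + 1) D (Q i), ∃ g1 ∈ T.G, g1 ≠ 0 ∧ Low K (g1 + g'))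
    (IH : ∀ Q' : Fin n → V → ZMod 2, (∀ i ∈ I, Nonempty (TD r k (D + (K + 1)) (Q' i))) → ov Q' ≤ (1/2:ℝ) ^ (e + 1)) :
    ov Q ≤ (1/2:ℝ) ^ e := by
  classical
  have h2 : ∀ i ∈ I, ∃ l : V → ZMod 2, ∀ a : ZMod 2,
      Nonempty (TD r k (D + (K + 1)) (fun x => Q i x + l x * (g' x + a))) := by
    intro i hi
    obtain ⟨T, g1, hg1, h0, hl⟩ := h i hi
    exact T.quad g1 hg1 h0 g' hq hl
  choose! l hl using h2
  have := ov_cond Q (fun a i x => if i ∈ I then Q i x + l i x * (g' x + a) else Q i x) g' (by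
    intro i x
    split_ifs
    · rw [zmod2_add_self, mul_zero, add_zero]
    · rfl) ((1/2:ℝ) ^ (e + 1)) (by
    intro a
    apply IH
    intro i hi
    simp only [hi, if_true]
    exact hl i hi a)
  rw [pow_succ] at this
  linarith

lemma TD.Unrel_symm {r k D K : ℕ} {Q Q' : V → ZMod 2} {T : TD r k D Q} {T' : TD r k D Q'} (h : T.Unrel T' K) :
    T'.Unrel T K := by
  refine ⟨by rw [sup_comm]; exact h.1, fun g hg h0 g' hg' h0' => ?_⟩
  rw [add_comm]
  exact h.2 g' hg' h0' g hg h0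

lemma ov_success_step {n r k D e : ℕ} (he : gapE r + 1 ≤ e) (Q : Fin n → V → ZMod 2) (J : Finset (Fin n))
    (T : ∀ i ∈ J, TD r k D (Q i)) (hJ : J.card = 2 ^ (3 * e + 5)) (K : ℕ) (hK : K = 4 * D + 2 * (3 * e + 4))
    (hg : ∀ i hi, (T i hi).Good K) (hu : ∀ i hi j hj, i ≠ j → (T i hi).Unrel (T j hj) K) :
    ov Q ≤ (1/2:ℝ) ^ e := by
  classical
  set q := 3 * e + 4 with hq
  have hJ0 : J.Nonempty := Finset.card_pos.1 (by rw [hJ]; positivity)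
  have := success Q J hJ0 (fun i => if h : i ∈ J then (T i h).al else 0) ((1/2:ℝ) ^ e) (5 * (1/2:ℝ) ^ q)
    (by positivity) (by positivity) (by
      intro i hi
      simp only [hi, dif_pos]
      exact (T i hi).al_abs) (by
      intro i hi
      simp only [hi, dif_pos]
      refine le_trans ?_ ((T i hi).al_gap (hg i hi) (q := q) (by omega))
      have h1 : (1/2:ℝ) ^ e ≤ (1/2:ℝ) ^ (gapE r + 1) := pow_le_pow_of_le_one (by norm_num) (by norm_num) he
      have h2 : (1/2:ℝ) ^ q ≤ (1/2:ℝ) ^ (gapE r + 1) := pow_le_pow_of_le_one (by norm_num) (by norm_num) (by omega)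
      rw [pow_succ _ (gapE r)] at h1 h2
      linarith) (by
      intro i hi j hj hij
      simp only [hi, hj, dif_pos]
      exact TD.cov_bound _ _ (hg i hi) (hg j hj) (hu i hi j hj hij) (by omega))
  refine this.trans (le_of_eq ?_)
  rw [hJ, hq]
  push_cast
  rw [show (1/2:ℝ) ^ (3 * e + 4) = ((1/2:ℝ) ^ e) ^ 3 / 16 by rw [pow_add, mul_comm 3 e, pow_mul]; ring]
  rw [show (2:ℝ) ^ (3 * e + 5) = 32 / ((1/2:ℝ) ^ e) ^ 3 by
    rw [pow_add, mul_comm 3 e, pow_mul, one_div, inv_pow, inv_pow, div_inv_eq_mul]; ring]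
  have : (1/2:ℝ) ^ e ≠ 0 := by positivity
  field_simp
  ring
end
end CL

namespace CL
open Module

lemma exists_functional {V : Type} [AddCommGroup V] [Module (ZMod 2) V] [Fintype V]
    (S : Submodule (ZMod 2) V) (h : S ≠ ⊤) :
    ∃ φ : V →ₗ[ZMod 2] ZMod 2, φ ≠ 0 ∧ ∀ u ∈ S, φ u = 0 := by
  obtain ⟨f, hf, hS⟩ := Submodule.exists_le_ker_of_lt_top S (lt_top_iff_ne_top.2 h)
  exact ⟨f, hf, fun u hu => hS hu⟩

lemma exists_functional2 {V : Type} [AddCommGroup V] [Module (ZMod 2) V] [Fintype V]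
    (S S' : Submodule (ZMod 2) V) (h : S ⊔ S' ≠ ⊤) :
    ∃ φ ∈ S.dualAnnihilator, φ ≠ 0 ∧ ∀ u ∈ S', φ u = 0 := by
  obtain ⟨φ, h0, hφ⟩ := exists_functional _ h
  refine ⟨φ, ?_, h0, fun u hu => hφ u (Submodule.mem_sup_right hu)⟩
  rw [Submodule.mem_dualAnnihilator]
  exact fun u hu => hφ u (Submodule.mem_sup_left hu)

set_option maxHeartbeats 800000 in
lemma main_ind (r Z : ℕ) : ∀ f k D e : ℕ, gapE r + 1 ≤ e → Z ≤ e + f → 12 ^ k * (D + e) < Z →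
    ∀ (V : Type) [AddCommGroup V] [Module (ZMod 2) V] [Fintype V] (n : ℕ) (Q : Fin n → V → ZMod 2)
      (I : Finset (Fin n)), 2 ^ (10 * Z * f) ≤ I.card → (∀ i ∈ I, Nonempty (TD r k D (Q i))) →
      ov Q ≤ (1/2:ℝ) ^ e := by
  intro f
  induction f with
  | zero =>
    intro k D e _ hZ hlt
    exfalso
    have : 1 ≤ 12 ^ k := Nat.one_le_pow _ _ (by norm_num)
    nlinarith
  | succ f ih =>
    intro k D e he hZ hlt V _ _ _ n Q I hI hT
    classical
    have h12 : 1 ≤ 12 ^ k := Nat.one_le_pow _ _ (by norm_num)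
    have heZ : D + e < Z := by nlinarith
    have he7 : 7 ≤ e := by
      have : 6 ≤ gapE r := by
        unfold gapE
        have : 1 ≤ 2 ^ r := Nat.one_le_pow _ _ (by norm_num)
        nlinarith
      omega
    have hkZ : k < Z := by
      have : k < 12 ^ k := Nat.lt_pow_self (by norm_num)
      nlinarith
    have T0 : ∀ i (hi : i ∈ I), TD r k D (Q i) := fun i hi => Classical.choice (hT i hi)
    set K := 4 * D + 2 * (3 * e + 4) with hK
    have hpow : (2:ℕ) ^ (10 * Z * (f + 1)) = 2 ^ (10 * Z * f) * 2 ^ (10 * Z) := by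
      rw [← pow_add]; ring_nf
    -- quadratic step
    have quadstep : ∀ (I' : Finset (Fin n)) (g' : V → ZMod 2), Quad g' → 2 ^ (10 * Z * f) ≤ I'.card →
        (∀ i ∈ I', ∃ T : TD r k D (Q i), ∃ g1 ∈ T.G, g1 ≠ 0 ∧ Low K (g1 + g')) → ov Q ≤ (1/2:ℝ) ^ e := by
      intro I' g' hq hc h
      obtain _ | k := k
      · exfalso
        have : 0 < I'.card := lt_of_lt_of_le (by positivity) hc
        obtain ⟨i, hi⟩ := Finset.card_pos.1 this
        obtain ⟨T, g1, hg1, h0, -⟩ := h i hi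
        have h1 : T.G = ⊥ := Submodule.finrank_eq_zero.1 (Nat.le_zero.1 T.hG)
        rw [h1] at hg1
        exact h0 hg1
      · refine ov_quad_step Q I' g' hq h (fun Q' hQ' => ?_)
        refine ih k (D + (K + 1)) (e + 1) (by omega) (by omega) ?_ V n Q' I' hc hQ'
        refine lt_of_le_of_lt ?_ hlt
        rw [pow_succ, mul_assoc]
        apply Nat.mul_le_mul_left
        omega
    set Bad := I.attach.filter (fun i => ¬ (T0 i.1 i.2).Good K) with hBad
    set Gd := I.attach.filter (fun i => (T0 i.1 i.2).Good K) with hGd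
    have hsum : Gd.card + Bad.card = I.card := by
      have := Finset.card_filter_add_card_filter_not (s := I.attach) (fun i => (T0 i.1 i.2).Good K)
      rw [Finset.card_attach] at this
      exact this
    have hmap : ∀ S : Finset {x // x ∈ I}, (S.image Subtype.val).card = S.card :=
      fun S => Finset.card_image_of_injective _ Subtype.val_injective
    by_cases hb : 2 ^ (10 * Z * f) ≤ Bad.card
    · refine quadstep (Bad.image Subtype.val) 0 ?_ (by rw [hmap]; exact hb) ?_
      · intro a b c x; simp [dd]
      · intro i hi
        obtain ⟨j, hj, rfl⟩ := Finset.mem_image.1 hi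
        have := (Finset.mem_filter.1 hj).2
        unfold TD.Good at this
        push Not at this
        obtain ⟨g, hg, h0, hl⟩ := this
        exact ⟨_, g, hg, h0, by simpa using hl⟩
    have hGc : 2 ^ (3 * e + 5) * (2 ^ (10 * Z * f) * 2 ^ (Z + 1)) ≤ Gd.card := by
      have h1 : 2 ^ (3 * e + 5) * (2 ^ (10 * Z * f) * 2 ^ (Z + 1)) =
        2 ^ (10 * Z * f) * 2 ^ (3 * e + 5 + (Z + 1)) := by rw [pow_add]; ring
      have h2 : 2 ^ (10 * Z) = 2 * 2 ^ (10 * Z - 1) := by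
        rw [← pow_succ']; congr 1; omega
      have h3 : 2 ^ (3 * e + 5 + (Z + 1)) ≤ 2 ^ (10 * Z - 1) := Nat.pow_le_pow_right (by norm_num) (by omega)
      have h4 : 1 ≤ 2 ^ (10 * Z - 1) := Nat.one_le_pow _ _ (by norm_num)
      rw [h1]
      have h5 : 2 ^ (10 * Z * f) * 2 ^ (3 * e + 5 + (Z + 1)) ≤ 2 ^ (10 * Z * f) * 2 ^ (10 * Z - 1) :=
        Nat.mul_le_mul_left _ h3
      have h6 : 2 ^ (10 * Z * f) ≤ 2 ^ (10 * Z * f) * 2 ^ (10 * Z - 1) := Nat.le_mul_of_pos_right _ h4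
      rw [hpow, h2] at hI
      have h7 : 2 ^ (10 * Z * f) * (2 * 2 ^ (10 * Z - 1)) = 2 * (2 ^ (10 * Z * f) * 2 ^ (10 * Z - 1)) := by ring
      rw [h7] at hI
      omega
    rcases greedy (fun i j : {x // x ∈ I} => ¬ (T0 i.1 i.2).Unrel (T0 j.1 j.2) K)
      (fun i j h h' => h (TD.Unrel_symm h')) (2 ^ (10 * Z * f) * 2 ^ (Z + 1)) (by
        exact Nat.one_le_iff_ne_zero.2 (by positivity)) _ Gd hGc with ⟨J, hJ, hJc, hJR⟩ | ⟨i1, hi1, J, hJ, hJc, hJR⟩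
    · have hmem : ∀ i ∈ J.image Subtype.val, ∃ h : i ∈ I, ⟨i, h⟩ ∈ J := by
        intro i hi
        obtain ⟨j, hj, rfl⟩ := Finset.mem_image.1 hi
        exact ⟨j.2, hj⟩
      refine ov_success_step he Q (J.image Subtype.val) (fun i hi => T0 i (hmem i hi).1)
        (by rw [hmap, hJc]) K hK ?_ ?_
      · intro i hi
        exact (Finset.mem_filter.1 (hJ (hmem i hi).2)).2
      · intro i hi j hj hij
        exact not_not.1 (hJR _ (hmem i hi).2 _ (hmem j hj).2 (fun h => hij (congrArg Subtype.val h)))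
    · set T1 := T0 i1.1 i1.2 with hT1
      obtain ⟨JL, JQ, hsp, hJL, hJQ⟩ : ∃ JL JQ : Finset {x // x ∈ I}, JL.card + JQ.card = J.card ∧
          (∀ j ∈ JL, T1.U ⊔ (T0 j.1 j.2).U ≠ ⊤) ∧ (∀ j ∈ JQ, j ∈ J ∧ T1.U ⊔ (T0 j.1 j.2).U = ⊤) :=
        ⟨J.filter (fun j => ¬ T1.U ⊔ (T0 j.1 j.2).U = ⊤), J.filter (fun j => T1.U ⊔ (T0 j.1 j.2).U = ⊤), by
          rw [add_comm]; exact Finset.card_filter_add_card_filter_not (s := J) (fun j => T1.U ⊔ (T0 j.1 j.2).U = ⊤),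
          fun j hj => (Finset.mem_filter.1 hj).2, fun j hj => Finset.mem_filter.1 hj⟩
      have hz : 2 ^ (10 * Z * f) * 2 ^ (Z + 1) = 2 * (2 ^ Z * 2 ^ (10 * Z * f)) := by rw [pow_succ]; ring
      by_cases hlin : 2 ^ Z * 2 ^ (10 * Z * f) ≤ JL.card
      · -- linear
        have hfin : Finite (Dual (ZMod 2) V) :=
          Finite.of_injective (fun φ : Dual (ZMod 2) V => (φ : V → ZMod 2)) DFunLike.coe_injective
        have hann : finrank (ZMod 2) T1.U.dualAnnihilator ≤ Z := by
          have h1 := Subspace.finrank_add_finrank_dualAnnihilator_eq T1.U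
          have := T1.hU
          omega
        obtain ⟨φ, hφ, J', hJ', hJ'c, hJ'P⟩ := pigeon T1.U.dualAnnihilator Z (2 ^ (10 * Z * f)) hann
          JL (fun j φ => φ ≠ 0 ∧ ∀ u ∈ (T0 j.1 j.2).U, φ u = 0) (by
            intro j hj
            exact exists_functional2 _ _ (hJL j hj)) hlin
        have : 0 < J'.card := lt_of_lt_of_le (by positivity) hJ'c
        obtain ⟨j0, hj0⟩ := Finset.card_pos.1 this
        have hφ0 := (hJ'P j0 hj0).1
        obtain ⟨v, hv⟩ : ∃ v, φ v = 1 := by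
          by_contra hcon
          push Not at hcon
          apply hφ0
          ext v
          exact (zmod2_cases _).resolve_right (hcon v)
        have hft : Fintype (LinearMap.ker φ) := Fintype.ofFinite _
        obtain _ | D := D
        · exfalso
          have hU1 : T1.U = ⊤ := Submodule.eq_top_of_finrank_eq
            (le_antisymm (Submodule.finrank_le _) (by have := T1.hU; omega))
          rw [Submodule.mem_dualAnnihilator, hU1] at hφ
          have := hφ v trivial
          rw [hv] at this
          exact one_ne_zero this
        have := ov_lin Q φ v hv ((1/2:ℝ) ^ (e + 1)) (by
          intro a
          refine ih k D (e + 1) (by omega) (by omega) (by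
            rw [show D + (e + 1) = D + 1 + e by ring]; exact hlt) _ n _ (J'.image Subtype.val)
            (by rw [hmap]; exact hJ'c) ?_
          intro i hi
          obtain ⟨j, hj, rfl⟩ := Finset.mem_image.1 hi
          exact (T0 j.1 j.2).lin φ v hv (hJ'P j hj).2 a)
        rw [pow_succ] at this
        linarith
      · have hq : 2 ^ Z * 2 ^ (10 * Z * f) ≤ JQ.card := by
          omega
        obtain ⟨g', hg', J', hJ', hJ'c, hJ'P⟩ := pigeon T1.G Z (2 ^ (10 * Z * f)) (T1.hG.trans hkZ.le)
          JQ (fun j g' => ∃ g1 ∈ (T0 j.1 j.2).G, g1 ≠ 0 ∧ Low K (g1 + g')) (by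
            intro j hj
            obtain ⟨hj, hj2⟩ := hJQ j hj
            have := hJR j hj
            unfold TD.Unrel at this
            by_contra hcon
            apply this
            refine ⟨hj2, fun g hg h0 g2 hg2 h02 hl => hcon ⟨g, hg, g2, hg2, h02, ?_⟩⟩
            rw [add_comm]; exact hl) hq
        refine quadstep (J'.image Subtype.val) g' (T1.hGq _ hg') (by rw [hmap]; exact hJ'c) ?_
        intro i hi
        obtain ⟨j, hj, rfl⟩ := Finset.mem_image.1 hi
        exact ⟨_, hJ'P j hj⟩
end CL

namespace CL
section
variable {V : Type} [AddCommGroup V] [Module (ZMod 2) V] [Fintype V]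
open Module

structure Tri (T : V → V → V → ZMod 2) : Prop where
  add : ∀ x x' y z, T (x + x') y z = T x y z + T x' y z
  s12 : ∀ x y z, T x y z = T y x z
  s23 : ∀ x y z, T x y z = T x z y

lemma Tri.add2 {T : V → V → V → ZMod 2} (h : Tri T) (x y y' z : V) : T x (y + y') z = T x y z + T x y' z := by
  rw [h.s12, h.add, h.s12 y, h.s12 y']

lemma Tri.zero2 {T : V → V → V → ZMod 2} (h : Tri T) (x z : V) : T x 0 z = 0 := by
  have := h.add2 x 0 0 z
  simpa using this

lemma Tri.zero1 {T : V → V → V → ZMod 2} (h : Tri T) (x z : V) : T 0 x z = 0 := by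
  rw [h.s12, h.zero2]

def Tri.Orth {T : V → V → V → ZMod 2} (h : Tri T) (W : Submodule (ZMod 2) V) (x : V) : Submodule (ZMod 2) V :=
  mkSub {y | ∀ z ∈ W, T x y z = 0} (fun z _ => h.zero2 x z) (fun y y' hy hy' z hz => by
    rw [h.add2, hy z hz, hy' z hz, add_zero])

lemma Tri.mem_Orth {T : V → V → V → ZMod 2} (h : Tri T) (W : Submodule (ZMod 2) V) (x y : V) :
    y ∈ h.Orth W x ↔ ∀ z ∈ W, T x y z = 0 := Iff.rfl

lemma Tri.halving {T : V → V → V → ZMod 2} (h : Tri T) (V' : Submodule (ZMod 2) V) :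
    ∀ ρ : ℕ, ∀ W : Submodule (ZMod 2) V,
      (∀ x ∈ V', finrank (ZMod 2) W ≤ ρ + finrank (ZMod 2) (W ⊓ h.Orth W x : Submodule (ZMod 2) V)) →
      ∃ W' ≤ W, finrank (ZMod 2) W ≤ 2 * ρ + finrank (ZMod 2) W' ∧ ∀ x ∈ V', ∀ y ∈ W', ∀ z ∈ W', T x y z = 0 := by
  intro ρ
  induction ρ using Nat.strong_induction_on with
  | _ ρ ih =>
  intro W hW
  obtain rfl | hpos := Nat.eq_zero_or_pos ρ
  · refine ⟨W, le_rfl, by omega, fun x hx y hy z hz => ?_⟩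
    have h1 := hW x hx
    have h2 : W ⊓ h.Orth W x = W := Submodule.eq_of_le_of_finrank_le inf_le_left (by omega)
    rw [← h2] at hy
    exact hy.2 z hz
  by_cases hsm : ∀ x ∈ V', finrank (ZMod 2) W ≤ (ρ - 1) + finrank (ZMod 2) (W ⊓ h.Orth W x : Submodule (ZMod 2) V)
  · obtain ⟨W', h1, h2, h3⟩ := ih (ρ - 1) (by omega) W hsm
    exact ⟨W', h1, by omega, h3⟩
  push Not at hsm
  obtain ⟨x0, hx0, hlt⟩ := hsm
  set W1 := W ⊓ h.Orth W x0 with hW1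
  have hle : ∀ x ∈ V', finrank (ZMod 2) W1 ≤ ρ / 2 + finrank (ZMod 2) (W1 ⊓ h.Orth W1 x : Submodule (ZMod 2) V) := by
    intro x hx
    set X := W ⊓ h.Orth W1 x with hX
    set N := W1 ⊓ h.Orth W1 x with hN
    set R := W ⊓ h.Orth W x with hR
    set R' := W ⊓ h.Orth W (x + x0) with hR'
    have a1 : R ≤ X := fun y hy => ⟨hy.1, fun z hz => hy.2 z hz.1⟩
    have a2 : R' ≤ X := by
      intro y hy
      refine ⟨hy.1, fun z hz => ?_⟩
      have e1 := hy.2 z hz.1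
      have e2 := hz.2 y hy.1
      rw [h.add, h.s23 x0, e2, add_zero] at e1
      exact e1
    have a3 : R ⊓ R' ≤ N := by
      intro y hy
      have hyX := a1 hy.1
      refine ⟨⟨hyX.1, fun z hz => ?_⟩, hyX.2⟩
      have e1 := hy.2.2 z hz
      have e2 := hy.1.2 z hz
      rw [h.add, e2, zero_add] at e1
      exact e1
    have a4 : X ⊔ W1 ≤ W := sup_le inf_le_left inf_le_left
    have a5 : X ⊓ W1 ≤ N := fun y hy => ⟨hy.2, hy.1.2⟩
    have b1 := Submodule.finrank_sup_add_finrank_inf_eq R R'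
    have b2 := Submodule.finrank_sup_add_finrank_inf_eq X W1
    have c1 := Submodule.finrank_mono (sup_le a1 a2)
    have c2 := Submodule.finrank_mono a3
    have c3 := Submodule.finrank_mono a4
    have c4 := Submodule.finrank_mono a5
    have d1 : finrank (ZMod 2) W ≤ ρ + finrank (ZMod 2) R := hW x hx
    have d2 : finrank (ZMod 2) W ≤ ρ + finrank (ZMod 2) R' := hW (x + x0) (V'.add_mem hx hx0)
    have d3 : finrank (ZMod 2) W ≤ ρ + finrank (ZMod 2) W1 := hW x0 hx0
    omega
  obtain ⟨W', h1, h2, h3⟩ := ih (ρ / 2) (by omega) W1 hle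
  have : finrank (ZMod 2) W ≤ ρ + finrank (ZMod 2) W1 := hW x0 hx0
  exact ⟨W', h1.trans inf_le_left, by omega, h3⟩

/-- growth -/
lemma grow (A : Finset V) : ∀ i : ℕ, ∃ U : Submodule (ZMod 2) V, finrank (ZMod 2) U ≤ i ∧ ∃ B : Finset V,
    (∀ x ∈ B, ∃ a ∈ A, x + a ∈ U) ∧
    (Fintype.card V < 2 * B.card ∨ 3 ^ i * A.card ≤ 2 ^ i * B.card) := by
  classical
  intro i
  induction i with
  | zero => exact ⟨⊥, by simp, A, fun x hx => ⟨x, hx, by simp [vself]⟩, Or.inr (by simp)⟩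
  | succ i ih =>
    obtain ⟨U, hU, B, hB, h⟩ := ih
    by_cases hbig : Fintype.card V < 2 * B.card
    · exact ⟨U, by omega, B, hB, Or.inl hbig⟩
    have h := h.resolve_left hbig
    obtain ⟨a, ha⟩ : ∃ a : V, 2 * (B.filter (fun x => x + a ∈ B)).card ≤ B.card := by
      by_contra hcon
      push Not at hcon
      have h1 : ∑ a : V, (B.filter (fun x => x + a ∈ B)).card = B.card * B.card := by
        simp_rw [Finset.card_filter]
        rw [Finset.sum_comm]
        rw [← smul_eq_mul, ← Finset.sum_const]
        apply Finset.sum_congr rfl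
        intro x hx
        rw [← Finset.card_filter]
        apply Finset.card_bij (fun a _ => x + a)
        · intro a ha; exact (Finset.mem_filter.1 ha).2
        · intro a _ b _ hab; exact add_left_cancel hab
        · intro b hb
          refine ⟨x + b, ?_, ?_⟩
          · simp [← add_assoc, vself, hb]
          · simp [← add_assoc, vself]
      have h2 : ∑ a : V, B.card < ∑ a : V, 2 * (B.filter (fun x => x + a ∈ B)).card :=
        Finset.sum_lt_sum_of_nonempty ⟨0, Finset.mem_univ _⟩ fun a _ => hcon a
      rw [← Finset.mul_sum, h1, Finset.sum_const, smul_eq_mul, Finset.card_univ] at h2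
      have : 2 * B.card * B.card ≤ Fintype.card V * B.card := Nat.mul_le_mul_right _ (not_lt.1 hbig)
      nlinarith
    set B2 := B.image (fun x => x + a) with hB2
    have hB2c : B2.card = B.card := Finset.card_image_of_injective _ (add_left_injective a)
    refine ⟨U ⊔ Submodule.span (ZMod 2) {a}, ?_, B ∪ B2, ?_, Or.inr ?_⟩
    · have h1 := Submodule.finrank_add_le_finrank_add_finrank U (Submodule.span (ZMod 2) {a})
      have h2 : finrank (ZMod 2) (Submodule.span (ZMod 2) ({a} : Set V)) ≤ 1 := by
        simpa using finrank_span_le_card (R := ZMod 2) ({a} : Set V)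
      omega
    · intro x hx
      rcases Finset.mem_union.1 hx with hx | hx
      · obtain ⟨b, hb, hb2⟩ := hB x hx
        exact ⟨b, hb, Submodule.mem_sup_left hb2⟩
      · obtain ⟨y, hy, rfl⟩ := Finset.mem_image.1 hx
        obtain ⟨b, hb, hb2⟩ := hB y hy
        refine ⟨b, hb, ?_⟩
        rw [add_right_comm]
        exact Submodule.add_mem_sup hb2 (Submodule.mem_span_singleton_self a)
    · have h1 := Finset.card_union_add_card_inter B B2
      have h2 : (B ∩ B2).card ≤ (B.filter (fun x => x + a ∈ B)).card := by
        apply Finset.card_le_card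
        intro x hx
        obtain ⟨h1, h2⟩ := Finset.mem_inter.1 hx
        obtain ⟨y, hy, rfl⟩ := Finset.mem_image.1 h2
        refine Finset.mem_filter.2 ⟨h1, ?_⟩
        rw [vcancel]; exact hy
      have h3 : 3 * B.card ≤ 2 * (B ∪ B2).card := by omega
      calc 3 ^ (i + 1) * A.card = 3 * (3 ^ i * A.card) := by ring
        _ ≤ 3 * (2 ^ i * B.card) := Nat.mul_le_mul_left _ h
        _ = 2 ^ i * (3 * B.card) := by ring
        _ ≤ 2 ^ i * (2 * (B ∪ B2).card) := Nat.mul_le_mul_left _ h3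
        _ = _ := by ring

lemma cover (A : Finset V) (q : ℕ) (hA : Fintype.card V ≤ 2 ^ q * A.card) :
    ∃ U : Submodule (ZMod 2) V, finrank (ZMod 2) U ≤ 2 * q ∧ ∀ x, ∃ a ∈ A, ∃ a' ∈ A, x + a + a' ∈ U := by
  classical
  obtain ⟨U, hU, B, hB, h⟩ := grow A (2 * q)
  refine ⟨U, hU, fun x => ?_⟩
  have hbig : Fintype.card V < 2 * B.card := by
    rcases h with h | h
    · exact h
    · rw [pow_mul, pow_mul] at h
      norm_num at h
      have hV : 0 < Fintype.card V := Fintype.card_pos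
      have h1 : 8 ^ q * A.card ≤ 9 ^ q * A.card := Nat.mul_le_mul_right _ (Nat.pow_le_pow_left (by norm_num) _)
      have h2 : 4 ^ q * Fintype.card V ≤ 4 ^ q * B.card := by
        calc 4 ^ q * Fintype.card V ≤ 4 ^ q * (2 ^ q * A.card) := Nat.mul_le_mul_left _ hA
          _ = 8 ^ q * A.card := by rw [← mul_assoc, ← mul_pow]; norm_num
          _ ≤ _ := h1.trans h
      have := Nat.le_of_mul_le_mul_left h2 (by positivity)
      omega
  obtain ⟨b, hb1, hb2⟩ : ∃ b ∈ B, x + b ∈ B := by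
    by_contra hcon
    push Not at hcon
    have hd : Disjoint B (B.image (fun b => x + b)) := by
      rw [Finset.disjoint_left]
      intro b hb hb'
      obtain ⟨c, hc, rfl⟩ := Finset.mem_image.1 hb'
      exact hcon c hc hb
    have h1 := Finset.card_union_of_disjoint hd
    rw [Finset.card_image_of_injective _ (add_right_injective x)] at h1
    have h2 := Finset.card_le_univ (B ∪ B.image (fun b => x + b))
    omega
  obtain ⟨a, ha, ha2⟩ := hB b hb1
  obtain ⟨a', ha', ha2'⟩ := hB _ hb2
  refine ⟨a', ha', a, ha, ?_⟩
  have := U.add_mem ha2' ha2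
  have e : x + b + a' + (b + a) = x + a' + a + (b + b) := by abel
  rw [e, vself, add_zero] at this
  exact this

/-- codimension of radical at most m -/
def Tri.C {T : V → V → V → ZMod 2} (h : Tri T) (m : ℕ) (x : V) : Prop :=
  finrank (ZMod 2) V ≤ m + finrank (ZMod 2) (h.Orth ⊤ x)

lemma Tri.C_add {T : V → V → V → ZMod 2} (h : Tri T) {m m' : ℕ} {x y : V} (hx : h.C m x) (hy : h.C m' y) :
    h.C (m + m') (x + y) := by
  unfold Tri.C at *
  have h1 := TD.finrank_inf _ _ hx hy
  have h2 : h.Orth ⊤ x ⊓ h.Orth ⊤ y ≤ h.Orth ⊤ (x + y) := by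
    intro w hw z hz
    rw [h.add, hw.1 z hz, hw.2 z hz, add_zero]
  have := Submodule.finrank_mono h2
  omega

lemma Tri.C_zero {T : V → V → V → ZMod 2} (h : Tri T) (m : ℕ) : h.C m 0 := by
  unfold Tri.C
  have : h.Orth ⊤ 0 = ⊤ := by
    rw [eq_top_iff]; intro w _ z _; exact h.zero1 w z
  rw [this, finrank_top]; omega

lemma Tri.C_mono {T : V → V → V → ZMod 2} (h : Tri T) {m m' : ℕ} {x : V} (hx : h.C m x) (hm : m ≤ m') : h.C m' x := by
  unfold Tri.C at *; omega

lemma Tri.C_span {T : V → V → V → ZMod 2} (h : Tri T) {m t : ℕ} (S : Set V) (hS : ∀ x ∈ S, h.C m x)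
    (ht : finrank (ZMod 2) (Submodule.span (ZMod 2) S) ≤ t) (x : V) (hx : x ∈ Submodule.span (ZMod 2) S) :
    h.C (m * t) x := by
  classical
  obtain ⟨b, hbS, hspan, hli⟩ := exists_linearIndependent (ZMod 2) S
  set s : Finset V := b.toFinset with hs
  have hcard : s.card ≤ t := by
    have e : finrank (ZMod 2) (Submodule.span (ZMod 2) b) = s.card := by
      convert finrank_span_set_eq_card hli
    rw [hspan] at e
    omega
  rw [← hspan, ← Set.coe_toFinset b] at hx
  obtain ⟨f, -, rfl⟩ := Submodule.mem_span_finset.1 hx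
  have key : ∀ s' : Finset V, (∀ a ∈ s', a ∈ S) → h.C (m * s'.card) (∑ a ∈ s', f a • a) := by
    intro s'
    induction s' using Finset.induction_on with
    | empty => intro _; simpa using h.C_zero 0
    | insert a s' ha ih =>
      intro hin
      rw [Finset.sum_insert ha, Finset.card_insert_of_notMem ha]
      have h1 : h.C m (f a • a) := by
        rcases zmod2_cases (f a) with e | e
        · rw [e, zero_smul]; exact h.C_zero m
        · rw [e, one_smul]; exact hS a (hin a (Finset.mem_insert_self _ _))
      have h2 := ih (fun c hc => hin c (Finset.mem_insert_of_mem hc))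
      exact h.C_mono (h.C_add h1 h2) (by ring_nf; omega)
  exact h.C_mono (key s (fun a ha => hbS (by simpa [hs] using ha))) (Nat.mul_le_mul_left _ hcard)

lemma Tri.structure {T : V → V → V → ZMod 2} (h : Tri T) (R q : ℕ) (A : Finset V) (hA : ∀ a ∈ A, h.C R a)
    (hAc : Fintype.card V ≤ 2 ^ q * A.card) :
    ∃ W : Submodule (ZMod 2) V, finrank (ZMod 2) V ≤ 2 * (2 * R + 6 * R * (2 * q)) + 2 * q + finrank (ZMod 2) W ∧
      ∀ x ∈ W, ∀ y ∈ W, ∀ z ∈ W, T x y z = 0 := by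
  obtain ⟨U, hU, hcov⟩ := cover A q hAc
  set S : Set V := {w | w ∈ U ∧ h.C (6 * R) w} with hS
  set U0 := Submodule.span (ZMod 2) S with hU0
  have hU0le : U0 ≤ U := Submodule.span_le.2 fun w hw => hw.1
  have hU0C : ∀ w ∈ U0, h.C (6 * R * (2 * q)) w := by
    intro w hw
    exact h.C_span S (fun x hx => hx.2) ((Submodule.finrank_mono hU0le).trans hU) w hw
  have hcov2 : ∀ x, ∃ u ∈ U, h.C (2 * R) (x + u) := by
    intro x
    obtain ⟨a, ha, a', ha', hu⟩ := hcov x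
    refine ⟨_, hu, ?_⟩
    rw [show x + (x + a + a') = (x + x) + (a + a') by abel, vself, zero_add]
    exact h.C_mono (h.C_add (hA a ha) (hA a' ha')) (by omega)
  let V' : Submodule (ZMod 2) V := mkSub {x | ∃ w ∈ U0, h.C (2 * R) (x + w)}
    ⟨0, U0.zero_mem, by rw [add_zero]; exact h.C_zero _⟩ (by
      rintro x y ⟨w, hw, hxw⟩ ⟨w', hw', hyw⟩
      obtain ⟨u, hu, hc⟩ := hcov2 (x + w + (y + w'))
      have h1 := h.C_add (h.C_add hxw hyw) hc
      rw [← add_assoc, vself, zero_add] at h1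
      have hu0 : u ∈ U0 := Submodule.subset_span ⟨hu, h.C_mono h1 (by omega)⟩
      refine ⟨w + w' + u, U0.add_mem (U0.add_mem hw hw') hu0, ?_⟩
      rw [show x + y + (w + w' + u) = x + w + (y + w') + u by abel]
      exact hc)
  have hV'C : ∀ x ∈ V', h.C (2 * R + 6 * R * (2 * q)) x := by
    rintro x ⟨w, hw, hxw⟩
    have := h.C_add hxw (hU0C w hw)
    rwa [vcancel] at this
  have hV'U : V' ⊔ U = ⊤ := by
    rw [eq_top_iff]
    intro x _
    obtain ⟨u, hu, hc⟩ := hcov2 x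
    have hx : x + u ∈ V' := ⟨0, U0.zero_mem, by rw [add_zero]; exact hc⟩
    have := Submodule.add_mem_sup hx hu
    rwa [vcancel] at this
  have hV'c : finrank (ZMod 2) V ≤ 2 * q + finrank (ZMod 2) V' := by
    have h1 := Submodule.finrank_add_le_finrank_add_finrank V' U
    rw [hV'U, finrank_top] at h1
    omega
  obtain ⟨W', -, hW', hT⟩ := h.halving V' (2 * R + 6 * R * (2 * q)) ⊤ (by
    intro x hx
    rw [top_inf_eq, finrank_top]
    exact hV'C x hx)
  rw [finrank_top] at hW'
  refine ⟨W' ⊓ V', TD.finrank_inf _ _ hW' hV'c, fun x hx y hy z hz => hT x hx.2 y hy.1 z hz.1⟩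
end
end CL

namespace CL
section
variable {V : Type} [AddCommGroup V] [Module (ZMod 2) V] [Fintype V]
open Module

def Cubic (P : V → ZMod 2) : Prop := ∀ a b c d x, dd a (dd b (dd c (dd d P))) x = 0

lemma dd_comm (a b : V) (f : V → ZMod 2) : dd a (dd b f) = dd b (dd a f) := by
  funext x
  simp only [dd]
  rw [add_right_comm x a b]
  ring

def TT (P : V → ZMod 2) (x y z : V) : ZMod 2 := dd x (dd y (dd z P)) 0

lemma TT_base {P : V → ZMod 2} (h : Cubic P) (x y z w : V) : dd x (dd y (dd z P)) w = TT P x y z := by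
  have := h w x y z 0
  unfold dd at this
  rw [zero_add] at this
  exact zmod2_eq_of_add this

lemma TT_tri {P : V → ZMod 2} (h : Cubic P) : Tri (TT P) where
  s12 := fun x y z => by unfold TT; rw [dd_comm]
  s23 := fun x y z => by unfold TT; rw [dd_comm y z]
  add := fun x x' y z => by
    have h1 := TT_base h x y z x'
    unfold TT at *
    set f := dd y (dd z P)
    simp only [dd, zero_add] at *
    rw [add_comm x' x] at h1
    linear_combination h1 - zmod2_add_self (f x')

lemma Orth_eq_Rad {P : V → ZMod 2} (h : Cubic P) (x : V) : (TT_tri h).Orth ⊤ x = Rad (dd x P) := by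
  ext y
  rw [Tri.mem_Orth, mem_Rad]
  constructor
  · intro hy z w
    rw [TT_base h, (TT_tri h).s12, (TT_tri h).s23, (TT_tri h).s12, hy z trivial]
  · intro hy z _
    rw [(TT_tri h).s12, (TT_tri h).s23, (TT_tri h).s12]
    exact hy z 0

lemma bias_density {P : V → ZMod 2} (h : Cubic P) (p : ℕ) (hb : (1/2:ℝ) ^ p ≤ |Ex (fun x => chi (P x))|) :
    ∃ A : Finset V, (∀ a ∈ A, (TT_tri h).C (4 * p + 2) a) ∧ Fintype.card V ≤ 2 ^ (2 * p + 1) * A.card := by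
  classical
  have hsq : (Ex (fun x => chi (P x))) ^ 2 = Ex (fun h => Ex (fun x => chi (dd h P x))) := by
    rw [Ex_comm]
    have : (fun y : V => Ex fun x => chi (dd x P y)) = fun y => Ex (fun x => chi (P x)) * chi (P y) := by
      funext y
      simp only [dd, chi_add]
      rw [Ex_mul_right]
      congr 1
      have := Ex_shift (fun x => chi (P x)) y
      rw [← this]
      simp_rw [add_comm y]
    rw [this, Ex_mul_left, sq]
  set A : Finset V := Finset.univ.filter (fun a => (TT_tri h).C (4 * p + 2) a) with hA
  refine ⟨A, fun a ha => (Finset.mem_filter.1 ha).2, ?_⟩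
  have h1 : ∀ a, Ex (fun x => chi (dd a P x)) ≤ (if a ∈ A then (1:ℝ) else 0) + (1/2:ℝ) ^ (2 * p + 1) := by
    intro a
    split_ifs with ha
    · have : |Ex (fun x => chi (dd a P x))| ≤ 1 := Ex_abs_le fun x => (chi_abs _).le
      have h2 := le_abs_self (Ex (fun x => chi (dd a P x)))
      have h3 : (0:ℝ) ≤ (1/2:ℝ) ^ (2 * p + 1) := by positivity
      linarith
    · have hq : Quad (dd a P) := fun b c d x => h b c d a x
      have h2 := bias_le hq
      rw [zero_add]
      refine (le_abs_self _).trans (abs_le_of_sq_le_sq (h2.trans ?_) (by positivity))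
      have h3 : ¬ (TT_tri h).C (4 * p + 2) a := fun hc => ha (Finset.mem_filter.2 ⟨Finset.mem_univ _, hc⟩)
      unfold Tri.C at h3
      rw [Orth_eq_Rad h] at h3
      rw [div_le_iff₀ (by positivity), ← pow_mul, one_div, inv_pow, ← div_eq_inv_mul, le_div_iff₀ (by positivity),
        ← pow_add]
      apply pow_le_pow_right₀ (by norm_num)
      omega
  have h2 := Ex_mono h1
  rw [← hsq, Ex_add, Ex_const] at h2
  have h3 : ((1/2:ℝ) ^ p) ^ 2 ≤ (Ex (fun x => chi (P x))) ^ 2 := by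
    rw [← sq_abs (Ex _)]
    exact pow_le_pow_left₀ (by positivity) hb 2
  have h4 : Ex (fun a => if a ∈ A then (1:ℝ) else 0) = A.card / Fintype.card V := by
    unfold Ex
    congr 1
    simp
  rw [h4] at h2
  have h5 : ((1/2:ℝ) ^ p) ^ 2 = 2 * (1/2:ℝ) ^ (2 * p + 1) := by
    rw [← pow_mul, pow_succ, mul_comm p 2]; ring
  have h6 : (1/2:ℝ) ^ (2 * p + 1) ≤ A.card / Fintype.card V := by linarith
  have hV : (0:ℝ) < Fintype.card V := by exact_mod_cast Fintype.card_pos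
  rw [le_div_iff₀ hV, one_div, inv_pow, ← div_eq_inv_mul, div_le_iff₀ (by positivity)] at h6
  have : (Fintype.card V : ℝ) ≤ 2 ^ (2 * p + 1) * A.card := by linarith
  exact_mod_cast this

/-- codim bound -/
def rr (p : ℕ) : ℕ := 2 * (2 * (4 * p + 2) + 6 * (4 * p + 2) * (2 * (2 * p + 1))) + 2 * (2 * p + 1)

lemma bias_struct {P : V → ZMod 2} (h : Cubic P) (p : ℕ) (hb : (1/2:ℝ) ^ p ≤ |Ex (fun x => chi (P x))|) :
    ∃ W : Submodule (ZMod 2) V, finrank (ZMod 2) V ≤ rr p + finrank (ZMod 2) W ∧ QuadOn W P := by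
  obtain ⟨A, hA, hc⟩ := bias_density h p hb
  obtain ⟨W, hW, hT⟩ := (TT_tri h).structure _ _ A hA hc
  refine ⟨W, hW, fun a ha b hb c hc x => ?_⟩
  rw [TT_base h]
  exact hT a ha b hb c hc

lemma exists_proj (W C : Submodule (ZMod 2) V) (h : IsCompl C W) :
    ∃ (π : V →ₗ[ZMod 2] V) (κ : V →ₗ[ZMod 2] C), (∀ x, π x + κ x = x) ∧ (∀ x, π x ∈ W) ∧ (∀ w ∈ W, π w = w) ∧
      (∀ w ∈ W, κ w = 0) := by
  let e := Submodule.prodEquivOfIsCompl C W h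
  refine ⟨W.subtype ∘ₗ LinearMap.snd _ _ _ ∘ₗ e.symm.toLinearMap, LinearMap.fst _ _ _ ∘ₗ e.symm.toLinearMap, ?_, ?_, ?_, ?_⟩
  · intro x
    have := e.apply_symm_apply x
    conv_rhs => rw [← this]
    simp only [e, Submodule.coe_prodEquivOfIsCompl', LinearMap.comp_apply]
    rw [add_comm]; rfl
  · intro x; exact (e.symm x).2.2
  · intro w hw
    have : e.symm w = (0, ⟨w, hw⟩) := by
      rw [LinearEquiv.symm_apply_eq]; simp [e]
    simp [this]
  · intro w hw
    have : e.symm w = (0, ⟨w, hw⟩) := by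
      rw [LinearEquiv.symm_apply_eq]; simp [e]
    simp [this]

def ddL (a : V) : (V → ZMod 2) →ₗ[ZMod 2] (V → ZMod 2) where
  toFun := dd a
  map_add' := fun f g => by funext x; simp only [dd, Pi.add_apply]; ring
  map_smul' := fun c f => by funext x; simp only [dd, Pi.smul_apply, smul_eq_mul, RingHom.id_apply]; ring

lemma ddL_apply (a : V) (f : V → ZMod 2) : ddL a f = dd a f := rfl

lemma init_TD {P : V → ZMod 2} (h : Cubic P) (W : Submodule (ZMod 2) V) (r : ℕ)
    (hW : finrank (ZMod 2) V ≤ r + finrank (ZMod 2) W) (hQ : QuadOn W P) :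
    Nonempty (TD r (r + 1) (r + 2 ^ r) P) := by
  classical
  obtain ⟨C, hC⟩ := Submodule.exists_isCompl W
  have hdim := Submodule.finrank_add_eq_of_isCompl hC
  obtain ⟨π, κ, hx, hπW, hπ, hκ⟩ := exists_proj W C hC.symm
  have hCr : finrank (ZMod 2) C ≤ r := by omega
  let bs := Module.finBasis (ZMod 2) C
  let L : C →ₗ[ZMod 2] (V → ZMod 2) := bs.constr (ZMod 2) (fun j x => dd (bs j : V) P (π x))
  have hL : ∀ j, L (bs j) = fun x => dd (bs j : V) P (π x) := fun j => Module.Basis.constr_basis _ _ _ _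
  set g0 : V → ZMod 2 := fun x => P (π x) with hg0
  have hg0q : Quad g0 := by
    intro a b c x
    have := hQ _ (hπW a) _ (hπW b) _ (hπW c) (π x)
    simp only [dd, hg0, map_add] at this ⊢
    exact this
  have hLq : ∀ c, Quad (L c) := by
    intro c a1 a2 a3 x
    have e : (LinearMap.proj (R := ZMod 2) (φ := fun _ : V => ZMod 2) x) ∘ₗ ddL a1 ∘ₗ ddL a2 ∘ₗ ddL a3 ∘ₗ L = 0 := by
      apply bs.ext
      intro j
      simp only [LinearMap.comp_apply, hL, ddL_apply, LinearMap.proj_apply, LinearMap.zero_apply]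
      have := h (π a1) (π a2) (π a3) (bs j) (π x)
      simp only [dd, map_add] at this ⊢
      exact this
    exact LinearMap.congr_fun e c
  have hLT : ∀ (c : C) (a b x : V), a ∈ W → b ∈ W → dd a (dd b (L c)) x = TT P c a b := by
    intro c a b x ha hb
    have e : (LinearMap.proj (R := ZMod 2) (φ := fun _ : V => ZMod 2) x) ∘ₗ ddL a ∘ₗ ddL b ∘ₗ L =
        mkLin (fun c : C => TT P c a b) (fun c c' => (TT_tri h).add c c' a b) := by
      apply bs.ext
      intro j
      simp only [LinearMap.comp_apply, hL, ddL_apply, LinearMap.proj_apply, mkLin_apply]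
      rw [(TT_tri h).s12, (TT_tri h).s23, ← TT_base h _ _ _ (π x)]
      simp only [dd, map_add, hπ a ha, hπ b hb]
    exact LinearMap.congr_fun e c
  set rho : V → V → ZMod 2 := fun x => g0 + L (κ x) with hrho
  have hrhoW : ∀ x, ∀ w ∈ W, rho (x + w) = rho x := by
    intro x w hw
    simp only [hrho, map_add, hκ w hw, add_zero]
  set F : V → ZMod 2 := fun x => P x + rho x x with hF
  have haff : ∀ x, ∀ a ∈ W, ∀ b ∈ W, F (x + a + b) + F (x + a) + F (x + b) + F x = 0 := by
    intro x a ha b hb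
    simp only [hF, hrhoW _ a ha, hrhoW _ b hb]
    have h1 := hLT (κ x) a b x ha hb
    have h2 := TT_base h (κ x) a b (π x)
    rw [← h1] at h2
    simp only [dd] at h2
    simp only [hx] at h2
    have e1 : π x + a + κ x = x + a := by rw [add_right_comm, hx]
    have e2 : π x + b + κ x = x + b := by rw [add_right_comm, hx]
    have e3 : π x + a + b + κ x = x + a + b := by rw [add_right_comm, e1]
    simp only [hrho, Pi.add_apply, hg0, map_add, hπ a ha, hπ b hb]
    have e4 : π x + κ x + a = x + a := by rw [hx]
    linear_combination h2 + zmod2_add_self (L (κ x) (x + a + b) + L (κ x) (x + a) + L (κ x) (x + b) + L (κ x) x)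
  let Λ : W →ₗ[ZMod 2] (C → ZMod 2) := mkLin (fun w c => F (c + w) + F c) (fun w w' => by
    funext c
    have := haff c w w.2 w' w'.2
    simp only [Pi.add_apply]
    push_cast
    rw [← add_assoc (c : V) w w']
    linear_combination this - zmod2_add_self (F (c + w)) - zmod2_add_self (F (c + w')) - zmod2_add_self (F c))
  have hker := finrank_ker_add Λ
  have hcard : finrank (ZMod 2) (C → ZMod 2) ≤ 2 ^ r := by
    rw [Module.finrank_pi, card_eq_nat]
    exact Nat.pow_le_pow_right (by norm_num) hCr
  refine ⟨{
    W := W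
    U := (LinearMap.ker Λ).map W.subtype
    G := Submodule.span (ZMod 2) {g0} ⊔ LinearMap.range L
    rho := rho
    hUW := Submodule.map_subtype_le _ _
    hW := hW
    hU := ?_
    hG := ?_
    hGq := ?_
    hrho := fun x => Submodule.add_mem_sup (Submodule.mem_span_singleton_self _) ⟨_, rfl⟩
    hrhoW := hrhoW
    hQU := ?_
    hQuad := hQ }⟩
  · rw [Submodule.finrank_map_subtype_eq]
    omega
  · have h1 := Submodule.finrank_add_le_finrank_add_finrank (Submodule.span (ZMod 2) {g0}) (LinearMap.range L)
    have h2 : finrank (ZMod 2) (Submodule.span (ZMod 2) ({g0} : Set (V → ZMod 2))) ≤ 1 := by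
      simpa using finrank_span_le_card (R := ZMod 2) ({g0} : Set (V → ZMod 2))
    have h3 := LinearMap.finrank_range_le L
    omega
  · intro g hg
    obtain ⟨s, hs, t, ⟨c, rfl⟩, rfl⟩ := Submodule.mem_sup.1 hg
    obtain ⟨a, rfl⟩ := Submodule.mem_span_singleton.1 hs
    refine TD.quad_add ?_ (hLq c)
    rcases zmod2_cases a with rfl | rfl
    · rw [zero_smul]; intro a b c x; simp [dd]
    · rw [one_smul]; exact hg0q
  · rintro x _ ⟨w, hw, rfl⟩
    have h1 : F (κ x + w) + F (κ x) = 0 := congrFun (show Λ w = 0 from hw) (κ x)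
    have h2 := haff (κ x) (π x) (hπW x) w w.2
    have e : (κ x : V) + π x = x := by rw [add_comm]; exact hx x
    rw [e] at h2
    have h3 : F (x + w) = F x := by
      apply zmod2_eq_of_add
      linear_combination h2 - h1
    simp only [hF, hrhoW x w w.2] at h3
    exact h3
end
end CL

namespace CL
section
variable {V : Type} [AddCommGroup V] [Module (ZMod 2) V] [Fintype V]

def DegD : ℕ → (V → ZMod 2) → Prop
  | 0, f => ∀ x, f x = 0
  | (n + 1), f => ∀ h, DegD n (dd h f)

lemma DegD.add : ∀ n {f g : V → ZMod 2}, DegD n f → DegD n g → DegD n (fun x => f x + g x)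
  | 0, f, g, hf, hg => fun x => by
    show f x + g x = 0
    rw [hf x, hg x, add_zero]
  | (n + 1), f, g, hf, hg => fun h => by
    have := DegD.add n (hf h) (hg h)
    convert this using 1
    funext x; simp only [dd]; ring

lemma DegD.cmul (a : ZMod 2) : ∀ n {f : V → ZMod 2}, DegD n f → DegD n (fun x => a * f x)
  | 0, f, hf => fun x => by
    show a * f x = 0
    rw [hf x, mul_zero]
  | (n + 1), f, hf => fun h => by
    have := DegD.cmul a n (hf h)
    convert this using 1
    funext x; simp only [dd]; ring

lemma DegD.succ : ∀ n {f : V → ZMod 2}, DegD n f → DegD (n + 1) f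
  | 0, f, hf => fun h x => by simp only [dd, hf (x + h), hf x, add_zero]
  | (n + 1), f, hf => fun h => DegD.succ n (hf h)

lemma DegD.mono {n m : ℕ} (hnm : n ≤ m) {f : V → ZMod 2} (hf : DegD n f) : DegD m f := by
  induction hnm with
  | refl => exact hf
  | step _ ih => exact DegD.succ _ ih

lemma DegD.lmul (l : V → ZMod 2) (hl : ∀ x y, l (x + y) = l x + l y) :
    ∀ n {f : V → ZMod 2}, DegD n f → DegD (n + 1) (fun x => l x * f x)
  | 0, f, hf => fun h x => by simp only [dd, hf (x + h), hf x, mul_zero, add_zero]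
  | (n + 1), f, hf => fun h => by
    have h1 := DegD.lmul l hl n (hf h)
    have h2 : DegD (n + 1) (fun x => f x + dd h f x) := DegD.add _ hf (DegD.succ _ (hf h))
    have h3 := DegD.add _ h1 (DegD.cmul (l h) _ h2)
    convert h3 using 1
    funext x; simp only [dd, hl]
    linear_combination (-1 : ZMod 2) * (zmod2_add_self (l h * f x))
end

section
variable {m : ℕ}

lemma DegD_const (a : ZMod 2) : DegD 1 (fun _ : Fin m → ZMod 2 => a) := by
  intro h x
  exact zmod2_add_self a

lemma DegD_monomial (s : Multiset (Fin m)) :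
    DegD (s.card + 1) (fun x : Fin m → ZMod 2 => (s.map x).prod) := by
  induction s using Multiset.induction_on with
  | empty => simpa using DegD_const 1
  | cons a s ih =>
    have := DegD.lmul (fun x : Fin m → ZMod 2 => x a) (fun x y => rfl) _ ih
    simpa using this

lemma DegD_of_DegLE {d : ℕ} {P : (Fin m → ZMod 2) → ZMod 2} (h : DegLE d P) : DegD (d + 1) P := by
  obtain ⟨p, hp, hP⟩ := h
  have e : P = fun x => ∑ s ∈ p.support, p.coeff s * ((Finsupp.toMultiset s).map x).prod := by
    funext x
    rw [← hP, MvPolynomial.eval_eq]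
    refine Finset.sum_congr rfl fun s _ => ?_
    congr 1
    rw [Finsupp.toMultiset_map, Finsupp.prod_toMultiset, Finsupp.prod_mapDomain_index]
    · rfl
    · simp
    · intros; rw [pow_add]
  rw [e]
  have key : ∀ S : Finset (Fin m →₀ ℕ), S ⊆ p.support →
      DegD (d + 1) (fun x => ∑ s ∈ S, p.coeff s * ((Finsupp.toMultiset s).map x).prod) := by
    classical
    intro S
    induction S using Finset.induction_on with
    | empty =>
      intro _
      simp only [Finset.sum_empty]
      exact DegD.mono (Nat.zero_le _) (n := 0) (fun x => rfl)
    | insert a S ha ih =>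
      intro hS
      simp only [Finset.sum_insert ha]
      refine DegD.add _ (DegD.cmul _ _ (DegD.mono ?_ (DegD_monomial _))) (ih fun x hx => hS (Finset.mem_insert_of_mem hx))
      have := MvPolynomial.le_totalDegree (hS (Finset.mem_insert_self a S))
      rw [Finsupp.card_toMultiset]
      have h2 : (a.sum fun _ => id) = a.sum fun _ e => e := rfl
      omega
  exact key _ le_rfl

lemma Cubic_of_DegLE {P : (Fin m → ZMod 2) → ZMod 2} (h : DegLE 3 P) : Cubic P :=
  fun a b c d x => DegD_of_DegLE h d c b a x

lemma Cubic.add {V : Type} [AddCommGroup V] [Module (ZMod 2) V] [Fintype V] {P Q : V → ZMod 2} (hP : Cubic P) (hQ : Cubic Q) : Cubic (fun x => P x + Q x) :=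
  fun a b c d x => DegD.add 4 (fun d c b a x => hP a b c d x) (fun d c b a x => hQ a b c d x) d c b a x

lemma Cubic.const {V : Type} [AddCommGroup V] [Module (ZMod 2) V] [Fintype V] (t : ZMod 2) : Cubic (fun _ : V => t) := by
  intro a b c d x
  simp only [dd, zmod2_add_self]
end
end CL

namespace CL

lemma top_step {m n : ℕ} (P : Fin n → (Fin m → ZMod 2) → ZMod 2) (hP : ∀ i, Cubic (P i)) (s p r e Z : ℕ)
    (hp : p = s + 7) (hr : r = rr p) (he : e = gapE r + 1) (hZ : Z = 12 ^ (r + 1) * (r + 2 ^ r + e) + 1)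
    (hs : s + 1 ≤ e) (hn : 2 ^ p * 2 ^ (10 * Z * Z) ≤ n) : ov P ≤ (1/2:ℝ) ^ s := by
  classical
  set R : Fin n → Fin n → Prop := fun i j => (1/2:ℝ) ^ p < |Ex (fun x => chi (P i x + P j x))| with hR
  have hsym : ∀ i j, R i j → R j i := by
    intro i j h
    simp only [hR] at h ⊢
    simp_rw [add_comm (P j _)]
    exact h
  rcases greedy R hsym (2 ^ (10 * Z * Z)) (Nat.one_le_pow _ _ (by norm_num)) (2 ^ p) Finset.univ (by simpa using hn) with
    ⟨J, _, hJc, hJ⟩ | ⟨i1, _, J, _, hJc, hJ⟩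
  · have hne : J.Nonempty := by
      rw [← Finset.card_pos, hJc]; positivity
    have h := success P J hne (fun _ => 0) (1/3) ((1/2:ℝ) ^ p) (by norm_num) (by positivity) (by simp) (by
      intro i _; norm_num [abs_of_nonneg]) (by
      intro i hi j hj hij
      have h1 := hJ i hi j hj hij
      simp only [hR, not_lt] at h1
      simpa only [sub_zero, chi_add] using h1)
    refine h.trans ?_
    rw [hJc, hp]
    push_cast
    have h2 : (6:ℝ) / 2 ^ (s + 7) = 6 * (1/2:ℝ) ^ (s + 7) := by
      rw [one_div, inv_pow]; rfl
    rw [h2]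
    have h3 : (0:ℝ) < (1/2:ℝ) ^ s := by positivity
    rw [pow_add]
    set y := (1/2:ℝ) ^ s
    norm_num
    linarith
  · have hc := ov_cond P (fun a i x => if i ∈ J then (P i x + P i1 x) + a else P i x) (P i1) (by
      intro i x
      split_ifs
      · rw [add_assoc, zmod2_add_self, add_zero]
      · rfl) ((1/2:ℝ) ^ e) (by
      intro a
      refine main_ind r Z Z (r + 1) (r + 2 ^ r) e (by omega) (by omega) (by omega) _ n _ J hJc ?_
      intro i hi
      simp only [if_pos hi]
      have hcub : Cubic (fun x => (P i x + P i1 x) + a) := ((hP i).add (hP i1)).add (Cubic.const a)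
      obtain ⟨W, hW, hQ⟩ := bias_struct hcub p (by
        have h1 := hJ i hi
        simp only [hR] at h1
        simp_rw [chi_add _ a]
        rw [Ex_mul_right, abs_mul, chi_abs, mul_one]
        simp_rw [add_comm (P i _)]
        exact h1.le)
      rw [← hr] at hW
      exact init_TD hcub W r hW hQ)
    refine hc.trans ?_
    have h1 : (1/2:ℝ) ^ e ≤ (1/2:ℝ) ^ (s + 1) := pow_le_pow_of_le_one (by norm_num) (by norm_num) hs
    rw [pow_succ] at h1
    linarith

lemma rr_le (s : ℕ) (hs : 1 ≤ s) : rr (s + 7) ≤ 29568 * s ^ 2 := by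
  unfold rr
  nlinarith

lemma Z_le (r : ℕ) : 12 ^ (r + 1) * (r + 2 ^ r + (gapE r + 1)) + 1 ≤ 2 ^ (6 * r + 9) := by
  have h1 : r < 2 ^ r := Nat.lt_two_pow_self
  have h2 : 12 ^ (r + 1) ≤ 2 ^ (4 * r + 4) := by
    calc 12 ^ (r + 1) ≤ 16 ^ (r + 1) := Nat.pow_le_pow_left (by norm_num) _
      _ = 2 ^ (4 * r + 4) := by rw [show 16 = 2 ^ 4 by norm_num, ← pow_mul]; congr 1
  have h3 : r + 2 ^ r + (gapE r + 1) ≤ 16 * (2 ^ r) ^ 2 := by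
    unfold gapE
    set X := 2 ^ r
    have : 1 ≤ X := by omega
    nlinarith
  have h4 : 1 ≤ 12 ^ (r + 1) * (r + 2 ^ r + (gapE r + 1)) := Nat.mul_pos (by positivity) (by omega)
  have h5 := Nat.mul_le_mul h2 h3
  have h6 : 2 ^ (6 * r + 9) = 2 * (2 ^ (4 * r + 4) * (16 * (2 ^ r) ^ 2)) := by
    ring
  omega

lemma top : ∃ K : ℕ, 1 ≤ K ∧ ∀ (m n s : ℕ) (P : Fin n → (Fin m → ZMod 2) → ZMod 2), (∀ i, Cubic (P i)) →
    1 ≤ s → 2 ^ (2 ^ (K * s ^ 2)) ≤ n → ov P ≤ (1/2:ℝ) ^ s := by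
  refine ⟨35 * 29568, by norm_num, ?_⟩
  intro m n s P hP hs hn
  have hpr : s + 7 ≤ rr (s + 7) := by unfold rr; nlinarith
  have hrs := rr_le s hs
  have hZ := Z_le (rr (s + 7))
  set r := rr (s + 7) with hr
  have hge : r ≤ gapE r := by
    unfold gapE
    have : 0 < 2 ^ r := by positivity
    nlinarith
  refine top_step P hP s (s + 7) r (gapE r + 1) _ rfl hr rfl rfl (by omega) (le_trans ?_ hn)
  set Z := 12 ^ (r + 1) * (r + 2 ^ r + (gapE r + 1)) + 1
  rw [← pow_add]
  apply Nat.pow_le_pow_right (by norm_num)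
  have h1 : 10 * Z * Z ≤ 16 * (2 ^ (6 * r + 9) * 2 ^ (6 * r + 9)) := by
    have := Nat.mul_le_mul hZ hZ
    nlinarith
  have h2 : 16 * (2 ^ (6 * r + 9) * 2 ^ (6 * r + 9)) = 2 ^ (12 * r + 22) := by
    ring
  have h3 : r < 2 ^ r := Nat.lt_two_pow_self
  have h4 : 2 ^ r ≤ 2 ^ (12 * r + 22) := Nat.pow_le_pow_right (by norm_num) (by omega)
  have h5 : 2 ^ (12 * r + 23) = 2 * 2 ^ (12 * r + 22) := by ring
  have h6 : 2 ^ (12 * r + 23) ≤ 2 ^ (35 * 29568 * s ^ 2) := by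
    apply Nat.pow_le_pow_right (by norm_num)
    rw [mul_assoc]
    omega
  omega
end CL

/-- cubic distributions are `1 - 2^{-c·√(log₂ log₂ n)}`-far
from `Ber(1/3)^{⊗n}` for large enough `n`. -/
theorem cubic_lower_bound :
    ∃ c > (0:ℝ), ∃ n₀ : ℕ, ∀ n : ℕ, n₀ ≤ n → ∀ m : ℕ,
      ∀ P : Fin n → (Fin m → ZMod 2) → ZMod 2, (∀ i, DegLE 3 (P i)) →
        tvDist (outDist P) ber13 ≥
          1 - (2:ℝ) ^ (-(c * Real.sqrt (Real.logb 2 (Real.logb 2 (n:ℝ))))) := by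
  obtain ⟨K, hK, htop⟩ := CL.top
  have hK0 : (0:ℝ) < K := by exact_mod_cast hK
  have hsK : 0 < Real.sqrt K := Real.sqrt_pos.2 hK0
  refine ⟨1 / (2 * Real.sqrt K), by positivity, 2 ^ (2 ^ K), ?_⟩
  intro n hn m P hP
  have hnR : (2:ℝ) ^ (2 ^ K) ≤ (n:ℝ) := by exact_mod_cast hn
  have hn0 : (0:ℝ) < n := lt_of_lt_of_le (by positivity) hnR
  have hl1 : (2:ℝ) ^ K ≤ Real.logb 2 n := by
    rw [Real.le_logb_iff_rpow_le (by norm_num) hn0]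
    have : (2:ℝ) ^ ((2:ℝ) ^ K) = (2:ℝ) ^ (2 ^ K) := by
      rw [← Real.rpow_natCast 2 (2 ^ K)]; push_cast; rfl
    rw [this]; exact hnR
  set L := Real.logb 2 (n:ℝ) with hL
  have hL0 : 0 < L := lt_of_lt_of_le (by positivity) hl1
  have hl2 : (K:ℝ) ≤ Real.logb 2 L := by
    rw [Real.le_logb_iff_rpow_le (by norm_num) hL0, Real.rpow_natCast]; exact hl1
  set l := Real.logb 2 L with hl
  set t := Real.sqrt l / Real.sqrt K with ht
  have ht1 : 1 ≤ t := by
    rw [ht, le_div_iff₀ hsK, one_mul]; exact Real.sqrt_le_sqrt hl2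
  set s := ⌊t⌋₊ with hs
  have hs1 : 1 ≤ s := Nat.one_le_floor_iff _ |>.2 ht1
  have hst : (s:ℝ) ≤ t := Nat.floor_le (by linarith)
  have hts : t < s + 1 := Nat.lt_floor_add_one t
  have hs1R : (1:ℝ) ≤ s := by exact_mod_cast hs1
  have hle : ((K * s ^ 2 : ℕ) : ℝ) ≤ l := by
    have h1 : (s:ℝ) ^ 2 ≤ t ^ 2 := pow_le_pow_left₀ (by positivity) hst 2
    have h2 : t ^ 2 = l / K := by
      rw [ht, div_pow, Real.sq_sqrt (by linarith), Real.sq_sqrt hK0.le]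
    rw [h2, le_div_iff₀ hK0] at h1
    push_cast; linarith
  have hnn : 2 ^ (2 ^ (K * s ^ 2)) ≤ n := by
    rw [hl, Real.le_logb_iff_rpow_le (by norm_num) hL0, Real.rpow_natCast, hL,
      Real.le_logb_iff_rpow_le (by norm_num) hn0] at hle
    have : (2:ℝ) ^ ((2:ℝ) ^ (K * s ^ 2)) = (2:ℝ) ^ (2 ^ (K * s ^ 2)) := by
      rw [← Real.rpow_natCast 2 (2 ^ (K * s ^ 2))]; push_cast; rfl
    rw [this] at hle
    exact_mod_cast hle
  have hov := htop m n s P (fun i => CL.Cubic_of_DegLE (hP i)) hs1 hnn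
  rw [CL.tv_eq]
  have h1 : (1/2:ℝ) ^ s = (2:ℝ) ^ (-(s:ℝ)) := by
    rw [Real.rpow_neg (by norm_num), Real.rpow_natCast, one_div, inv_pow]
  have h2 : (2:ℝ) ^ (-(s:ℝ)) ≤ (2:ℝ) ^ (-(1 / (2 * Real.sqrt K) * Real.sqrt l)) := by
    apply Real.rpow_le_rpow_of_exponent_le (by norm_num)
    have : 1 / (2 * Real.sqrt K) * Real.sqrt l = t / 2 := by
      rw [ht]; field_simp
    rw [this]; linarith
  linarith
end
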